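/- arXiv:2310.08264 — 2 statements merged into one kernel-verified Lean document; each statement's English description precedes it below -/
import Mathlib

section
/- Let n ≥ 2 and 0 < μ < n. Suppose u ∈ Cⁿ(ℝⁿ) satisfies condition (B) and the integral equation (IE). Then u is a standard bubble: there exist a point x₀ ∈ ℝⁿ and constants ε > 0 and C₁ > 0 such that u(x) = ln( C₁ / (|x−x₀|² + ε²) ) for all x ∈ ℝⁿ. -/
open MeasureTheory Real Filter Metric

noncomputable section

/-- The nonlocal term `v(x) = ∫ e^{((2n-μ)/2) u(y)} / |x-y|^μ dy`. -/
noncomputable def V (n : ℕ) (μ : ℝ) (u : EuclideanSpace ℝ (Fin n) → ℝ)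
    (x : EuclideanSpace ℝ (Fin n)) : ℝ :=
  ∫ y : EuclideanSpace ℝ (Fin n),
    Real.exp ((2 * n - μ) / 2 * u y) / ‖x - y‖ ^ μ

/-- `βₙ = 2^{n-1} Γ(n/2+1) Γ(n/2) ωₙ` with `ωₙ` the volume of the unit ball in `ℝⁿ`. -/
noncomputable def betaN (n : ℕ) : ℝ :=
  2 ^ (n - 1) * Real.Gamma ((n : ℝ) / 2 + 1) * Real.Gamma ((n : ℝ) / 2) *
    (volume (Metric.ball (0 : EuclideanSpace ℝ (Fin n)) 1)).toReal

/-- Condition (B): finite weighted volume and finite total curvature. -/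
def CondB (n : ℕ) (μ : ℝ) (u : EuclideanSpace ℝ (Fin n) → ℝ) : Prop :=
  Integrable (fun y : EuclideanSpace ℝ (Fin n) => Real.exp ((2 * n - μ) / 2 * u y)) ∧
  Integrable (fun p : EuclideanSpace ℝ (Fin n) × EuclideanSpace ℝ (Fin n) =>
    Real.exp ((2 * n - μ) / 2 * u p.1) * Real.exp ((2 * n - μ) / 2 * u p.2) / ‖p.1 - p.2‖ ^ μ)

/-- The integral equation (IE). -/
def IE (n : ℕ) (μ : ℝ) (u : EuclideanSpace ℝ (Fin n) → ℝ) : Prop :=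
  ∃ C : ℝ, ∀ x : EuclideanSpace ℝ (Fin n), u x = (1 / betaN n) *
    (∫ y, Real.log ((‖y‖ + 1) / ‖x - y‖) * (V n μ u y * Real.exp ((2 * n - μ) / 2 * u y))) + C

/-- `α = (1/βₙ) ∫ v(y) e^{((2n-μ)/2) u(y)} dy`. -/
noncomputable def alphaC (n : ℕ) (μ : ℝ) (u : EuclideanSpace ℝ (Fin n) → ℝ) : ℝ :=
  (1 / betaN n) * ∫ y, V n μ u y * Real.exp ((2 * n - μ) / 2 * u y)

namespace LogPotential

variable {n : ℕ} {μ β : ℝ}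

local notation "𝔼" => EuclideanSpace ℝ (Fin n)

lemma integrableOn_ball_norm_rpow {s : ℝ} (hs0 : 0 ≤ s) (hs : s < n) (r : ℝ) :
    IntegrableOn (fun z : 𝔼 => ‖z‖ ^ (-s)) (ball 0 r) := by
  have hn : n ≠ 0 := by
    rintro rfl
    simp at hs
    linarith
  have : Nonempty (Fin n) := ⟨⟨0, Nat.pos_of_ne_zero hn⟩⟩
  have h := (integrableOn_fun_norm_addHaar (E := 𝔼) (μ := volume) (f := fun t : ℝ => t ^ (-s))
    (r := r)).2
  refine h ?_
  rcases le_or_gt r 0 with hr | hr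
  · simp [Set.Ioo_eq_empty (not_lt.2 hr)]
  have h1 : IntegrableOn (fun y : ℝ => y ^ ((n : ℝ) - 1 - s)) (Set.Ioo 0 r) :=
    (intervalIntegral.integrableOn_Ioo_rpow_iff hr).2 (by linarith)
  refine h1.congr_fun ?_ measurableSet_Ioo
  intro y hy
  have hn1 : ((n - 1 : ℕ) : ℝ) = (n : ℝ) - 1 := by
    rw [Nat.cast_sub (Nat.one_le_iff_ne_zero.2 hn)]; simp
  simp only [finrank_euclideanSpace, Fintype.card_fin, smul_eq_mul]
  rw [← rpow_natCast, hn1, ← rpow_add hy.1]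
  ring_nf

lemma norm_rpow_neg_le {s r : ℝ} (hs0 : 0 ≤ s) (hr : 0 < r) (z : 𝔼) :
    ‖z‖ ^ (-s) ≤ (ball (0 : 𝔼) r).indicator (fun z => ‖z‖ ^ (-s)) z + r ^ (-s) := by
  by_cases hz : z ∈ ball (0 : 𝔼) r
  · rw [Set.indicator_of_mem hz]
    have := rpow_nonneg hr.le (-s)
    linarith
  · rw [Set.indicator_of_notMem hz, zero_add]
    have : r ≤ ‖z‖ := by simpa using hz
    exact rpow_le_rpow_of_nonpos hr this (by linarith)

lemma integrable_indicator_norm_sub {s : ℝ} (hs0 : 0 ≤ s) (hs : s < n) (r : ℝ) (x : 𝔼) :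
    Integrable (fun y => (ball (0 : 𝔼) r).indicator (fun z => ‖z‖ ^ (-s)) (x - y)) :=
  (((integrable_indicator_iff measurableSet_ball).2
    (integrableOn_ball_norm_rpow hs0 hs r))).comp_sub_left x

lemma integral_indicator_norm_sub {s : ℝ} (r : ℝ) (x : 𝔼) :
    ∫ y, (ball (0 : 𝔼) r).indicator (fun z => ‖z‖ ^ (-s)) (x - y) =
      ∫ z in ball (0 : 𝔼) r, ‖z‖ ^ (-s) := by
  rw [integral_sub_left_eq_self (fun z => (ball (0 : 𝔼) r).indicator (fun z => ‖z‖ ^ (-s)) z),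
    integral_indicator measurableSet_ball]

lemma measurable_norm_sub_rpow (s : ℝ) (x : 𝔼) : Measurable (fun y : 𝔼 => ‖x - y‖ ^ s) := by
  fun_prop

lemma integrableOn_norm_sub_rpow {s : ℝ} (hs0 : 0 ≤ s) (hs : s < n) {A : Set 𝔼}
    (hA : volume A ≠ ⊤) (x : 𝔼) : IntegrableOn (fun y => ‖x - y‖ ^ (-s)) A := by
  have h1 : IntegrableOn (fun y => (ball (0 : 𝔼) 1).indicator (fun z => ‖z‖ ^ (-s)) (x - y)
      + 1 ^ (-s)) A :=
    (integrable_indicator_norm_sub hs0 hs 1 x).integrableOn.add (integrableOn_const hA)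
  refine h1.mono' (measurable_norm_sub_rpow _ x).aestronglyMeasurable ?_
  filter_upwards with y
  rw [Real.norm_of_nonneg (by positivity)]
  exact norm_rpow_neg_le hs0 one_pos _

lemma setIntegral_norm_sub_rpow_le {s r : ℝ} (hs0 : 0 ≤ s) (hs : s < n) (hr : 0 < r) {A : Set 𝔼}
    (hA : volume A ≠ ⊤) (x : 𝔼) :
    ∫ y in A, ‖x - y‖ ^ (-s) ≤ (∫ z in ball (0 : 𝔼) r, ‖z‖ ^ (-s)) + r ^ (-s) * volume.real A := by
  have h0 := integrable_indicator_norm_sub hs0 hs r x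
  calc ∫ y in A, ‖x - y‖ ^ (-s)
      ≤ ∫ y in A, ((ball (0 : 𝔼) r).indicator (fun z => ‖z‖ ^ (-s)) (x - y) + r ^ (-s)) := by
        refine integral_mono (integrableOn_norm_sub_rpow hs0 hs hA x)
          (h0.integrableOn.add (integrableOn_const hA)) ?_
        intro y
        exact norm_rpow_neg_le hs0 hr _
    _ = (∫ y in A, (ball (0 : 𝔼) r).indicator (fun z => ‖z‖ ^ (-s)) (x - y))
          + r ^ (-s) * volume.real A := by
        rw [integral_add h0.integrableOn (integrableOn_const hA), setIntegral_const, smul_eq_mul,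
          mul_comm (volume.real A)]
    _ ≤ _ := by
        gcongr
        rw [← integral_indicator_norm_sub r x]
        refine setIntegral_le_integral h0 ?_
        filter_upwards with y
        exact Set.indicator_nonneg (fun z _ => by positivity) _

lemma exists_setIntegral_norm_sub_rpow_le {s : ℝ} (hs0 : 0 ≤ s) (hs : s < n) {ε : ℝ}
    (hε : 0 < ε) : ∃ δ > 0, ∀ A : Set 𝔼, volume A ≠ ⊤ → volume.real A ≤ δ → ∀ x : 𝔼,
      ∫ y in A, ‖x - y‖ ^ (-s) ≤ ε := by
  have hlim : Tendsto (fun k : ℕ => ∫ z in ball (0 : 𝔼) (1 / ((k : ℝ) + 1)), ‖z‖ ^ (-s)) atTop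
      (nhds (∫ z in ⋂ k : ℕ, ball (0 : 𝔼) (1 / ((k : ℝ) + 1)), ‖z‖ ^ (-s))) := by
    refine tendsto_setIntegral_of_antitone (fun _ => measurableSet_ball) ?_
      ⟨0, integrableOn_ball_norm_rpow hs0 hs _⟩
    intro i j hij
    exact ball_subset_ball (Nat.one_div_le_one_div hij)
  have hzero : (⋂ k : ℕ, ball (0 : 𝔼) (1 / ((k : ℝ) + 1))) = {0} := by
    ext z
    simp only [Set.mem_iInter, mem_ball, dist_zero_right, Set.mem_singleton_iff]
    constructor
    · intro h
      by_contra hz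
      obtain ⟨k, hk⟩ := exists_nat_one_div_lt (norm_pos_iff.2 hz)
      exact absurd (h k) (not_lt.2 hk.le)
    · rintro rfl k
      rw [norm_zero]
      positivity
  have hn : Nontrivial 𝔼 := by
    have : n ≠ 0 := by
      rintro rfl
      simp at hs
      linarith
    have : Nonempty (Fin n) := ⟨⟨0, Nat.pos_of_ne_zero this⟩⟩
    infer_instance
  rw [hzero, setIntegral_measure_zero _ (by simp)] at hlim
  obtain ⟨k, hk⟩ := (hlim.eventually_lt_const (half_pos hε)).exists
  have hr : (0 : ℝ) < 1 / ((k : ℝ) + 1) := by positivity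
  have hr' := rpow_pos_of_pos hr (-s)
  refine ⟨ε / 2 / (1 / ((k : ℝ) + 1)) ^ (-s), by positivity, fun A hA hAδ x => ?_⟩
  have h1 := setIntegral_norm_sub_rpow_le hs0 hs hr hA x
  have h2 := mul_le_mul_of_nonneg_left hAδ hr'.le
  rw [mul_div_cancel₀ _ hr'.ne'] at h2
  linarith

/-- `h` is integrable and bounded on every ball. -/
structure LocBddIntegrable (h : 𝔼 → ℝ) : Prop where
  integrable : Integrable h
  bdd : ∀ R : ℝ, ∃ C : ℝ, 0 ≤ C ∧ ∀ x : 𝔼, ‖x‖ ≤ R → |h x| ≤ C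

lemma LocBddIntegrable.norm_mul_rpow_le {h : 𝔼 → ℝ} {s : ℝ} (hs0 : 0 ≤ s) {R C : ℝ}
    (hC : ∀ x : 𝔼, ‖x‖ ≤ R + 1 → |h x| ≤ C) {x : 𝔼} (hx : ‖x‖ ≤ R) (y : 𝔼) :
    |h y| * ‖x - y‖ ^ (-s) ≤
      C * (ball (0 : 𝔼) 1).indicator (fun z => ‖z‖ ^ (-s)) (x - y) + |h y| := by
  by_cases hz : x - y ∈ ball (0 : 𝔼) 1
  · rw [Set.indicator_of_mem hz]
    have h1 : ‖y‖ ≤ R + 1 := by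
      have h2 : ‖x - y‖ < 1 := by simpa using hz
      have h3 : ‖y‖ ≤ ‖x‖ + ‖x - y‖ := by
        have := norm_sub_le x (x - y)
        simpa using this
      linarith
    have h4 := mul_le_mul_of_nonneg_right (hC y h1) (rpow_nonneg (norm_nonneg (x - y)) (-s))
    have := abs_nonneg (h y)
    linarith
  · rw [Set.indicator_of_notMem hz, mul_zero, zero_add]
    have h1 : 1 ≤ ‖x - y‖ := by simpa using hz
    have h2 : ‖x - y‖ ^ (-s) ≤ 1 := rpow_le_one_of_one_le_of_nonpos h1 (by linarith)
    exact mul_le_of_le_one_right (abs_nonneg _) h2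

lemma LocBddIntegrable.integrable_mul_rpow {h : 𝔼 → ℝ} (H : LocBddIntegrable h) {s : ℝ}
    (hs0 : 0 ≤ s) (hs : s < n) (x : 𝔼) : Integrable (fun y => h y * ‖x - y‖ ^ (-s)) := by
  obtain ⟨C, -, hC⟩ := H.bdd (‖x‖ + 1)
  refine (((integrable_indicator_norm_sub hs0 hs 1 x).const_mul C).add H.integrable.abs).mono'
    (H.integrable.aestronglyMeasurable.mul (measurable_norm_sub_rpow _ x).aestronglyMeasurable) ?_
  filter_upwards with y
  rw [norm_mul, Real.norm_eq_abs, Real.norm_of_nonneg (by positivity)]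
  exact norm_mul_rpow_le hs0 hC le_rfl y

lemma LocBddIntegrable.exists_integral_mul_rpow_le {h : 𝔼 → ℝ} (H : LocBddIntegrable h) {s : ℝ}
    (hs0 : 0 ≤ s) (hs : s < n) (R : ℝ) :
    ∃ K : ℝ, 0 ≤ K ∧ ∀ x : 𝔼, ‖x‖ ≤ R → ∫ y, |h y| * ‖x - y‖ ^ (-s) ≤ K := by
  obtain ⟨C, hC0, hC⟩ := H.bdd (R + 1)
  refine ⟨C * (∫ z in ball (0 : 𝔼) 1, ‖z‖ ^ (-s)) + ∫ y, |h y|, ?_, fun x hx => ?_⟩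
  · have h1 : 0 ≤ ∫ z in ball (0 : 𝔼) 1, ‖z‖ ^ (-s) := integral_nonneg fun z => by positivity
    have h2 : 0 ≤ ∫ y, |h y| := integral_nonneg fun z => abs_nonneg _
    positivity
  rw [← integral_indicator_norm_sub 1 x, ← integral_const_mul,
    ← integral_add ((integrable_indicator_norm_sub hs0 hs 1 x).const_mul C) H.integrable.abs]
  refine integral_mono_of_nonneg (ae_of_all _ fun y => by positivity)
    (((integrable_indicator_norm_sub hs0 hs 1 x).const_mul C).add H.integrable.abs)
    (ae_of_all _ fun y => norm_mul_rpow_le hs0 hC hx y)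

/-- The weight `e^{((2n-μ)/2) u}`. -/
def dens (μ : ℝ) (u : 𝔼 → ℝ) (y : 𝔼) : ℝ := Real.exp ((2 * n - μ) / 2 * u y)

/-- The density `v e^{((2n-μ)/2) u}` of the logarithmic potential. -/
def charge (μ : ℝ) (u : 𝔼 → ℝ) (y : 𝔼) : ℝ := V n μ u y * dens μ u y

lemma dens_pos (μ : ℝ) (u : 𝔼 → ℝ) (y : 𝔼) : 0 < dens μ u y := Real.exp_pos _

lemma continuous_dens {u : 𝔼 → ℝ} (hu : Continuous u) : Continuous (dens μ u) := by
  unfold dens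
  fun_prop

lemma V_eq (u : 𝔼 → ℝ) (x : 𝔼) : V n μ u x = ∫ y, dens μ u y * ‖x - y‖ ^ (-μ) := by
  simp only [V, dens, div_eq_mul_inv]
  congr 1
  ext y
  rw [rpow_neg (norm_nonneg _)]

lemma V_nonneg (u : 𝔼 → ℝ) (x : 𝔼) : 0 ≤ V n μ u x := by
  rw [V_eq]
  exact integral_nonneg fun y => mul_nonneg (dens_pos μ u y).le (by positivity)

lemma charge_nonneg (u : 𝔼 → ℝ) (x : 𝔼) : 0 ≤ charge μ u x :=
  mul_nonneg (V_nonneg u x) (dens_pos μ u x).le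

lemma exists_bound_of_continuous {h : 𝔼 → ℝ} (hc : Continuous h) (R : ℝ) :
    ∃ C : ℝ, 0 ≤ C ∧ ∀ x : 𝔼, ‖x‖ ≤ R → |h x| ≤ C := by
  obtain ⟨C, hC⟩ := (isCompact_closedBall (0 : 𝔼) R).exists_bound_of_continuousOn hc.continuousOn
  refine ⟨max C 0, le_max_right _ _, fun x hx => le_max_of_le_left (hC x (by simpa using hx))⟩

lemma locBddIntegrable_dens {u : 𝔼 → ℝ} (hu : Continuous u) (hf : Integrable (dens μ u)) :
    LocBddIntegrable (dens μ u) :=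
  ⟨hf, exists_bound_of_continuous (continuous_dens hu)⟩

lemma log_le_aux {a d : ℝ} (ha : 0 ≤ a) (hd : 0 ≤ d) {t : ℝ} (ht : t ≤ d + a) (ht0 : 0 ≤ t) :
    Real.log (t / d) ≤ a * d ^ (-1 : ℝ) := by
  rcases hd.eq_or_lt with rfl | hd
  · simp only [div_zero, Real.log_zero]
    positivity
  rcases ht0.eq_or_lt with rfl | ht0
  · simp only [zero_div, Real.log_zero]
    positivity
  have h1 := Real.log_le_sub_one_of_pos (div_pos ht0 hd)
  have h2 : t / d - 1 ≤ a / d := by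
    rw [div_sub_one hd.ne']
    gcongr
    linarith
  rw [rpow_neg_one, ← div_eq_mul_inv]
  linarith

lemma abs_log_kernel_le (x y : 𝔼) :
    |Real.log ((‖y‖ + 1) / ‖x - y‖)| ≤ (‖x‖ + 1) * ‖x - y‖ ^ (-1 : ℝ) + ‖x‖ := by
  have hy := norm_nonneg y
  have hx := norm_nonneg x
  have hxy := norm_nonneg (x - y)
  have hr : 0 ≤ ‖x - y‖ ^ (-1 : ℝ) := by positivity
  rw [abs_le]
  constructor
  · have h1 : Real.log (‖x - y‖ / (‖y‖ + 1)) ≤ ‖x‖ * (‖y‖ + 1) ^ (-1 : ℝ) :=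
      log_le_aux hx (by positivity) (by linarith [norm_sub_le x y]) hxy
    have h2 : (‖y‖ + 1) ^ (-1 : ℝ) ≤ 1 :=
      rpow_le_one_of_one_le_of_nonpos (by linarith) (by norm_num)
    have h3 : Real.log ((‖y‖ + 1) / ‖x - y‖) = - Real.log (‖x - y‖ / (‖y‖ + 1)) := by
      rw [← Real.log_inv, inv_div]
    have h4 := mul_le_mul_of_nonneg_left h2 hx
    have h5 : 0 ≤ (‖x‖ + 1) * ‖x - y‖ ^ (-1 : ℝ) := by positivity
    linarith
  · have h1 := log_le_aux (a := ‖x‖ + 1) (d := ‖x - y‖) (t := ‖y‖ + 1) (by positivity) hxy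
      (by have := norm_sub_le x (x - y); simp at this; linarith) (by positivity)
    linarith

lemma LocBddIntegrable.integrable_log_mul {h : 𝔼 → ℝ} (H : LocBddIntegrable h) (hn : 2 ≤ n)
    (x : 𝔼) : Integrable (fun y => Real.log ((‖y‖ + 1) / ‖x - y‖) * h y) := by
  have hn1 : (1 : ℝ) < n := by exact_mod_cast hn
  have h1 := ((H.integrable_mul_rpow zero_le_one hn1 x).abs.const_mul (‖x‖ + 1)).add
    (H.integrable.abs.const_mul ‖x‖)
  refine h1.mono' ?_ ?_
  · exact (by fun_prop : Measurable fun y : 𝔼 =>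
      Real.log ((‖y‖ + 1) / ‖x - y‖)).aestronglyMeasurable.mul H.integrable.aestronglyMeasurable
  filter_upwards with y
  rw [norm_mul, Real.norm_eq_abs, Real.norm_eq_abs]
  have h2 := mul_le_mul_of_nonneg_right (abs_log_kernel_le x y) (abs_nonneg (h y))
  have h3 : 0 ≤ ‖x - y‖ ^ (-1 : ℝ) := by positivity
  simp only [Pi.add_apply, abs_mul, abs_of_nonneg h3]
  linarith

lemma ae_ne [NeZero n] (x : 𝔼) : ∀ᵐ y : 𝔼, y ≠ x := by
  have : Nonempty (Fin n) := ⟨0⟩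
  have : Nontrivial 𝔼 := inferInstance
  exact Measure.ae_ne volume x

lemma log_kernel_sub {x y z : 𝔼} (hx : y ≠ x) (hz : y ≠ z) :
    Real.log (‖z - y‖ / ‖x - y‖) =
      Real.log ((‖y‖ + 1) / ‖x - y‖) - Real.log ((‖y‖ + 1) / ‖z - y‖) := by
  have h1 : ‖x - y‖ ≠ 0 := norm_ne_zero_iff.2 (sub_ne_zero.2 hx.symm)
  have h2 : ‖z - y‖ ≠ 0 := norm_ne_zero_iff.2 (sub_ne_zero.2 hz.symm)
  have h3 : ‖y‖ + 1 ≠ 0 := by positivity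
  rw [Real.log_div h2 h1, Real.log_div h3 h1, Real.log_div h3 h2]
  ring

lemma log_kernel_sub_ae (hn : 2 ≤ n) (h : 𝔼 → ℝ) (x z : 𝔼) :
    (fun y => Real.log (‖z - y‖ / ‖x - y‖) * h y) =ᵐ[volume] fun y =>
      Real.log ((‖y‖ + 1) / ‖x - y‖) * h y - Real.log ((‖y‖ + 1) / ‖z - y‖) * h y := by
  have : NeZero n := ⟨by omega⟩
  filter_upwards [ae_ne x, ae_ne z] with y hx hz
  rw [log_kernel_sub hx hz, sub_mul]

lemma LocBddIntegrable.integrable_log_sub_mul {h : 𝔼 → ℝ} (H : LocBddIntegrable h) (hn : 2 ≤ n)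
    (x z : 𝔼) : Integrable (fun y => Real.log (‖z - y‖ / ‖x - y‖) * h y) :=
  ((H.integrable_log_mul hn x).sub (H.integrable_log_mul hn z)).congr
    (log_kernel_sub_ae hn h x z).symm

/-- Translation-invariant form of the integral equation, with its basic integrability
consequences. -/
structure IsSol (n : ℕ) (μ β : ℝ) (u : EuclideanSpace ℝ (Fin n) → ℝ) : Prop where
  cont : Continuous u
  dens_integrable : Integrable (dens μ u)
  charge_lbi : LocBddIntegrable (charge μ u)
  diff : ∀ x z, u x - u z = (1 / β) * ∫ y, Real.log (‖z - y‖ / ‖x - y‖) * charge μ u y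

lemma exists_V_le (hμ0 : 0 ≤ μ) (hμn : μ < n) {u : 𝔼 → ℝ} (hu : Continuous u)
    (hf : Integrable (dens μ u)) (R : ℝ) :
    ∃ K : ℝ, 0 ≤ K ∧ ∀ x : 𝔼, ‖x‖ ≤ R → V n μ u x ≤ K := by
  obtain ⟨K, hK0, hK⟩ := (locBddIntegrable_dens hu hf).exists_integral_mul_rpow_le hμ0 hμn R
  refine ⟨K, hK0, fun x hx => ?_⟩
  have := hK x hx
  simp only [abs_of_pos (dens_pos μ u _)] at this
  rwa [V_eq]

lemma V_pos (hn : 2 ≤ n) (hμ0 : 0 ≤ μ) (hμn : μ < n) {u : 𝔼 → ℝ} (hu : Continuous u)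
    (hf : Integrable (dens μ u)) (x : 𝔼) : 0 < V n μ u x := by
  have : NeZero n := ⟨by omega⟩
  rw [V_eq]
  refine (integral_pos_iff_support_of_nonneg (fun y => mul_nonneg (dens_pos μ u y).le
    (by positivity)) ((locBddIntegrable_dens hu hf).integrable_mul_rpow hμ0 hμn x)).2 ?_
  refine lt_of_lt_of_le ?_ (measure_mono (s := ball x 1 \ {x}) ?_)
  · have : Nonempty (Fin n) := ⟨0⟩
    have : Nontrivial 𝔼 := inferInstance
    rw [measure_sdiff_null (by simp)]
    exact measure_ball_pos _ _ one_pos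
  · intro y hy
    have : 0 < ‖x - y‖ := norm_pos_iff.2 (sub_ne_zero.2 fun h => hy.2 h.symm)
    exact (mul_pos (dens_pos μ u y) (rpow_pos_of_pos this _)).ne'

lemma charge_integrable {u : 𝔼 → ℝ} (hB : CondB n μ u) : Integrable (charge μ u) := by
  refine hB.2.integral_prod_left.congr (ae_of_all _ fun x => ?_)
  simp only [charge, V, dens]
  rw [← integral_mul_const]
  congr 1
  ext y
  ring

lemma integral_charge {u : 𝔼 → ℝ} (hB : CondB n μ u) :
    ∫ p : 𝔼 × 𝔼, dens μ u p.1 * dens μ u p.2 / ‖p.1 - p.2‖ ^ μ = ∫ x, charge μ u x := by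
  have := integral_prod _ hB.2
  simp only [← Measure.volume_eq_prod] at this
  refine this.trans ?_
  congr 1
  ext x
  simp only [charge, V, dens]
  rw [← integral_mul_const]
  congr 1
  ext y
  ring

lemma isSol_of_IE (hn : 2 ≤ n) (hμ0 : 0 < μ) (hμn : μ < n) {u : 𝔼 → ℝ} (hu : Continuous u)
    (hB : CondB n μ u) (hIE : IE n μ u) : IsSol n μ (betaN n) u := by
  have hg : LocBddIntegrable (charge μ u) := by
    refine ⟨charge_integrable hB, fun R => ?_⟩
    obtain ⟨K, hK0, hK⟩ := exists_V_le hμ0.le hμn hu hB.1 R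
    obtain ⟨C, hC0, hC⟩ := exists_bound_of_continuous (continuous_dens (μ := μ) hu) R
    refine ⟨K * C, by positivity, fun x hx => ?_⟩
    rw [charge, abs_mul, abs_of_nonneg (V_nonneg u x)]
    exact mul_le_mul (hK x hx) (hC x hx) (abs_nonneg _) hK0
  refine ⟨hu, hB.1, hg, fun x z => ?_⟩
  obtain ⟨C, hC⟩ := hIE
  have h1 := hC x
  have h2 := hC z
  rw [h1, h2, integral_congr_ae (log_kernel_sub_ae hn _ x z),
    integral_sub (hg.integrable_log_mul hn x) (hg.integrable_log_mul hn z)]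
  simp only [charge, dens]
  ring

lemma V_comp_add (u : 𝔼 → ℝ) (a x : 𝔼) : V n μ (fun y => u (y + a)) x = V n μ u (x + a) := by
  rw [V, V, ← integral_add_right_eq_self
    (fun y => Real.exp ((2 * n - μ) / 2 * u y) / ‖x + a - y‖ ^ μ) a]
  simp

lemma charge_comp_add (u : 𝔼 → ℝ) (a x : 𝔼) :
    charge μ (fun y => u (y + a)) x = charge μ u (x + a) := by
  simp [charge, V_comp_add, dens]

lemma IsSol.comp_add {u : 𝔼 → ℝ} (h : IsSol n μ β u) (a : 𝔼) :
    IsSol n μ β (fun y => u (y + a)) := by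
  refine ⟨h.cont.comp (by fun_prop), h.dens_integrable.comp_add_right a, ⟨?_, fun R => ?_⟩,
    fun x z => ?_⟩
  · exact (h.charge_lbi.integrable.comp_add_right a).congr
      (ae_of_all _ fun x => (charge_comp_add u a x).symm)
  · obtain ⟨C, hC0, hC⟩ := h.charge_lbi.bdd (R + ‖a‖)
    refine ⟨C, hC0, fun x hx => ?_⟩
    rw [charge_comp_add]
    exact hC _ ((norm_add_le _ _).trans (by linarith))
  · rw [h.diff (x + a) (z + a), ← integral_add_right_eq_self
      (fun y => Real.log (‖z + a - y‖ / ‖x + a - y‖) * charge μ u y) a]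
    simp [charge_comp_add]

lemma integral_charge_comp_add (u : 𝔼 → ℝ) (a : 𝔼) :
    ∫ y, charge μ (fun y => u (y + a)) y = ∫ y, charge μ u y := by
  simp only [charge_comp_add]
  exact integral_add_right_eq_self _ a

lemma betaN_pos (hn : 2 ≤ n) : 0 < betaN n := by
  have hn0 : (0 : ℝ) < n := by exact_mod_cast (by omega : 0 < n)
  have h1 := Real.Gamma_pos_of_pos (s := (n : ℝ) / 2 + 1) (by positivity)
  have h2 := Real.Gamma_pos_of_pos (s := (n : ℝ) / 2) (by positivity)
  have h3 : 0 < (volume (Metric.ball (0 : 𝔼) 1)).toReal :=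
    ENNReal.toReal_pos (measure_ball_pos _ _ one_pos).ne' measure_ball_lt_top.ne
  unfold betaN
  positivity

/-- Inversion in the sphere of radius `l` centred at the origin. -/
abbrev inv0 (l : ℝ) (y : 𝔼) : 𝔼 := EuclideanGeometry.inversion (0 : 𝔼) l y

lemma inv0_eq (l : ℝ) (y : 𝔼) : inv0 l y = (l / ‖y‖) ^ 2 • y := by
  simp [inv0, EuclideanGeometry.inversion]

lemma inv0_ne_zero {l : ℝ} (hl : 0 < l) {y : 𝔼} (hy : y ≠ 0) : inv0 l y ≠ 0 := by
  rwa [Ne, EuclideanGeometry.inversion_eq_center hl.ne']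

lemma norm_inv0 (l : ℝ) (y : 𝔼) : ‖inv0 l y‖ = l ^ 2 / ‖y‖ := by
  simpa using EuclideanGeometry.dist_inversion_center (0 : 𝔼) y l

lemma inv0_inv0 {l : ℝ} (hl : 0 < l) (y : 𝔼) : inv0 l (inv0 l y) = y :=
  EuclideanGeometry.inversion_inversion _ hl.ne' y

lemma measurable_inv0 (l : ℝ) : Measurable (inv0 l : 𝔼 → 𝔼) := by
  have : (inv0 l : 𝔼 → 𝔼) = fun y => (l / ‖y‖) ^ 2 • y := funext (inv0_eq l)
  rw [this]
  fun_prop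

lemma abs_det_inv0 (l : ℝ) (x : 𝔼) :
    |(((l / dist x 0) ^ 2 • ((Submodule.span ℝ {x - 0})ᗮ.reflection : 𝔼 →L[ℝ] 𝔼)).det)| =
      (l / ‖x‖) ^ (2 * n) := by
  rw [ContinuousLinearMap.det, ContinuousLinearMap.toLinearMap_smul, LinearMap.det_smul, abs_mul]
  have h : |LinearMap.det (((Submodule.span ℝ {x - 0})ᗮ.reflection : 𝔼 →L[ℝ] 𝔼) : 𝔼 →ₗ[ℝ] 𝔼)|
      = 1 := by
    have h1 := Submodule.det_reflection (K := (Submodule.span ℝ {x - 0})ᗮ)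
    have h2 : |LinearMap.det (Submodule.span ℝ {x - 0})ᗮ.reflection.toLinearMap| = 1 := by
      rw [h1, abs_pow]
      simp
    exact h2
  rw [h, mul_one, dist_zero_right, ← pow_mul, abs_of_nonneg]
  · simp
  · simp only [finrank_euclideanSpace, Fintype.card_fin]
    rw [pow_mul]
    positivity

lemma image_inv0 {l : ℝ} (hl : 0 < l) :
    inv0 l '' (ball (0 : 𝔼) l \ {0}) = (closedBall (0 : 𝔼) l)ᶜ := by
  ext z
  simp only [Set.mem_image, Set.mem_sdiff, mem_ball, dist_zero_right, Set.mem_singleton_iff,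
    Set.mem_compl_iff, mem_closedBall, not_le]
  constructor
  · rintro ⟨y, ⟨hy, hy0⟩, rfl⟩
    rw [norm_inv0, lt_div_iff₀ (norm_pos_iff.2 hy0), sq]
    gcongr
  · intro hz
    have hz0 : z ≠ 0 := norm_pos_iff.1 (hl.trans hz)
    refine ⟨inv0 l z, ⟨?_, inv0_ne_zero hl hz0⟩, inv0_inv0 hl z⟩
    rw [norm_inv0, div_lt_iff₀ (hl.trans hz), sq]
    gcongr

lemma ball_diff_ae [NeZero n] (l : ℝ) :
    (ball (0 : 𝔼) l \ {0} : Set 𝔼) =ᵐ[volume] ball (0 : 𝔼) l := by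
  have : Nonempty (Fin n) := ⟨0⟩
  exact sdiff_null_ae_eq_self (by simp)

lemma hasFDerivWithinAt_inv0 (l : ℝ) : ∀ x ∈ ball (0 : 𝔼) l \ {0}, HasFDerivWithinAt (inv0 l)
    ((l / dist x 0) ^ 2 • ((Submodule.span ℝ {x - 0})ᗮ.reflection : 𝔼 →L[ℝ] 𝔼))
    (ball (0 : 𝔼) l \ {0}) x := fun _ hx =>
  (EuclideanGeometry.hasFDerivAt_inversion hx.2).hasFDerivWithinAt

lemma integrableOn_inv0 [NeZero n] {l : ℝ} (hl : 0 < l) {F : 𝔼 → ℝ} (hF : Integrable F) :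
    IntegrableOn (fun y => (l / ‖y‖) ^ (2 * n) * F (inv0 l y)) (ball 0 l) := by
  have h := (integrableOn_image_iff_integrableOn_abs_det_fderiv_smul volume
    (measurableSet_ball.diff (measurableSet_singleton 0)) (hasFDerivWithinAt_inv0 (n := n) l)
    (EuclideanGeometry.inversion_injective (0 : 𝔼) hl.ne').injOn F).1 hF.integrableOn
  simp only [abs_det_inv0, smul_eq_mul] at h
  exact h.congr_set_ae (ball_diff_ae l).symm

lemma integral_eq_setIntegral_ball [NeZero n] {l : ℝ} (hl : 0 < l) {F : 𝔼 → ℝ}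
    (hF : Integrable F) :
    ∫ y, F y = ∫ y in ball (0 : 𝔼) l, (F y + (l / ‖y‖) ^ (2 * n) * F (inv0 l y)) := by
  have : Nonempty (Fin n) := ⟨0⟩
  have h := integral_image_eq_integral_abs_det_fderiv_smul volume
    (measurableSet_ball.diff (measurableSet_singleton 0)) (hasFDerivWithinAt_inv0 (n := n) l)
    (EuclideanGeometry.inversion_injective (0 : 𝔼) hl.ne').injOn F
  simp only [abs_det_inv0, smul_eq_mul] at h
  rw [setIntegral_congr_set (ball_diff_ae l), image_inv0 hl] at h
  rw [integral_add hF.integrableOn (integrableOn_inv0 hl hF), ← h,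
    ← integral_add_compl measurableSet_closedBall hF]
  congr 1
  refine setIntegral_congr_set ?_
  exact (ae_eq_of_subset_of_measure_ge ball_subset_closedBall
    (Measure.addHaar_closedBall_eq_addHaar_ball volume (0 : 𝔼) l).le
    measurableSet_ball.nullMeasurableSet measure_closedBall_lt_top.ne).symm

/-- The kernel `‖y‖ ‖x - y*‖ / l`, where `y*` is the inverse point of `y`. -/
def refl (l : ℝ) (x y : 𝔼) : ℝ := ‖y‖ * ‖x - inv0 l y‖ / l

lemma norm_sub_inv0 {l : ℝ} (hl : 0 < l) {x y : 𝔼} (hy : y ≠ 0) :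
    ‖x - inv0 l y‖ = refl l x y * (l / ‖y‖) := by
  have : ‖y‖ ≠ 0 := norm_ne_zero_iff.2 hy
  rw [refl]
  field_simp

lemma norm_inv0_sub {l : ℝ} (hl : 0 < l) {x y : 𝔼} (hx : x ≠ 0) (hy : y ≠ 0) :
    ‖inv0 l x - y‖ = refl l x y * (l / ‖x‖) := by
  have h1 : ‖x‖ ≠ 0 := norm_ne_zero_iff.2 hx
  have h := EuclideanGeometry.dist_inversion_mul_dist_center_eq (R := l) hx hy
  simp only [dist_eq_norm, sub_zero] at h
  rw [refl]
  field_simp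
  rw [h]
  ring

lemma norm_inv0_sub_inv0 {l : ℝ} {x y : 𝔼} (hx : x ≠ 0) (hy : y ≠ 0) :
    ‖inv0 l x - inv0 l y‖ = l / ‖x‖ * (l / ‖y‖) * ‖x - y‖ := by
  have h := EuclideanGeometry.dist_inversion_inversion hx hy l
  simp only [dist_eq_norm, sub_zero] at h
  rw [h]
  have h1 : ‖x‖ ≠ 0 := norm_ne_zero_iff.2 hx
  have h2 : ‖y‖ ≠ 0 := norm_ne_zero_iff.2 hy
  field_simp

lemma refl_nonneg {l : ℝ} (hl : 0 < l) (x y : 𝔼) : 0 ≤ refl l x y := by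
  unfold refl
  positivity

lemma refl_le {l : ℝ} (hl : 0 < l) {x y : 𝔼} (hx : ‖x‖ ≤ l) (hy : ‖y‖ ≤ l) (hy0 : y ≠ 0) :
    refl l x y ≤ 2 * l := by
  have h2 : 0 < ‖y‖ := norm_pos_iff.2 hy0
  have h1 := norm_sub_le x (inv0 l y)
  rw [norm_inv0] at h1
  rw [refl, div_le_iff₀ hl]
  calc ‖y‖ * ‖x - inv0 l y‖ ≤ ‖y‖ * (‖x‖ + l ^ 2 / ‖y‖) := by gcongr
    _ = ‖y‖ * ‖x‖ + l ^ 2 := by field_simp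
    _ ≤ l * l + l ^ 2 := by gcongr
    _ = 2 * l * l := by ring

lemma refl_sq {l : ℝ} (hl : 0 < l) {x y : 𝔼} (hy0 : y ≠ 0) :
    refl l x y ^ 2 = ‖x - y‖ ^ 2 + (l ^ 2 - ‖x‖ ^ 2) * (l ^ 2 - ‖y‖ ^ 2) / l ^ 2 := by
  have h2 : ‖y‖ ≠ 0 := norm_ne_zero_iff.2 hy0
  rw [refl, div_pow, mul_pow, inv0_eq, norm_sub_sq_real, norm_sub_sq_real, inner_smul_right,
    norm_smul, Real.norm_of_nonneg (by positivity)]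
  field_simp
  ring

lemma norm_sub_lt_refl {l : ℝ} (hl : 0 < l) {x y : 𝔼} (hx : ‖x‖ < l) (hy : ‖y‖ < l)
    (hy0 : y ≠ 0) : ‖x - y‖ < refl l x y := by
  refine lt_of_pow_lt_pow_left₀ 2 (refl_nonneg hl x y) ?_
  rw [refl_sq hl hy0]
  have h1 : ‖x‖ ^ 2 < l ^ 2 := by gcongr
  have h2 : ‖y‖ ^ 2 < l ^ 2 := by gcongr
  have : 0 < (l ^ 2 - ‖x‖ ^ 2) * (l ^ 2 - ‖y‖ ^ 2) / l ^ 2 :=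
    div_pos (mul_pos (by linarith) (by linarith)) (by positivity)
  linarith

/-- The conformal reflection of `u` in the sphere of radius `l`. -/
def kelvin (l : ℝ) (u : 𝔼 → ℝ) (x : 𝔼) : ℝ := u (inv0 l x) + 2 * Real.log (l / ‖x‖)

/-- The reflection of the nonlocal term. -/
def kelvinV (μ l : ℝ) (u : 𝔼 → ℝ) (x : 𝔼) : ℝ := (l / ‖x‖) ^ μ * V n μ u (inv0 l x)

/-- The reflection of the charge density. -/
def kelvinCharge (μ l : ℝ) (u : 𝔼 → ℝ) (x : 𝔼) : ℝ :=
  (l / ‖x‖) ^ (2 * n) * charge μ u (inv0 l x)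

lemma dens_kelvin {l : ℝ} (hl : 0 < l) (u : 𝔼 → ℝ) {y : 𝔼} (hy : y ≠ 0) :
    dens μ (kelvin l u) y = (l / ‖y‖) ^ (2 * n - μ) * dens μ u (inv0 l y) := by
  have h : 0 < l / ‖y‖ := div_pos hl (norm_pos_iff.2 hy)
  rw [dens, dens, kelvin, rpow_def_of_pos h, ← Real.exp_add]
  ring_nf

lemma pow_mul_dens_inv0 {l : ℝ} (hl : 0 < l) (u : 𝔼 → ℝ) {y : 𝔼} (hy : y ≠ 0) :
    (l / ‖y‖) ^ (2 * n) * dens μ u (inv0 l y) = (l / ‖y‖) ^ μ * dens μ (kelvin l u) y := by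
  have h : 0 < l / ‖y‖ := div_pos hl (norm_pos_iff.2 hy)
  rw [dens_kelvin hl u hy, ← mul_assoc, ← rpow_add h, ← rpow_natCast]
  push_cast
  ring_nf

lemma kelvinCharge_eq {l : ℝ} (hl : 0 < l) (u : 𝔼 → ℝ) {y : 𝔼} (hy : y ≠ 0) :
    kelvinCharge μ l u y = kelvinV μ l u y * dens μ (kelvin l u) y := by
  have := pow_mul_dens_inv0 (μ := μ) hl u hy
  rw [kelvinCharge, charge, kelvinV]
  linear_combination (V n μ u (inv0 l y)) * this

lemma kelvinV_nonneg {l : ℝ} (hl : 0 < l) (u : 𝔼 → ℝ) (y : 𝔼) : 0 ≤ kelvinV μ l u y :=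
  mul_nonneg (by positivity) (V_nonneg u _)

lemma rpow_mul_refl_rpow {l : ℝ} (hl : 0 < l) {x y : 𝔼} (hy : y ≠ 0) :
    (l / ‖y‖) ^ μ * ‖x - inv0 l y‖ ^ (-μ) = refl l x y ^ (-μ) := by
  have h : 0 < l / ‖y‖ := div_pos hl (norm_pos_iff.2 hy)
  rw [norm_sub_inv0 hl hy, mul_rpow (refl_nonneg hl x y) h.le, rpow_neg h.le]
  field_simp

lemma V_sub_kelvinV (hn : 2 ≤ n) (hμ0 : 0 ≤ μ) (hμn : μ < n) {u : 𝔼 → ℝ} (hu : Continuous u)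
    (hf : Integrable (dens μ u)) {l : ℝ} (hl : 0 < l) {x : 𝔼} (hx : x ≠ 0) :
    IntegrableOn (fun y => (‖x - y‖ ^ (-μ) - refl l x y ^ (-μ)) *
      (dens μ u y - dens μ (kelvin l u) y)) (ball 0 l) ∧
    V n μ u x - kelvinV μ l u x = ∫ y in ball (0 : 𝔼) l,
      (‖x - y‖ ^ (-μ) - refl l x y ^ (-μ)) * (dens μ u y - dens μ (kelvin l u) y) := by
  have : NeZero n := ⟨by omega⟩
  have hL := locBddIntegrable_dens hu hf
  have hx' : 0 < l / ‖x‖ := div_pos hl (norm_pos_iff.2 hx)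
  have i1 := hL.integrable_mul_rpow hμ0 hμn x
  have i2 := hL.integrable_mul_rpow hμ0 hμn (inv0 l x)
  have j1 := (i1.integrableOn (s := ball 0 l)).add (integrableOn_inv0 hl i1)
  have j2 := ((i2.integrableOn (s := ball 0 l)).add (integrableOn_inv0 hl i2)).const_mul
    ((l / ‖x‖) ^ μ)
  have key : ∀ᵐ y ∂(volume.restrict (ball (0 : 𝔼) l)),
      (‖x - y‖ ^ (-μ) - refl l x y ^ (-μ)) * (dens μ u y - dens μ (kelvin l u) y) =
      (dens μ u y * ‖x - y‖ ^ (-μ) +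
        (l / ‖y‖) ^ (2 * n) * (dens μ u (inv0 l y) * ‖x - inv0 l y‖ ^ (-μ))) -
      (l / ‖x‖) ^ μ * (dens μ u y * ‖inv0 l x - y‖ ^ (-μ) +
        (l / ‖y‖) ^ (2 * n) * (dens μ u (inv0 l y) * ‖inv0 l x - inv0 l y‖ ^ (-μ))) := by
    filter_upwards [ae_restrict_of_ae (ae_ne (0 : 𝔼))] with y hy
    have hy' : 0 < l / ‖y‖ := div_pos hl (norm_pos_iff.2 hy)
    have e1 := pow_mul_dens_inv0 (μ := μ) hl u hy
    have e2 := rpow_mul_refl_rpow (μ := μ) hl (x := x) hy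
    have e3 : (l / ‖x‖) ^ μ * ‖inv0 l x - y‖ ^ (-μ) = refl l x y ^ (-μ) := by
      rw [norm_inv0_sub hl hx hy, mul_rpow (refl_nonneg hl x y) hx'.le, rpow_neg hx'.le]
      field_simp
    have e4 : (l / ‖x‖) ^ μ * (l / ‖y‖) ^ μ * ‖inv0 l x - inv0 l y‖ ^ (-μ) =
        ‖x - y‖ ^ (-μ) := by
      rw [norm_inv0_sub_inv0 hx hy, mul_rpow (by positivity) (norm_nonneg _),
        mul_rpow hx'.le hy'.le, rpow_neg hx'.le, rpow_neg hy'.le]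
      field_simp
    rw [← e4, ← e2]
    linear_combination (-‖x - inv0 l y‖ ^ (-μ) + (l / ‖x‖) ^ μ *
      ‖inv0 l x - inv0 l y‖ ^ (-μ)) * e1 +
      dens μ u y * e3 - dens μ u y * e2
  refine ⟨(j1.sub j2).congr (key.mono fun y hy => hy.symm), ?_⟩
  rw [integral_congr_ae key, kelvinV, V_eq, V_eq, integral_eq_setIntegral_ball hl i1,
    integral_eq_setIntegral_ball hl i2, ← integral_const_mul]
  exact (integral_sub j1 j2).symm

lemma IsSol.sub_kelvin {u : 𝔼 → ℝ} (h : IsSol n μ β u) (hn : 2 ≤ n) (hβ : 0 < β)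
    (hM : ∫ y, charge μ u y = 2 * β) {l : ℝ} (hl : 0 < l) {x : 𝔼} (hx : x ≠ 0) (hxl : ‖x‖ < l) :
    IntegrableOn (fun y => Real.log (refl l x y / ‖x - y‖) *
      (charge μ u y - kelvinCharge μ l u y)) (ball 0 l) ∧
    u x - kelvin l u x = (1 / β) * ∫ y in ball (0 : 𝔼) l,
      Real.log (refl l x y / ‖x - y‖) * (charge μ u y - kelvinCharge μ l u y) := by
  have : NeZero n := ⟨by omega⟩
  have hx' : 0 < l / ‖x‖ := div_pos hl (norm_pos_iff.2 hx)
  have i1 := h.charge_lbi.integrable_log_sub_mul hn x (inv0 l x)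
  have i2 := h.charge_lbi.integrable
  have j1 := (i1.integrableOn (s := ball 0 l)).add (integrableOn_inv0 hl i1)
  have j2 := ((i2.integrableOn (s := ball 0 l)).add (integrableOn_inv0 hl i2)).const_mul
    (Real.log (l / ‖x‖))
  have key : ∀ᵐ y ∂(volume.restrict (ball (0 : 𝔼) l)),
      Real.log (refl l x y / ‖x - y‖) * (charge μ u y - kelvinCharge μ l u y) =
      (Real.log (‖inv0 l x - y‖ / ‖x - y‖) * charge μ u y + (l / ‖y‖) ^ (2 * n) *
        (Real.log (‖inv0 l x - inv0 l y‖ / ‖x - inv0 l y‖) * charge μ u (inv0 l y))) -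
      Real.log (l / ‖x‖) * (charge μ u y + (l / ‖y‖) ^ (2 * n) * charge μ u (inv0 l y)) := by
    filter_upwards [ae_restrict_of_ae (ae_ne (0 : 𝔼)), ae_restrict_of_ae (ae_ne x),
      ae_restrict_mem measurableSet_ball] with y hy hyx hyl
    have hyl : ‖y‖ < l := by simpa using hyl
    have hy' : 0 < l / ‖y‖ := div_pos hl (norm_pos_iff.2 hy)
    have p1 : 0 < ‖x - y‖ := norm_pos_iff.2 (sub_ne_zero.2 hyx.symm)
    have p2 : 0 < refl l x y := p1.trans (norm_sub_lt_refl hl hxl hyl hy)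
    have e1 : Real.log (‖inv0 l x - y‖ / ‖x - y‖) =
        Real.log (refl l x y / ‖x - y‖) + Real.log (l / ‖x‖) := by
      rw [norm_inv0_sub hl hx hy, ← Real.log_mul (by positivity) hx'.ne']
      congr 1
      ring
    have e2 : Real.log (‖inv0 l x - inv0 l y‖ / ‖x - inv0 l y‖) =
        -Real.log (refl l x y / ‖x - y‖) + Real.log (l / ‖x‖) := by
      rw [norm_inv0_sub_inv0 hx hy, norm_sub_inv0 hl hy, ← Real.log_inv,
        ← Real.log_mul (by positivity) hx'.ne']
      congr 1
      have := norm_ne_zero_iff.2 hy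
      field_simp
    rw [e1, e2, kelvinCharge]
    ring
  refine ⟨(j1.sub j2).congr (key.mono fun y hy => hy.symm), ?_⟩
  have e3 := integral_eq_setIntegral_ball hl i1
  have e4 := integral_eq_setIntegral_ball hl i2
  have e5 := integral_sub j1 j2
  simp only [Pi.add_apply] at e5
  rw [integral_congr_ae key, e5, ← e3, integral_const_mul, ← e4, hM, mul_sub, ← h.diff, kelvin]
  field_simp
  ring

/-- The set where `u` exceeds its reflection inside the ball of radius `l`. -/
def badSet (l : ℝ) (u : 𝔼 → ℝ) : Set 𝔼 := {x | x ∈ ball (0 : 𝔼) l ∧ x ≠ 0 ∧ kelvin l u x < u x}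

lemma measurable_kelvin {u : 𝔼 → ℝ} (hu : Continuous u) (l : ℝ) : Measurable (kelvin l u) := by
  have h1 := hu.measurable.comp (measurable_inv0 (n := n) l)
  have h2 : Measurable fun x : 𝔼 => 2 * Real.log (l / ‖x‖) := by fun_prop
  exact h1.add h2

lemma measurableSet_badSet {u : 𝔼 → ℝ} (hu : Continuous u) (l : ℝ) :
    MeasurableSet (badSet l u) :=
  measurableSet_ball.inter ((measurableSet_singleton (0 : 𝔼)).compl.inter
    (measurableSet_lt (measurable_kelvin hu l) hu.measurable))

lemma badSet_subset (l : ℝ) (u : 𝔼 → ℝ) : badSet l u ⊆ ball 0 l := fun _ hx => hx.1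

lemma log_refl_nonneg {l : ℝ} (hl : 0 < l) {x y : 𝔼} (hx : ‖x‖ < l) (hy : ‖y‖ < l)
    (hy0 : y ≠ 0) (hxy : y ≠ x) : 0 < Real.log (refl l x y / ‖x - y‖) := by
  have p1 : 0 < ‖x - y‖ := norm_pos_iff.2 (sub_ne_zero.2 hxy.symm)
  exact Real.log_pos ((one_lt_div p1).2 (norm_sub_lt_refl hl hx hy hy0))

lemma log_refl_le {l : ℝ} (hl : 0 < l) (hμ0 : 0 < μ) {x y : 𝔼} (hx : ‖x‖ < l) (hy : ‖y‖ < l)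
    (hy0 : y ≠ 0) :
    Real.log (refl l x y / ‖x - y‖) ≤ (2 * l) ^ μ / μ * ‖x - y‖ ^ (-μ) := by
  have h0 : 0 ≤ refl l x y / ‖x - y‖ := div_nonneg (refl_nonneg hl x y) (norm_nonneg _)
  have h1 := Real.log_le_rpow_div h0 hμ0
  refine h1.trans ?_
  rw [div_rpow (refl_nonneg hl x y) (norm_nonneg _), rpow_neg (norm_nonneg _)]
  have h2 : refl l x y ^ μ ≤ (2 * l) ^ μ :=
    rpow_le_rpow (refl_nonneg hl x y) (refl_le hl hx.le hy.le hy0) hμ0.le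
  calc refl l x y ^ μ / ‖x - y‖ ^ μ / μ = refl l x y ^ μ / μ * (‖x - y‖ ^ μ)⁻¹ := by ring
    _ ≤ _ := by gcongr

lemma mul_sub_mul_le {a b v w c d : ℝ} (hv : 0 ≤ v) (hw : 0 ≤ w) (ha : 0 ≤ a) (hb : 0 ≤ b)
    (hc0 : 0 ≤ c) (hd0 : 0 ≤ d) (hc : a - b ≤ c) (hd : v - w ≤ d) :
    v * a - w * b ≤ v * c + a * d := by
  rcases le_total a b with hab | hab
  · nlinarith [mul_nonneg hv hc0, mul_le_mul_of_nonneg_left hd ha,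
      mul_le_mul_of_nonneg_left hab hw]
  · rcases le_total v w with hvw | hvw
    · nlinarith [mul_le_mul_of_nonneg_left hc hv, mul_nonneg ha hd0, mul_nonneg hv hc0,
        mul_le_mul_of_nonneg_right hvw hb]
    · nlinarith [mul_le_mul_of_nonneg_left hc hv, mul_le_mul_of_nonneg_left hd ha,
        mul_nonneg (sub_nonneg.2 hvw) (sub_nonneg.2 hab)]

lemma dens_sub_dens_le (u w : 𝔼 → ℝ) (y : 𝔼) :
    dens μ u y - dens μ w y ≤ dens μ u y * ((2 * n - μ) / 2 * (u y - w y)) := by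
  have h1 := Real.add_one_le_exp (-((2 * n - μ) / 2 * (u y - w y)))
  have h2 : dens μ w y = dens μ u y * Real.exp (-((2 * n - μ) / 2 * (u y - w y))) := by
    rw [dens, dens, ← Real.exp_add]
    ring_nf
  have h3 := mul_le_mul_of_nonneg_left h1 (dens_pos μ u y).le
  rw [h2]
  linarith

lemma IsSol.sub_kelvin_le {u : 𝔼 → ℝ} (h : IsSol n μ β u) (hn : 2 ≤ n) (hβ : 0 < β)
    (hμ0 : 0 < μ) (hμn : μ < n)
    (hM : ∫ y, charge μ u y = 2 * β) {l : ℝ} (hl : 0 < l) {A : Set 𝔼} (hA : MeasurableSet A)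
    (hAl : A ⊆ ball 0 l) {c₁ c₂ : ℝ} (hc₁ : 0 ≤ c₁) (hc₂ : 0 ≤ c₂)
    (hbd : ∀ y ∈ ball (0 : 𝔼) l, y ≠ 0 →
      charge μ u y - kelvinCharge μ l u y ≤ A.indicator (fun _ => c₁) y + c₂)
    {x : 𝔼} (hx : x ≠ 0) (hxl : ‖x‖ < l) :
    u x - kelvin l u x ≤ (1 / β) * ((2 * l) ^ μ / μ * (c₁ * ∫ y in A, ‖x - y‖ ^ (-μ)) +
      (2 * l) ^ μ / μ * (c₂ * ∫ y in ball (0 : 𝔼) l, ‖x - y‖ ^ (-μ))) := by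
  have : NeZero n := ⟨by omega⟩
  obtain ⟨hintg, heq⟩ := h.sub_kelvin hn hβ hM hl hx hxl
  rw [heq]
  gcongr
  have i0 := integrableOn_norm_sub_rpow hμ0.le hμn
    (measure_ball_lt_top (μ := volume) (x := (0 : 𝔼)) (r := l)).ne x
  have i1 : IntegrableOn (A.indicator fun y => ‖x - y‖ ^ (-μ)) (ball (0 : 𝔼) l) := i0.indicator hA
  have e1 : ∫ y in A, ‖x - y‖ ^ (-μ) =
      ∫ y in ball (0 : 𝔼) l, A.indicator (fun y => ‖x - y‖ ^ (-μ)) y := by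
    rw [setIntegral_indicator hA, Set.inter_eq_self_of_subset_right hAl]
  have i2 := (i1.const_mul c₁).const_mul ((2 * l) ^ μ / μ)
  have i3 := (i0.const_mul c₂).const_mul ((2 * l) ^ μ / μ)
  rw [e1, ← integral_const_mul, ← integral_const_mul, ← integral_const_mul, ← integral_const_mul,
    ← integral_add i2 i3]
  refine integral_mono_ae hintg (i2.add i3) ?_
  filter_upwards [ae_restrict_of_ae (ae_ne (0 : 𝔼)), ae_restrict_of_ae (ae_ne x),
      ae_restrict_mem measurableSet_ball] with y hy hyx hyB
  have hyl : ‖y‖ < l := by simpa using hyB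
  have g0 := log_refl_nonneg hl hxl hyl hy hyx
  have g1 := log_refl_le hl hμ0 hxl hyl hy
  have d0 : 0 ≤ A.indicator (fun _ => c₁) y + c₂ :=
    add_nonneg (Set.indicator_nonneg (fun _ _ => hc₁) y) hc₂
  refine (mul_le_mul_of_nonneg_left (hbd y hyB hy) g0.le).trans ?_
  refine (mul_le_mul_of_nonneg_right g1 d0).trans (le_of_eq ?_)
  by_cases hyA : y ∈ A
  · simp only [Set.indicator_of_mem hyA]
    ring
  · simp only [Set.indicator_of_notMem hyA]
    ring

/-- If the bad set is small then the reflection inequality holds in the whole ball. -/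
lemma IsSol.exists_contraction {u : 𝔼 → ℝ} (h : IsSol n μ β u) (hn : 2 ≤ n) (hβ : 0 < β)
    (hμ0 : 0 < μ) (hμn : μ < n) (hM : ∫ y, charge μ u y = 2 * β) (L : ℝ) :
    ∃ δ > 0, ∀ l, 0 < l → l ≤ L → volume.real (badSet l u) ≤ δ →
      ∀ x, x ≠ 0 → ‖x‖ < l → u x ≤ kelvin l u x := by
  have : NeZero n := ⟨by omega⟩
  obtain ⟨F, hF0, hF⟩ := exists_bound_of_continuous (continuous_dens (μ := μ) h.cont) L
  obtain ⟨K, hK0, hK⟩ := exists_V_le hμ0.le hμn h.cont h.dens_integrable L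
  obtain ⟨G, hG0, hG⟩ := h.charge_lbi.bdd L
  set p : ℝ := (2 * n - μ) / 2 with hp
  have hp0 : 0 < p := by
    have : (0 : ℝ) < n := hμ0.trans hμn
    rw [hp]
    linarith
  set κ : ℝ := (∫ z in ball (0 : 𝔼) 1, ‖z‖ ^ (-μ)) + 1 ^ (-μ) * volume.real (ball (0 : 𝔼) L)
  have hκ0 : 0 ≤ κ := add_nonneg (integral_nonneg fun z => by positivity) (by positivity)
  have hκ : ∀ l ≤ L, ∀ x : 𝔼, ∫ y in ball (0 : 𝔼) l, ‖x - y‖ ^ (-μ) ≤ κ := by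
    intro l hl x
    refine (setIntegral_norm_sub_rpow_le hμ0.le hμn one_pos measure_ball_lt_top.ne x).trans ?_
    have : volume.real (ball (0 : 𝔼) l) ≤ volume.real (ball (0 : 𝔼) L) :=
      measureReal_mono (ball_subset_ball hl) measure_ball_lt_top.ne
    simp only [κ]
    gcongr
  set B : ℝ := (1 / β) * ((2 * L) ^ μ / μ * (K * (F * p) + F * (F * p) * κ)) with hB
  obtain ⟨δ, hδ0, hδ⟩ := exists_setIntegral_norm_sub_rpow_le (n := n) hμ0.le hμn
    (ε := 1 / (2 * (|B| + 1))) (by positivity)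
  refine ⟨δ, hδ0, fun l hl hlL hbad => ?_⟩
  have hA := measurableSet_badSet h.cont l
  have hAfin : volume (badSet l u) ≠ ⊤ :=
    ((measure_mono (badSet_subset l u)).trans_lt measure_ball_lt_top).ne
  have hpow : (2 * l) ^ μ ≤ (2 * L) ^ μ := rpow_le_rpow (by positivity) (by linarith) hμ0.le
  set ε := 1 / (2 * (|B| + 1)) with hε
  have hε0 : 0 < ε := by positivity
  have hBε : B * ε ≤ 1 / 2 := by
    rw [hε, mul_one_div, div_le_iff₀ (by positivity)]
    have := le_abs_self B
    linarith
  have hB0 : 0 ≤ B := by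
    have hL : 0 < L := hl.trans_le hlL
    positivity
  have step : ∀ W, 0 ≤ W → (∀ x, x ≠ 0 → ‖x‖ < l → u x - kelvin l u x ≤ W) →
      ∀ x, x ≠ 0 → ‖x‖ < l → u x - kelvin l u x ≤ W / 2 := by
    intro W hW hle x hx hxl
    have f1 : ∀ y, y ≠ 0 → ‖y‖ < l → dens μ u y - dens μ (kelvin l u) y ≤
        (badSet l u).indicator (fun _ => F * p * W) y := by
      intro y hy hyl
      have a1 := dens_sub_dens_le (μ := μ) u (kelvin l u) y
      have a2 : dens μ u y ≤ F := (le_abs_self _).trans (hF y (hyl.le.trans hlL))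
      have a3 := dens_pos μ u y
      by_cases hyA : y ∈ badSet l u
      · rw [Set.indicator_of_mem hyA]
        have a4 : 0 < u y - kelvin l u y := sub_pos.2 hyA.2.2
        refine a1.trans ?_
        rw [mul_assoc]
        have := hle y hy hyl
        gcongr
      · rw [Set.indicator_of_notMem hyA]
        have a4 : u y ≤ kelvin l u y := by
          by_contra hcon
          exact hyA ⟨by simpa using hyl, hy, not_le.1 hcon⟩
        refine a1.trans ?_
        have : p * (u y - kelvin l u y) ≤ 0 :=
          mul_nonpos_of_nonneg_of_nonpos hp0.le (by linarith)
        exact mul_nonpos_of_nonneg_of_nonpos a3.le this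
    have f2 : ∀ y, y ≠ 0 → ‖y‖ < l → V n μ u y - kelvinV μ l u y ≤ F * p * W * ε := by
      intro y hy hyl
      obtain ⟨hintg, heq⟩ := V_sub_kelvinV hn hμ0.le hμn h.cont h.dens_integrable hl hy
      rw [heq]
      have i0 := integrableOn_norm_sub_rpow hμ0.le hμn
        (measure_ball_lt_top (μ := volume) (x := (0 : 𝔼)) (r := l)).ne y
      have i1 : IntegrableOn ((badSet l u).indicator fun z => ‖y - z‖ ^ (-μ))
        (ball (0 : 𝔼) l) := i0.indicator hA
      have e1 : ∫ z in badSet l u, ‖y - z‖ ^ (-μ) =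
          ∫ z in ball (0 : 𝔼) l, (badSet l u).indicator (fun z => ‖y - z‖ ^ (-μ)) z := by
        rw [setIntegral_indicator hA, Set.inter_eq_self_of_subset_right (badSet_subset l u)]
      refine le_trans ?_ (mul_le_mul_of_nonneg_left (hδ _ hAfin hbad y) (by positivity))
      rw [e1, ← integral_const_mul]
      refine integral_mono_ae hintg (i1.const_mul _) ?_
      filter_upwards [ae_restrict_of_ae (ae_ne (0 : 𝔼)), ae_restrict_of_ae (ae_ne y),
        ae_restrict_mem measurableSet_ball] with z hz hzy hzB
      have hzl : ‖z‖ < l := by simpa using hzB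
      have p1 : 0 < ‖y - z‖ := norm_pos_iff.2 (sub_ne_zero.2 hzy.symm)
      have k1 := norm_sub_lt_refl hl hyl hzl hz
      have k2 : refl l y z ^ (-μ) ≤ ‖y - z‖ ^ (-μ) :=
        rpow_le_rpow_of_nonpos p1 k1.le (by linarith)
      have k3 : 0 ≤ refl l y z ^ (-μ) := rpow_nonneg (refl_nonneg hl y z) _
      have k4 := f1 z hz hzl
      have k5 : 0 ≤ (badSet l u).indicator (fun _ => F * p * W) z :=
        Set.indicator_nonneg (fun _ _ => by positivity) z
      refine (mul_le_mul_of_nonneg_left k4 (sub_nonneg.2 k2)).trans ?_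
      refine (mul_le_mul_of_nonneg_right (sub_le_self _ k3) k5).trans (le_of_eq ?_)
      by_cases hzA : z ∈ badSet l u
      · simp only [Set.indicator_of_mem hzA]
        ring
      · simp only [Set.indicator_of_notMem hzA]
        ring
    have f3 : ∀ y ∈ ball (0 : 𝔼) l, y ≠ 0 → charge μ u y - kelvinCharge μ l u y ≤
        (badSet l u).indicator (fun _ => K * (F * p * W)) y + F * (F * p * W * ε) := by
      intro y hyB hy
      have hyl : ‖y‖ < l := by simpa using hyB
      rw [kelvinCharge_eq hl u hy, charge]
      have m0 : 0 ≤ (badSet l u).indicator (fun _ => F * p * W) y :=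
        Set.indicator_nonneg (fun _ _ => by positivity) y
      have m1 := mul_sub_mul_le (V_nonneg u y) (kelvinV_nonneg hl u y)
        (dens_pos μ u y).le (dens_pos μ (kelvin l u) y).le m0 (by positivity) (f1 y hy hyl)
          (f2 y hy hyl)
      have m2 : dens μ u y ≤ F := (le_abs_self _).trans (hF y (hyl.le.trans hlL))
      refine m1.trans (add_le_add ?_ (by gcongr))
      refine (mul_le_mul_of_nonneg_right (hK y (hyl.le.trans hlL)) m0).trans (le_of_eq ?_)
      by_cases hzA : y ∈ badSet l u
      · simp only [Set.indicator_of_mem hzA]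
      · simp only [Set.indicator_of_notMem hzA, mul_zero]
    have f4 := h.sub_kelvin_le hn hβ hμ0 hμn hM hl hA (badSet_subset l u) (by positivity)
      (by positivity) f3 hx hxl
    have f5 := hδ _ hAfin hbad x
    have f6 := hκ l hlL x
    calc u x - kelvin l u x ≤ _ := f4
      _ ≤ (1 / β) * ((2 * L) ^ μ / μ * (K * (F * p * W) * ε) +
        (2 * L) ^ μ / μ * (F * (F * p * W * ε) * κ)) := by
          have : 0 ≤ (2 * L) ^ μ := le_trans (by positivity) hpow
          gcongr
      _ = B * ε * W := by rw [hB]; ring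
      _ ≤ 1 / 2 * W := by gcongr
      _ = W / 2 := by ring
  have base : ∃ W, 0 ≤ W ∧ ∀ x, x ≠ 0 → ‖x‖ < l → u x - kelvin l u x ≤ W := by
    refine ⟨(1 / β) * ((2 * l) ^ μ / μ * (G * κ)), by positivity, fun x hx hxl => ?_⟩
    have f4 := h.sub_kelvin_le hn hβ hμ0 hμn hM hl MeasurableSet.empty (Set.empty_subset _)
      le_rfl hG0 (fun y hyB hy => ?_) hx hxl
    · refine f4.trans ?_
      have f6 := hκ l hlL x
      rw [zero_mul, mul_zero, zero_add]
      gcongr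
    · have hyl : ‖y‖ < l := by simpa using hyB
      have m1 := (le_abs_self _).trans (hG y (hyl.le.trans hlL))
      have m2 : 0 ≤ kelvinCharge μ l u y := mul_nonneg (by positivity) (charge_nonneg u _)
      simp
      linarith
  obtain ⟨W, hW0, hW⟩ := base
  have iter : ∀ k : ℕ, ∀ x, x ≠ 0 → ‖x‖ < l → u x - kelvin l u x ≤ W * (1 / 2) ^ k := by
    intro k
    induction k with
    | zero => simpa using hW
    | succ k ih =>
      intro x hx hxl
      have := step _ (by positivity) ih x hx hxl
      rw [pow_succ]
      linarith
  intro x hx hxl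
  have hlim : Tendsto (fun k : ℕ => W * (1 / 2 : ℝ) ^ k) atTop (nhds (W * 0)) :=
    (tendsto_pow_atTop_nhds_zero_of_lt_one (by norm_num) (by norm_num)).const_mul W
  rw [mul_zero] at hlim
  have := ge_of_tendsto' hlim fun k => iter k x hx hxl
  linarith

/-- The solution lies below its reflection inside the ball of radius `l`. -/
def BelowReflection (u : 𝔼 → ℝ) (l : ℝ) : Prop := ∀ x, x ≠ 0 → ‖x‖ < l → u x ≤ kelvin l u x

lemma continuousAt_kelvin_radius {u : 𝔼 → ℝ} (hu : Continuous u) {l : ℝ} (hl : 0 < l) {x : 𝔼}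
    (hx : x ≠ 0) : ContinuousAt (fun l => kelvin l u x) l := by
  have h1 : 0 < ‖x‖ := norm_pos_iff.2 hx
  have h2 : (fun l => kelvin l u x) =
      fun l => u ((l / ‖x‖) ^ 2 • x) + 2 * Real.log (l / ‖x‖) := by
    funext l
    rw [kelvin, inv0_eq]
  rw [h2]
  have h3 : ContinuousAt (fun l => u ((l / ‖x‖) ^ 2 • x)) l := by fun_prop
  have h4 : ContinuousAt (fun l => Real.log (l / ‖x‖)) l :=
    ContinuousAt.log (by fun_prop) (by positivity)
  exact h3.add (h4.const_mul 2)

lemma IsSol.exists_belowReflection {u : 𝔼 → ℝ} (h : IsSol n μ β u) (hn : 2 ≤ n) (hβ : 0 < β)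
    (hμ0 : 0 < μ) (hμn : μ < n) (hM : ∫ y, charge μ u y = 2 * β) :
    ∃ l > 0, BelowReflection u l := by
  have : NeZero n := ⟨by omega⟩
  obtain ⟨δ, hδ0, hδ⟩ := h.exists_contraction hn hβ hμ0 hμn hM 1
  set c := volume.real (ball (0 : 𝔼) 1)
  have hc : 0 ≤ c := measureReal_nonneg
  have hl : 0 < min 1 (δ / (c + 1)) := lt_min one_pos (by positivity)
  refine ⟨_, hl, hδ _ hl (min_le_left _ _) ?_⟩
  set l := min 1 (δ / (c + 1))
  have h1 : volume.real (ball (0 : 𝔼) l) = l ^ n * c := by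
    rw [measureReal_def, Measure.addHaar_ball volume _ hl.le, ENNReal.toReal_mul]
    simp [ENNReal.toReal_ofReal (pow_nonneg hl.le n), c, measureReal_def]
  have h2 : l ^ n ≤ l := pow_le_of_le_one hl.le (min_le_left _ _) (by omega)
  calc volume.real (badSet l u) ≤ volume.real (ball (0 : 𝔼) l) :=
        measureReal_mono (badSet_subset l u) measure_ball_lt_top.ne
    _ = l ^ n * c := h1
    _ ≤ δ / (c + 1) * c := by gcongr; exact h2.trans (min_le_right _ _)
    _ ≤ δ := by rw [div_mul_eq_mul_div, div_le_iff₀ (by positivity)]; nlinarith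

lemma BelowReflection.rpow_mul_le [NeZero n] {u : 𝔼 → ℝ}
    (hf : Integrable (dens μ u)) (hμ0 : 0 < μ) {l : ℝ} (hl : 1 ≤ l) (h : BelowReflection u l)
    (hp : 0 ≤ (2 * n - μ) / 2) :
    l ^ μ * ∫ y in ball (0 : 𝔼) 1, dens μ u y ≤ ∫ y, dens μ u y := by
  have hl0 : 0 < l := one_pos.trans_le hl
  have hsub : ball (0 : 𝔼) 1 ⊆ ball 0 l := ball_subset_ball hl
  have hi := integrableOn_inv0 hl0 hf
  have hi1 : IntegrableOn (fun y => dens μ u y + (l / ‖y‖) ^ (2 * n) * dens μ u (inv0 l y))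
    (ball 0 l) := hf.integrableOn.add hi
  have hnn : ∀ y : 𝔼, 0 ≤ (l / ‖y‖) ^ (2 * n) * dens μ u (inv0 l y) := fun y =>
    mul_nonneg (by positivity) (dens_pos μ u _).le
  rw [integral_eq_setIntegral_ball hl0 hf]
  refine le_trans ?_ (setIntegral_mono_set hi1
    (ae_of_all _ fun y => add_nonneg (dens_pos μ u _).le (hnn y)) hsub.eventuallyLE)
  rw [← integral_const_mul]
  refine integral_mono_ae (hf.integrableOn.const_mul _) (hi1.mono_set hsub) ?_
  filter_upwards [ae_restrict_of_ae (ae_ne (0 : 𝔼)), ae_restrict_mem measurableSet_ball]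
    with y hy0 hy
  have hy1 : ‖y‖ < 1 := by simpa using hy
  have hyp : 0 < ‖y‖ := norm_pos_iff.2 hy0
  rw [pow_mul_dens_inv0 hl0 u hy0]
  have h1 : dens μ u y ≤ dens μ (kelvin l u) y :=
    Real.exp_le_exp.2 (mul_le_mul_of_nonneg_left (h y hy0 (hy1.trans_le hl)) hp)
  have h2 : l ≤ l / ‖y‖ := by
    rw [le_div_iff₀ hyp]
    nlinarith
  have h3 : l ^ μ ≤ (l / ‖y‖) ^ μ := rpow_le_rpow hl0.le h2 hμ0.le
  have h4 := dens_pos μ u y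
  calc l ^ μ * dens μ u y ≤ (l / ‖y‖) ^ μ * dens μ (kelvin l u) y := by gcongr
    _ ≤ _ := le_add_of_nonneg_left h4.le

lemma IsSol.bddAbove_belowReflection {u : 𝔼 → ℝ} (h : IsSol n μ β u) (hn : 2 ≤ n)
    (hμ0 : 0 < μ) (hμn : μ < n) : BddAbove {l | 0 < l ∧ BelowReflection u l} := by
  have : NeZero n := ⟨by omega⟩
  set a := ∫ y in ball (0 : 𝔼) 1, dens μ u y
  set b := ∫ y, dens μ u y
  have ha : 0 < a := by
    refine (setIntegral_pos_iff_support_of_nonneg_ae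
      (ae_of_all _ fun y => (dens_pos μ u y).le) h.dens_integrable.integrableOn).2 ?_
    have : Function.support (dens μ u) = Set.univ :=
      Set.eq_univ_of_forall fun y => (dens_pos μ u y).ne'
    rw [this, Set.univ_inter]
    exact measure_ball_pos _ _ one_pos
  have hb : 0 ≤ b := integral_nonneg fun y => (dens_pos μ u y).le
  refine ⟨max 1 ((b / a) ^ μ⁻¹), fun l ⟨hl0, hl⟩ => ?_⟩
  rcases le_total l 1 with hl1 | hl1
  · exact le_max_of_le_left hl1
  refine le_max_of_le_right ?_
  have h1 := hl.rpow_mul_le h.dens_integrable hμ0 hl1 (by linarith)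
  rw [le_rpow_inv_iff_of_pos hl0.le (by positivity) hμ0, le_div_iff₀ ha]
  exact h1

lemma IsSol.belowReflection_sSup {u : 𝔼 → ℝ} (h : IsSol n μ β u)
    (hne : {l | 0 < l ∧ BelowReflection u l}.Nonempty)
    (hbd : BddAbove {l | 0 < l ∧ BelowReflection u l}) :
    0 < sSup {l | 0 < l ∧ BelowReflection u l} ∧
      BelowReflection u (sSup {l | 0 < l ∧ BelowReflection u l}) := by
  obtain ⟨s, -, hs, hmem⟩ := exists_seq_tendsto_sSup hne hbd
  set L := sSup {l | 0 < l ∧ BelowReflection u l}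
  have hL : 0 < L := by
    obtain ⟨l, hl⟩ := hne
    exact hl.1.trans_le (le_csSup hbd hl)
  refine ⟨hL, fun x hx hxl => ?_⟩
  have h1 := (continuousAt_kelvin_radius h.cont hL hx).tendsto.comp hs
  refine ge_of_tendsto h1 ?_
  filter_upwards [hs.eventually (lt_mem_nhds hxl)] with k hk
  exact (hmem k).2 x hx hk

lemma IsSol.exists_gt_of_strict {u : 𝔼 → ℝ} (h : IsSol n μ β u) (hn : 2 ≤ n) (hβ : 0 < β)
    (hμ0 : 0 < μ) (hμn : μ < n) (hM : ∫ y, charge μ u y = 2 * β) {l : ℝ} (hl : 0 < l)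
    (hlt : ∀ x, x ≠ 0 → ‖x‖ < l → u x < kelvin l u x) : ∃ l' > l, BelowReflection u l' := by
  have : NeZero n := ⟨by omega⟩
  have : Nonempty (Fin n) := ⟨0⟩
  obtain ⟨δ, hδ0, hδ⟩ := h.exists_contraction hn hβ hμ0 hμn hM (l + 1)
  set s : ℕ → ℝ := fun k => l + 1 / ((k : ℝ) + 1)
  have hs : Tendsto s atTop (nhds l) := by
    have h0 := (tendsto_one_div_add_atTop_nhds_zero_nat (𝕜 := ℝ)).const_add l
    rwa [add_zero] at h0
  have hs1 : ∀ k, l < s k := fun k => lt_add_of_pos_right _ (by positivity)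
  have hs2 : ∀ k, s k ≤ l + 1 := fun k => by
    simp only [s]
    have : 1 / ((k : ℝ) + 1) ≤ 1 := by
      rw [div_le_one (by positivity)]
      linarith [(Nat.cast_nonneg k : (0 : ℝ) ≤ k)]
    linarith
  have hlim : Tendsto (fun k => volume (badSet (s k) u)) atTop (nhds (volume (∅ : Set 𝔼))) := by
    refine tendsto_measure_of_ae_tendsto_indicator atTop MeasurableSet.empty
      (fun k => measurableSet_badSet h.cont _) (B := ball 0 (l + 1)) measurableSet_ball
      measure_ball_lt_top.ne (Eventually.of_forall fun k =>
        (badSet_subset _ u).trans (ball_subset_ball (hs2 k))) ?_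
    have hsph : ∀ᵐ x : 𝔼, x ∉ sphere (0 : 𝔼) l :=
      measure_eq_zero_iff_ae_notMem.1 (Measure.addHaar_sphere volume 0 l)
    filter_upwards [hsph] with x hx
    simp only [Set.mem_empty_iff_false, iff_false]
    rcases eq_or_ne x 0 with rfl | hx0
    · exact Eventually.of_forall fun k hk => hk.2.1 rfl
    rcases lt_trichotomy ‖x‖ l with hxl | hxl | hxl
    · have h1 := (continuousAt_kelvin_radius h.cont hl hx0).tendsto.comp hs
      filter_upwards [h1.eventually (lt_mem_nhds (hlt x hx0 hxl))] with k hk hmem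
      exact lt_asymm hmem.2.2 hk
    · exact absurd (by simpa using hxl) hx
    · filter_upwards [hs.eventually (gt_mem_nhds hxl)] with k hk hmem
      have := hmem.1
      simp only [mem_ball, dist_zero_right] at this
      exact lt_asymm this hk
  rw [measure_empty] at hlim
  have hlim2 := (ENNReal.tendsto_toReal ENNReal.zero_ne_top).comp hlim
  obtain ⟨k, hk⟩ := (hlim2.eventually (gt_mem_nhds (by simpa using hδ0))).exists
  exact ⟨s k, hs1 k, hδ _ (hl.trans (hs1 k)) (hs2 k) (le_of_lt hk)⟩

lemma IsSol.eq_kelvin_of_touch {u : 𝔼 → ℝ} (h : IsSol n μ β u) (hn : 2 ≤ n) (hβ : 0 < β)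
    (hμ0 : 0 < μ) (hμn : μ < n) (hM : ∫ y, charge μ u y = 2 * β) {l : ℝ} (hl : 0 < l)
    (hle : BelowReflection u l) {z : 𝔼} (hz0 : z ≠ 0) (hzl : ‖z‖ < l) (hz : u z = kelvin l u z) :
    ∀ x, x ≠ 0 → ‖x‖ < l → u x = kelvin l u x := by
  have : NeZero n := ⟨by omega⟩
  have hp : 0 ≤ (2 * n - μ) / 2 := by linarith
  have hdens : ∀ y, y ≠ 0 → ‖y‖ < l → dens μ u y ≤ dens μ (kelvin l u) y := fun y hy hyl =>
    Real.exp_le_exp.2 (mul_le_mul_of_nonneg_left (hle y hy hyl) hp)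
  have hV : ∀ y, y ≠ 0 → ‖y‖ < l → V n μ u y ≤ kelvinV μ l u y := by
    intro y hy hyl
    rw [← sub_nonpos, (V_sub_kelvinV hn hμ0.le hμn h.cont h.dens_integrable hl hy).2]
    refine integral_nonpos_of_ae ?_
    filter_upwards [ae_restrict_of_ae (ae_ne (0 : 𝔼)), ae_restrict_of_ae (ae_ne y),
      ae_restrict_mem measurableSet_ball] with w hw hwy hwB
    have hwl : ‖w‖ < l := by simpa using hwB
    have p1 : 0 < ‖y - w‖ := norm_pos_iff.2 (sub_ne_zero.2 hwy.symm)
    have k1 := norm_sub_lt_refl hl hyl hwl hw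
    have k2 : refl l y w ^ (-μ) ≤ ‖y - w‖ ^ (-μ) :=
      rpow_le_rpow_of_nonpos p1 k1.le (by linarith)
    exact mul_nonpos_of_nonneg_of_nonpos (sub_nonneg.2 k2) (sub_nonpos.2 (hdens w hw hwl))
  have hch : ∀ y, y ≠ 0 → ‖y‖ < l → charge μ u y - kelvinCharge μ l u y ≤ 0 := by
    intro y hy hyl
    rw [kelvinCharge_eq hl u hy, charge, sub_nonpos]
    exact mul_le_mul (hV y hy hyl) (hdens y hy hyl) (dens_pos μ u y).le (kelvinV_nonneg hl u y)
  obtain ⟨hintg, heq⟩ := h.sub_kelvin hn hβ hM hl hz0 hzl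
  rw [sub_eq_zero.2 hz] at heq
  have hzero : ∫ y in ball (0 : 𝔼) l, Real.log (refl l z y / ‖z - y‖) *
      (charge μ u y - kelvinCharge μ l u y) = 0 := by
    have : (1 / β) ≠ 0 := by positivity
    exact (mul_eq_zero.1 heq.symm).resolve_left this
  have hneg : ∀ᵐ y ∂(volume.restrict (ball (0 : 𝔼) l)), 0 ≤ -(Real.log (refl l z y / ‖z - y‖) *
      (charge μ u y - kelvinCharge μ l u y)) := by
    filter_upwards [ae_restrict_of_ae (ae_ne (0 : 𝔼)), ae_restrict_of_ae (ae_ne z),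
      ae_restrict_mem measurableSet_ball] with y hy hyz hyB
    have hyl : ‖y‖ < l := by simpa using hyB
    have := mul_nonpos_of_nonneg_of_nonpos (log_refl_nonneg hl hzl hyl hy hyz).le (hch y hy hyl)
    linarith
  have hae := (integral_eq_zero_iff_of_nonneg_ae hneg hintg.neg).1 (by
    rw [integral_neg, hzero, neg_zero])
  have hchz : ∀ᵐ y ∂(volume.restrict (ball (0 : 𝔼) l)),
      charge μ u y - kelvinCharge μ l u y = 0 := by
    filter_upwards [hae, ae_restrict_of_ae (ae_ne (0 : 𝔼)), ae_restrict_of_ae (ae_ne z),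
      ae_restrict_mem measurableSet_ball] with y hy1 hy hyz hyB
    have hyl : ‖y‖ < l := by simpa using hyB
    have h1 := (log_refl_nonneg hl hzl hyl hy hyz).ne'
    simp only [Pi.zero_apply, neg_eq_zero] at hy1
    exact (mul_eq_zero.1 hy1).resolve_left h1
  intro x hx hxl
  rw [← sub_eq_zero, (h.sub_kelvin hn hβ hM hl hx hxl).2]
  have : ∫ y in ball (0 : 𝔼) l, Real.log (refl l x y / ‖x - y‖) *
      (charge μ u y - kelvinCharge μ l u y) = 0 := by
    refine integral_eq_zero_of_ae ?_
    filter_upwards [hchz] with y hy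
    simp [hy]
  rw [this, mul_zero]

/-- The moving sphere stops at a radius where the solution is symmetric. -/
lemma IsSol.exists_eq_kelvin {u : 𝔼 → ℝ} (h : IsSol n μ β u) (hn : 2 ≤ n) (hβ : 0 < β)
    (hμ0 : 0 < μ) (hμn : μ < n) (hM : ∫ y, charge μ u y = 2 * β) :
    ∃ l > 0, ∀ x, x ≠ 0 → u x = kelvin l u x := by
  obtain ⟨l₁, hl₁, hl₁'⟩ := h.exists_belowReflection hn hβ hμ0 hμn hM
  have hbd := h.bddAbove_belowReflection hn hμ0 hμn
  obtain ⟨hl, hle⟩ := h.belowReflection_sSup ⟨l₁, hl₁, hl₁'⟩ hbd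
  set l := sSup {l | 0 < l ∧ BelowReflection u l} with hldef
  refine ⟨l, hl, ?_⟩
  have htouch : ∃ z, z ≠ 0 ∧ ‖z‖ < l ∧ u z = kelvin l u z := by
    by_contra! hcon
    obtain ⟨l', hl', hl''⟩ := h.exists_gt_of_strict hn hβ hμ0 hμn hM hl fun x hx hxl =>
      lt_of_le_of_ne (hle x hx hxl) (hcon x hx hxl)
    exact absurd (le_csSup hbd ⟨hl.trans hl', hl''⟩) (not_le.2 hl')
  obtain ⟨z, hz0, hzl, hz⟩ := htouch
  have hin := h.eq_kelvin_of_touch hn hβ hμ0 hμn hM hl hle hz0 hzl hz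
  intro x hx
  have hxp : 0 < ‖x‖ := norm_pos_iff.2 hx
  rcases lt_trichotomy ‖x‖ l with hxl | hxl | hxl
  · exact hin x hx hxl
  · rw [kelvin, inv0_eq, hxl, div_self hl.ne']
    simp
  · have h1 := hin (inv0 l x) (inv0_ne_zero hl hx) (by
      rw [norm_inv0, div_lt_iff₀ hxp]
      nlinarith)
    rw [kelvin, inv0_inv0 hl, norm_inv0] at h1
    have h2 : l / (l ^ 2 / ‖x‖) = (l / ‖x‖)⁻¹ := by field_simp
    rw [h2, Real.log_inv] at h1
    rw [kelvin, h1]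
    ring

/-- The inverted function `τ ↦ τ² q(e/τ)` near `τ = 0`, computed from the spherical symmetry of
`q` about `b`. -/
lemma hasDerivAt_inverted {q : 𝔼 → ℝ} {b e : 𝔼} (hq : DifferentiableAt ℝ q b) (he : e ≠ 0)
    {l : ℝ} (hl : 0 < l) :
    HasDerivAt (fun τ : ℝ => ‖e - τ • b‖ ^ 2 / l ^ 2 *
        q (b + (l ^ 2 * τ / ‖e - τ • b‖ ^ 2) • (e - τ • b)))
      (fderiv ℝ q b e - 2 * (q b / l ^ 2) * inner ℝ b e) 0 := by
  have he' : ‖e‖ ≠ 0 := norm_ne_zero_iff.2 he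
  have h1 : HasDerivAt (fun τ : ℝ => e - τ • b) (-b) 0 := by
    simpa using ((hasDerivAt_id (0 : ℝ)).smul_const b).const_sub e
  have h2 : HasDerivAt (fun τ : ℝ => ‖e - τ • b‖ ^ 2) (-2 * inner ℝ b e) 0 := by
    have := h1.norm_sq
    simp only [zero_smul, sub_zero, inner_neg_right] at this
    rw [real_inner_comm] at this
    convert this using 1
    ring
  have h3 : HasDerivAt (fun τ : ℝ => l ^ 2 * τ / ‖e - τ • b‖ ^ 2) (l ^ 2 / ‖e‖ ^ 2) 0 := by
    have := ((hasDerivAt_id (0 : ℝ)).const_mul (l ^ 2)).div h2 (by simpa using he)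
    simp only [id, mul_one, zero_smul, sub_zero, mul_zero, zero_mul] at this
    refine this.congr_deriv ?_
    field_simp
  have h4 : HasDerivAt (fun τ : ℝ => b + (l ^ 2 * τ / ‖e - τ • b‖ ^ 2) • (e - τ • b))
      ((l ^ 2 / ‖e‖ ^ 2) • e) 0 := by
    have := (h3.smul h1).const_add b
    simpa using this
  have h5 : HasDerivAt (fun τ : ℝ => q (b + (l ^ 2 * τ / ‖e - τ • b‖ ^ 2) • (e - τ • b)))
      (fderiv ℝ q b ((l ^ 2 / ‖e‖ ^ 2) • e)) 0 := by
    refine HasFDerivAt.comp_hasDerivAt (0 : ℝ) ?_ h4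
    simpa using hq.hasFDerivAt
  have h6 := (h2.div_const (l ^ 2)).mul h5
  simp only [zero_smul, sub_zero, mul_zero, zero_div, add_zero, map_smul, smul_eq_mul] at h6
  refine h6.congr_deriv ?_
  field_simp
  ring

/-- A positive differentiable function that is symmetric under some inversion about every point
is a quadratic polynomial. -/
lemma exists_eq_quadratic [NeZero n] {q : 𝔼 → ℝ} (hq : Differentiable ℝ q) (hpos : ∀ x, 0 < q x)
    (hsym : ∀ b, ∃ l > 0, ∀ x, x ≠ b →
      q x = ‖x - b‖ ^ 2 / l ^ 2 * q (b + (l / ‖x - b‖) ^ 2 • (x - b))) :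
    ∃ (x₀ : 𝔼) (a d : ℝ), 0 < a ∧ 0 < d ∧ ∀ x, q x = a * (‖x - x₀‖ ^ 2 + d) := by
  choose l hl hsym using hsym
  have hG : ∀ b e : 𝔼, e ≠ 0 → ∀ᶠ τ : ℝ in nhdsWithin 0 {0}ᶜ, τ ^ 2 * q (τ⁻¹ • e) =
      ‖e - τ • b‖ ^ 2 / l b ^ 2 * q (b + (l b ^ 2 * τ / ‖e - τ • b‖ ^ 2) • (e - τ • b)) := by
    intro b e he
    have hc : ContinuousAt (fun τ : ℝ => e - τ • b) 0 := by fun_prop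
    have h1 : ∀ᶠ τ : ℝ in nhds 0, e - τ • b ≠ 0 := hc.eventually_ne (by simpa using he)
    filter_upwards [h1.filter_mono nhdsWithin_le_nhds, self_mem_nhdsWithin] with τ hτ hτ0
    have hτ0 : τ ≠ 0 := hτ0
    have h2 : τ⁻¹ • e - b = τ⁻¹ • (e - τ • b) := by
      rw [smul_sub, smul_smul, inv_mul_cancel₀ hτ0, one_smul]
    have h3 : τ⁻¹ • e ≠ b := by
      rw [← sub_ne_zero, h2]
      exact smul_ne_zero (inv_ne_zero hτ0) hτ
    have h4 : ‖e - τ • b‖ ≠ 0 := norm_ne_zero_iff.2 hτ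
    rw [hsym b _ h3, h2, norm_smul, smul_smul, norm_inv, Real.norm_eq_abs]
    have h5 : (l b / (|τ|⁻¹ * ‖e - τ • b‖)) ^ 2 * τ⁻¹ = l b ^ 2 * τ / ‖e - τ • b‖ ^ 2 := by
      rw [div_pow, mul_pow, inv_pow, sq_abs]
      field_simp
    rw [h5, mul_pow, inv_pow, sq_abs]
    field_simp
  have key : ∀ b e : 𝔼, e ≠ 0 → q 0 / l 0 ^ 2 = q b / l b ^ 2 ∧
      fderiv ℝ q b e - 2 * (q b / l b ^ 2) * inner ℝ b e = fderiv ℝ q 0 e := by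
    intro b e he
    have he' : ‖e‖ ≠ 0 := norm_ne_zero_iff.2 he
    have d0 := hasDerivAt_inverted (hq 0) he (hl 0)
    have db := hasDerivAt_inverted (hq b) he (hl b)
    have hev : (fun τ : ℝ => ‖e - τ • (0 : 𝔼)‖ ^ 2 / l 0 ^ 2 *
        q (0 + (l 0 ^ 2 * τ / ‖e - τ • (0 : 𝔼)‖ ^ 2) • (e - τ • (0 : 𝔼)))) =ᶠ[nhdsWithin 0 {0}ᶜ]
        (fun τ : ℝ => ‖e - τ • b‖ ^ 2 / l b ^ 2 *
        q (b + (l b ^ 2 * τ / ‖e - τ • b‖ ^ 2) • (e - τ • b))) := by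
      filter_upwards [hG 0 e he, hG b e he] with τ h0 h1
      exact h0.symm.trans h1
    have hval := tendsto_nhds_unique_of_eventuallyEq
      (d0.continuousAt.tendsto.mono_left nhdsWithin_le_nhds)
      (db.continuousAt.tendsto.mono_left nhdsWithin_le_nhds) hev
    have hev' := eventuallyEq_nhds_of_eventuallyEq_nhdsNE hev hval
    have hder := (d0.congr_of_eventuallyEq hev'.symm).unique db
    simp only [zero_smul, sub_zero, mul_zero, zero_div, add_zero] at hval
    simp only [inner_zero_left, mul_zero, sub_zero] at hder
    refine ⟨?_, hder.symm⟩
    have h7 : ‖e‖ ^ 2 ≠ 0 := pow_ne_zero 2 he'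
    have h8 : ‖e‖ ^ 2 * (q 0 / l 0 ^ 2) = ‖e‖ ^ 2 * (q b / l b ^ 2) := by
      linear_combination hval
    exact mul_left_cancel₀ h7 h8
  have hne : Nonempty (Fin n) := ⟨0⟩
  obtain ⟨e₀, he₀⟩ := exists_ne (0 : 𝔼)
  set a := q 0 / l 0 ^ 2 with ha
  have ha0 : 0 < a := div_pos (hpos 0) (pow_pos (hl 0) 2)
  obtain ⟨v, hv⟩ := (InnerProductSpace.toDual ℝ 𝔼).surjective (fderiv ℝ q 0)
  have hv' : ∀ e, fderiv ℝ q 0 e = inner ℝ v e := fun e => by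
    rw [← hv, InnerProductSpace.toDual_apply_apply]
  have hder : ∀ b e : 𝔼, fderiv ℝ q b e = 2 * a * inner ℝ b e + inner ℝ v e := by
    intro b e
    rcases eq_or_ne e 0 with rfl | he
    · simp
    have h1 := (key b e he).2
    rw [← (key b e he).1, hv'] at h1
    linarith
  set x₀ : 𝔼 := -((2 * a)⁻¹ • v) with hx₀
  have hdiff : ∀ x, HasFDerivAt (fun x => q x - a * ‖x - x₀‖ ^ 2) (0 : 𝔼 →L[ℝ] ℝ) x := by
    intro x
    have h1 := (hq x).hasFDerivAt.sub ((((hasFDerivAt_id x).sub_const x₀).norm_sq).const_mul a)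
    refine h1.congr_fderiv ?_
    ext e
    simp [hder, hx₀]
    field_simp
    ring
  have hconst : ∀ x, q x - a * ‖x - x₀‖ ^ 2 = q x₀ := by
    intro x
    have := is_const_of_fderiv_eq_zero (fun x => (hdiff x).differentiableAt)
      (fun x => (hdiff x).fderiv) x x₀
    simpa using this
  refine ⟨x₀, a, q x₀ / a, ha0, div_pos (hpos _) ha0, fun x => ?_⟩
  have := hconst x
  field_simp
  linarith

lemma exists_eq_bubble [NeZero n] {u : 𝔼 → ℝ} (hu : Differentiable ℝ u)
    (hsym : ∀ b, ∃ l > 0, ∀ x, x ≠ 0 → u (x + b) = kelvin l (fun y => u (y + b)) x) :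
    ∃ (x₀ : 𝔼) (ε C₁ : ℝ), 0 < ε ∧ 0 < C₁ ∧
      ∀ x, u x = Real.log (C₁ / (‖x - x₀‖ ^ 2 + ε ^ 2)) := by
  obtain ⟨x₀, a, d, ha, hd, h⟩ := exists_eq_quadratic (q := fun x => Real.exp (-u x))
    hu.neg.exp (fun x => Real.exp_pos _) (fun b => by
      obtain ⟨l, hl, hk⟩ := hsym b
      refine ⟨l, hl, fun x hx => ?_⟩
      have hx' : x - b ≠ 0 := sub_ne_zero.2 hx
      have h1 := hk (x - b) hx'
      have hp : 0 < l / ‖x - b‖ := div_pos hl (norm_pos_iff.2 hx')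
      rw [sub_add_cancel, kelvin, inv0_eq, add_comm _ b] at h1
      rw [h1, neg_add, Real.exp_add, mul_comm]
      congr 1
      rw [show -(2 * Real.log (l / ‖x - b‖)) = Real.log (((l / ‖x - b‖) ^ 2)⁻¹) by
        rw [Real.log_inv, Real.log_pow]; norm_num, Real.exp_log (by positivity), div_pow, inv_div])
  refine ⟨x₀, √d, 1 / a, Real.sqrt_pos.2 hd, by positivity, fun x => ?_⟩
  rw [Real.sq_sqrt hd.le, div_div, ← h x, one_div, ← Real.exp_neg, neg_neg, Real.log_exp]

/-- The map displacing points in the direction `e` by `t ψ`. -/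
def shear (ψ : 𝔼 → ℝ) (e : 𝔼) (t : ℝ) (x : 𝔼) : 𝔼 := x + (t * ψ x) • e

/-- The derivative of `shear`. -/
def shearDeriv (ψ : 𝔼 → ℝ) (e : 𝔼) (t : ℝ) (x : 𝔼) : 𝔼 →L[ℝ] 𝔼 :=
  ContinuousLinearMap.id ℝ 𝔼 + (t • fderiv ℝ ψ x).smulRight e

lemma hasFDerivAt_shear {ψ : 𝔼 → ℝ} (hψ : Differentiable ℝ ψ) (e : 𝔼) (t : ℝ) (x : 𝔼) :
    HasFDerivAt (shear ψ e t) (shearDeriv ψ e t x) x :=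
  (hasFDerivAt_id x).add (((hψ x).hasFDerivAt.const_mul t).smul_const e)

lemma det_shearDeriv (ψ : 𝔼 → ℝ) (e : 𝔼) (t : ℝ) (x : 𝔼) :
    (shearDeriv ψ e t x).det = 1 + t * fderiv ℝ ψ x e := by
  have h : ((shearDeriv ψ e t x : 𝔼 →L[ℝ] 𝔼) : 𝔼 →ₗ[ℝ] 𝔼) =
      LinearMap.transvection ((t • fderiv ℝ ψ x : 𝔼 →L[ℝ] ℝ) : 𝔼 →ₗ[ℝ] ℝ) e := by
    ext1 y
    simp [shearDeriv, LinearMap.transvection.apply]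
  rw [ContinuousLinearMap.det, h, LinearMap.transvection.det]
  simp

lemma norm_shear_sub_le {ψ : 𝔼 → ℝ} {e : 𝔼} {L : ℝ} (hL : ∀ x y, |ψ x - ψ y| * ‖e‖ ≤ L * ‖x - y‖)
    {t : ℝ} (ht : 0 ≤ t) (x y : 𝔼) :
    ‖(t * (ψ x - ψ y)) • e‖ ≤ t * L * ‖x - y‖ := by
  rw [norm_smul, norm_mul, Real.norm_of_nonneg ht, Real.norm_eq_abs, mul_assoc, mul_assoc]
  exact mul_le_mul_of_nonneg_left (hL x y) ht

lemma shear_sub (ψ : 𝔼 → ℝ) (e : 𝔼) (t : ℝ) (x y : 𝔼) :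
    shear ψ e t x - shear ψ e t y = (x - y) + (t * (ψ x - ψ y)) • e := by
  simp only [shear]
  module

lemma shear_injective {ψ : 𝔼 → ℝ} {e : 𝔼} {L : ℝ} (hL : ∀ x y, |ψ x - ψ y| * ‖e‖ ≤ L * ‖x - y‖)
    {t : ℝ} (ht : 0 ≤ t) (htL : t * L ≤ 1 / 2) : Function.Injective (shear ψ e t) := by
  intro x y hxy
  have h1 := shear_sub ψ e t x y
  rw [hxy, sub_self] at h1
  have h2 : ‖x - y‖ = ‖(t * (ψ x - ψ y)) • e‖ := by
    rw [eq_neg_of_add_eq_zero_left h1.symm, norm_neg]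
  have h3 := norm_shear_sub_le hL ht x y
  have h4 : t * L * ‖x - y‖ ≤ 1 / 2 * ‖x - y‖ := by gcongr
  have h5 : ‖x - y‖ = 0 := le_antisymm (by linarith) (norm_nonneg _)
  exact sub_eq_zero.1 (norm_eq_zero.1 h5)

lemma lintegral_comp_shear_le {ψ : 𝔼 → ℝ} (hψ : Differentiable ℝ ψ) {e : 𝔼} {t : ℝ}
    (hinj : Function.Injective (shear ψ e t)) (H : 𝔼 → ENNReal) :
    ∫⁻ x, ENNReal.ofReal (1 + t * fderiv ℝ ψ x e) * H (shear ψ e t x) ≤ ∫⁻ x, H x := by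
  have h := lintegral_image_eq_lintegral_abs_det_fderiv_mul volume MeasurableSet.univ
    (fun x _ => (hasFDerivAt_shear hψ e t x).hasFDerivWithinAt) hinj.injOn H
  simp only [det_shearDeriv, Measure.restrict_univ] at h
  calc ∫⁻ x, ENNReal.ofReal (1 + t * fderiv ℝ ψ x e) * H (shear ψ e t x)
      ≤ ∫⁻ x, ENNReal.ofReal |1 + t * fderiv ℝ ψ x e| * H (shear ψ e t x) := by
        gcongr
        exact le_abs_self _
    _ = ∫⁻ x in shear ψ e t '' Set.univ, H x := h.symm
    _ ≤ ∫⁻ x, H x := lintegral_mono' Measure.restrict_le_self le_rfl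

lemma lintegral_prod_comp_shear_le {ψ : 𝔼 → ℝ} (hψ : ContDiff ℝ 1 ψ) {e : 𝔼} {t : ℝ}
    (hinj : Function.Injective (shear ψ e t)) {H : 𝔼 × 𝔼 → ENNReal} (hH : Measurable H) :
    ∫⁻ p : 𝔼 × 𝔼, ENNReal.ofReal (1 + t * fderiv ℝ ψ p.1 e) *
      (ENNReal.ofReal (1 + t * fderiv ℝ ψ p.2 e) * H (shear ψ e t p.1, shear ψ e t p.2)) ≤
      ∫⁻ p : 𝔼 × 𝔼, H p := by
  have hd : Differentiable ℝ ψ := hψ.differentiable one_ne_zero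
  have hc : Continuous fun x => fderiv ℝ ψ x e :=
    (hψ.continuous_fderiv one_ne_zero).clm_apply continuous_const
  have hJ : Measurable fun x => ENNReal.ofReal (1 + t * fderiv ℝ ψ x e) := by
    have := hc.measurable
    fun_prop
  have hT : Measurable (shear ψ e t) := by
    have := hψ.continuous
    unfold shear
    fun_prop
  rw [Measure.volume_eq_prod, lintegral_prod _ (by fun_prop), lintegral_prod _ hH.aemeasurable]
  calc _ ≤ ∫⁻ x, ENNReal.ofReal (1 + t * fderiv ℝ ψ x e) * ∫⁻ y, H (shear ψ e t x, y) := by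
        refine lintegral_mono fun x => ?_
        dsimp only
        rw [lintegral_const_mul _ (by fun_prop)]
        refine mul_le_mul' le_rfl ?_
        exact lintegral_comp_shear_le hd hinj fun y => H (shear ψ e t x, y)
    _ ≤ _ := lintegral_comp_shear_le hd hinj fun x => ∫⁻ y, H (x, y)

lemma log_norm_add_le {d v : 𝔼} (hd : d ≠ 0) (hv : d + v ≠ 0) :
    Real.log (‖d + v‖ / ‖d‖) ≤ inner ℝ v d / ‖d‖ ^ 2 + (‖v‖ / ‖d‖) ^ 2 / 2 := by
  have h1 : 0 < ‖d‖ := norm_pos_iff.2 hd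
  have h2 : 0 < ‖d + v‖ := norm_pos_iff.2 hv
  have h3 := Real.log_le_sub_one_of_pos (x := (‖d + v‖ / ‖d‖) ^ 2) (by positivity)
  rw [Real.log_pow, div_pow, norm_add_sq_real, real_inner_comm] at h3
  have h4 : (‖d‖ ^ 2 + 2 * inner ℝ v d + ‖v‖ ^ 2) / ‖d‖ ^ 2 - 1 =
      2 * (inner ℝ v d / ‖d‖ ^ 2) + (‖v‖ / ‖d‖) ^ 2 := by
    field_simp
    ring
  push_cast at h3
  linarith

lemma log_norm_add_le_rpow {d v : 𝔼} (hd : d ≠ 0) (hv : d + v ≠ 0) :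
    Real.log (‖d + v‖ / ‖d‖) ≤
      inner ℝ v d / ‖d‖ ^ 2 + 2 * ‖v‖ ^ (3 / 2 : ℝ) * ‖d‖ ^ (-(3 / 2 : ℝ)) := by
  have h1 : 0 < ‖d‖ := norm_pos_iff.2 hd
  have h2 : 0 < ‖d + v‖ := norm_pos_iff.2 hv
  have h0 := norm_nonneg v
  set r := ‖v‖ / ‖d‖ with hr
  have hr0 : 0 ≤ r := by positivity
  have h3 : 2 * ‖v‖ ^ (3 / 2 : ℝ) * ‖d‖ ^ (-(3 / 2 : ℝ)) = 2 * r ^ (3 / 2 : ℝ) := by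
    rw [hr, div_rpow h0 h1.le, rpow_neg h1.le]
    ring
  rw [h3]
  rcases le_total r 1 with h | h
  · have h4 := log_norm_add_le hd hv
    have h5 : r ^ 2 ≤ r ^ (3 / 2 : ℝ) := by
      rw [← rpow_natCast]
      exact rpow_le_rpow_of_exponent_ge' hr0 h (by norm_num) (by norm_num)
    have h6 : 0 ≤ r ^ 2 := by positivity
    linarith
  · have h4 := Real.log_le_sub_one_of_pos (x := ‖d + v‖ / ‖d‖) (by positivity)
    have h5 : ‖d + v‖ / ‖d‖ ≤ 1 + r := by
      rw [div_le_iff₀ h1, hr, add_mul, div_mul_cancel₀ _ h1.ne', one_mul]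
      exact norm_add_le _ _
    have h6 : r ≤ r ^ (3 / 2 : ℝ) := by
      conv_lhs => rw [← rpow_one r]
      exact rpow_le_rpow_of_exponent_le h (by norm_num)
    have h7 : -r ≤ inner ℝ v d / ‖d‖ ^ 2 := by
      have := (abs_le.1 (abs_real_inner_le_norm v d)).1
      rw [le_div_iff₀ (by positivity), hr]
      calc -(‖v‖ / ‖d‖) * ‖d‖ ^ 2 = -(‖v‖ * ‖d‖) := by field_simp
        _ ≤ _ := this
    linarith

lemma sub_sq_le_log {s : ℝ} (hs : |s| ≤ 1 / 2) : s - 2 * s ^ 2 ≤ Real.log (1 + s) := by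
  obtain ⟨h1, h2⟩ := abs_le.1 hs
  have h3 := Real.one_sub_inv_le_log_of_pos (x := 1 + s) (by linarith)
  refine le_trans ?_ h3
  have h4 : 0 < 1 + s := by linarith
  rw [le_sub_iff_add_le, ← le_sub_iff_add_le', inv_le_iff_one_le_mul₀ h4]
  nlinarith [sq_nonneg s, mul_nonneg (sq_nonneg s) (by linarith : 0 ≤ 1 + 2 * s)]

/-- The density of the double integral in `CondB`. -/
def pairDens (μ : ℝ) (u : 𝔼 → ℝ) (p : 𝔼 × 𝔼) : ℝ :=
  dens μ u p.1 * dens μ u p.2 / ‖p.1 - p.2‖ ^ μ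

/-- The difference quotient `(ψ x - ψ y) ⟪e, x - y⟫ / ‖x - y‖²`. -/
def diffQuot (ψ : 𝔼 → ℝ) (e : 𝔼) (p : 𝔼 × 𝔼) : ℝ :=
  (ψ p.1 - ψ p.2) * inner ℝ e (p.1 - p.2) / ‖p.1 - p.2‖ ^ 2

lemma pairDens_nonneg (u : 𝔼 → ℝ) (p : 𝔼 × 𝔼) : 0 ≤ pairDens μ u p :=
  div_nonneg (mul_nonneg (dens_pos μ u _).le (dens_pos μ u _).le) (by positivity)

lemma measurable_pairDens {u : 𝔼 → ℝ} (hu : Continuous u) : Measurable (pairDens μ u) := by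
  have := (continuous_dens (μ := μ) hu).measurable
  unfold pairDens
  fun_prop

lemma measurable_diffQuot {ψ : 𝔼 → ℝ} (hψ : Continuous ψ) (e : 𝔼) :
    Measurable (diffQuot ψ e) := by
  have := hψ.measurable
  have : Measurable fun p : 𝔼 × 𝔼 => inner ℝ e (p.1 - p.2) :=
    (continuous_const.inner (continuous_fst.sub continuous_snd)).measurable
  unfold diffQuot
  fun_prop

lemma abs_diffQuot_le {ψ : 𝔼 → ℝ} {e : 𝔼} {L : ℝ} (hL0 : 0 ≤ L)
    (hL : ∀ x y, |ψ x - ψ y| * ‖e‖ ≤ L * ‖x - y‖) (p : 𝔼 × 𝔼) : |diffQuot ψ e p| ≤ L := by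
  unfold diffQuot
  rcases (norm_nonneg (p.1 - p.2)).eq_or_lt with h | h
  · rw [← h]
    simpa using hL0
  rw [abs_div, abs_mul, abs_of_pos (by positivity : 0 < ‖p.1 - p.2‖ ^ 2),
    div_le_iff₀ (by positivity)]
  calc |ψ p.1 - ψ p.2| * |inner ℝ e (p.1 - p.2)|
      ≤ |ψ p.1 - ψ p.2| * (‖e‖ * ‖p.1 - p.2‖) := by
        gcongr
        exact abs_real_inner_le_norm _ _
    _ = |ψ p.1 - ψ p.2| * ‖e‖ * ‖p.1 - p.2‖ := by ring
    _ ≤ L * ‖p.1 - p.2‖ * ‖p.1 - p.2‖ := by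
        exact mul_le_mul_of_nonneg_right (hL _ _) h.le
    _ = _ := by ring

lemma pairDens_shear {ψ : 𝔼 → ℝ} {e : 𝔼} {L : ℝ} (hL : ∀ x y, |ψ x - ψ y| * ‖e‖ ≤ L * ‖x - y‖)
    (hμ0 : 0 < μ) (hL' : ∀ x, |fderiv ℝ ψ x e| ≤ L) {t : ℝ} (ht : 0 ≤ t) (htL : t * L ≤ 1 / 2)
    (u : 𝔼 → ℝ) (p : 𝔼 × 𝔼) :
    pairDens μ u p * (1 + ((2 * n - μ) / 2 * (u (shear ψ e t p.1) - u p.1) +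
      (2 * n - μ) / 2 * (u (shear ψ e t p.2) - u p.2) - μ * (t * diffQuot ψ e p) +
      t * (fderiv ℝ ψ p.1 e + fderiv ℝ ψ p.2 e) - (μ / 2 + 4) * (t * L) ^ 2)) ≤
    (1 + t * fderiv ℝ ψ p.1 e) * ((1 + t * fderiv ℝ ψ p.2 e) *
      pairDens μ u (shear ψ e t p.1, shear ψ e t p.2)) := by
  obtain ⟨x, y⟩ := p
  dsimp only
  have hJ : ∀ x, |t * fderiv ℝ ψ x e| ≤ t * L := fun x => by
    rw [abs_mul, abs_of_nonneg ht]
    exact mul_le_mul_of_nonneg_left (hL' x) ht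
  have hJ0 : ∀ x, 0 < 1 + t * fderiv ℝ ψ x e := fun x => by
    linarith [(abs_le.1 (hJ x)).1]
  have hJl : ∀ x, t * fderiv ℝ ψ x e - 2 * (t * L) ^ 2 ≤ Real.log (1 + t * fderiv ℝ ψ x e) := by
    intro x
    have h1 := sub_sq_le_log ((hJ x).trans htL)
    have h2 := sq_le_sq' (abs_le.1 (hJ x)).1 (abs_le.1 (hJ x)).2
    linarith
  rcases eq_or_ne x y with rfl | hxy
  · have h0 : pairDens μ u (x, x) = 0 := by simp [pairDens, zero_rpow hμ0.ne']
    rw [h0, zero_mul]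
    exact mul_nonneg (hJ0 _).le (mul_nonneg (hJ0 _).le (pairDens_nonneg u _))
  have hd : x - y ≠ 0 := sub_ne_zero.2 hxy
  have hTd : shear ψ e t x - shear ψ e t y ≠ 0 :=
    sub_ne_zero.2 ((shear_injective hL ht htL).ne hxy)
  have hr : 0 < ‖x - y‖ := norm_pos_iff.2 hd
  have hTr : 0 < ‖shear ψ e t x - shear ψ e t y‖ := norm_pos_iff.2 hTd
  have hlog : Real.log (‖shear ψ e t x - shear ψ e t y‖ / ‖x - y‖) ≤
      t * diffQuot ψ e (x, y) + (t * L) ^ 2 / 2 := by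
    have h1 := log_norm_add_le hd (v := (t * (ψ x - ψ y)) • e) (shear_sub ψ e t x y ▸ hTd)
    rw [← shear_sub] at h1
    have h2 : ‖(t * (ψ x - ψ y)) • e‖ / ‖x - y‖ ≤ t * L := by
      rw [div_le_iff₀ hr]
      exact norm_shear_sub_le hL ht x y
    have h3 : (‖(t * (ψ x - ψ y)) • e‖ / ‖x - y‖) ^ 2 ≤ (t * L) ^ 2 := by gcongr
    have h4 : inner ℝ ((t * (ψ x - ψ y)) • e) (x - y) / ‖x - y‖ ^ 2 =
        t * diffQuot ψ e (x, y) := by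
      rw [real_inner_smul_left, diffQuot]
      ring
    rw [h4] at h1
    linarith
  rw [Real.log_div hTr.ne' hr.ne'] at hlog
  have e1 : ∀ x y : 𝔼, 0 < ‖x - y‖ → pairDens μ u (x, y) =
      Real.exp ((2 * n - μ) / 2 * u x + (2 * n - μ) / 2 * u y - μ * Real.log ‖x - y‖) := by
    intro x y h
    rw [pairDens, dens, dens, Real.exp_sub, Real.exp_add, rpow_def_of_pos h, mul_comm μ]
  rw [e1 x y hr, e1 _ _ hTr, ← Real.exp_log (hJ0 x), ← Real.exp_log (hJ0 y), ← Real.exp_add,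
    ← Real.exp_add]
  refine (mul_le_mul_of_nonneg_left ((add_comm _ _).trans_le (Real.add_one_le_exp _))
    (Real.exp_pos _).le).trans ?_
  rw [← Real.exp_add, Real.exp_le_exp]
  have := mul_le_mul_of_nonneg_left hlog hμ0.le
  linarith [hJl x, hJl y]

lemma integral_pairDens_mul_fst {u : 𝔼 → ℝ} (hB : CondB n μ u) {h : 𝔼 → ℝ} {K : ℝ}
    (hm : Measurable h) (hK : ∀ x, |h x| ≤ K) :
    Integrable (fun p : 𝔼 × 𝔼 => pairDens μ u p * h p.1) ∧
      ∫ p : 𝔼 × 𝔼, pairDens μ u p * h p.1 = ∫ x, h x * charge μ u x := by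
  have hi : Integrable (fun p : 𝔼 × 𝔼 => pairDens μ u p * h p.1) :=
    Integrable.mul_bdd (c := K) hB.2 (hm.comp measurable_fst).aestronglyMeasurable
      (ae_of_all _ fun p => hK p.1)
  refine ⟨hi, ?_⟩
  rw [Measure.volume_eq_prod] at hi ⊢
  rw [integral_prod _ hi]
  congr 1
  ext x
  simp only [pairDens, charge, V, dens]
  rw [integral_mul_const, mul_comm]
  congr 1
  rw [← integral_mul_const]
  congr 1
  ext y
  ring

lemma pairDens_swap (u : 𝔼 → ℝ) (p : 𝔼 × 𝔼) : pairDens μ u p.swap = pairDens μ u p := by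
  simp only [pairDens, Prod.fst_swap, Prod.snd_swap, norm_sub_rev p.2]
  ring

lemma integral_pairDens_mul_snd {u : 𝔼 → ℝ} (hB : CondB n μ u) {h : 𝔼 → ℝ} {K : ℝ}
    (hm : Measurable h) (hK : ∀ x, |h x| ≤ K) :
    Integrable (fun p : 𝔼 × 𝔼 => pairDens μ u p * h p.2) ∧
      ∫ p : 𝔼 × 𝔼, pairDens μ u p * h p.2 = ∫ x, h x * charge μ u x := by
  obtain ⟨h1, h2⟩ := integral_pairDens_mul_fst hB hm hK
  rw [Measure.volume_eq_prod] at h1 h2 ⊢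
  refine ⟨h1.swap.congr (ae_of_all _ fun p => ?_), ?_⟩
  · simp [pairDens_swap]
  · rw [← h2, ← integral_prod_swap]
    simp [pairDens_swap]

lemma integral_le_toReal_lintegral {α : Type*} [MeasurableSpace α] {ν : Measure α} {f : α → ℝ}
    (hf : Integrable f ν) : ∫ x, f x ∂ν ≤ (∫⁻ x, ENNReal.ofReal (f x) ∂ν).toReal := by
  rw [integral_eq_lintegral_pos_part_sub_lintegral_neg_part hf]
  linarith [ENNReal.toReal_nonneg (a := ∫⁻ x, ENNReal.ofReal (-f x) ∂ν)]

/-- Change of variables in the double integral, to first order in `t`. -/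
lemma integral_shear_le {u : 𝔼 → ℝ} (hu : Continuous u) (hB : CondB n μ u) (hμ0 : 0 < μ)
    {ψ : 𝔼 → ℝ} (hψ : ContDiff ℝ 1 ψ) (hψc : HasCompactSupport ψ) {e : 𝔼} {L : ℝ}
    (hL : ∀ x y, |ψ x - ψ y| * ‖e‖ ≤ L * ‖x - y‖) (hL' : ∀ x, |fderiv ℝ ψ x e| ≤ L)
    {t : ℝ} (ht : 0 ≤ t) (htL : t * L ≤ 1 / 2) :
    Integrable (fun x => (u (shear ψ e t x) - u x) * charge μ u x) ∧
    (2 * n - μ) * ∫ x, (u (shear ψ e t x) - u x) * charge μ u x ≤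
      μ * t * (∫ p : 𝔼 × 𝔼, pairDens μ u p * diffQuot ψ e p) -
      2 * t * (∫ x, fderiv ℝ ψ x e * charge μ u x) +
      (μ / 2 + 4) * (t * L) ^ 2 * ∫ x, charge μ u x := by
  have hL0 : 0 ≤ L := (abs_nonneg _).trans (hL' 0)
  have hTc : Continuous (shear ψ e t) := by
    have := hψ.continuous
    unfold shear
    fun_prop
  have hac : Continuous fun x => u (shear ψ e t x) - u x := (hu.comp hTc).sub hu
  obtain ⟨A, hA⟩ : ∃ A, ∀ x, |u (shear ψ e t x) - u x| ≤ A := by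
    have : HasCompactSupport fun x => u (shear ψ e t x) - u x := by
      refine hψc.mono fun x hx => ?_
      contrapose! hx
      simp only [Function.mem_support, not_not] at hx ⊢
      simp [shear, hx]
    exact this.exists_bound_of_continuous hac
  have hdc : Continuous fun x => fderiv ℝ ψ x e :=
    (hψ.continuous_fderiv one_ne_zero).clm_apply continuous_const
  obtain ⟨ia1, ea1⟩ := integral_pairDens_mul_fst hB hac.measurable hA
  obtain ⟨ia2, ea2⟩ := integral_pairDens_mul_snd hB hac.measurable hA
  obtain ⟨id1, ed1⟩ := integral_pairDens_mul_fst hB hdc.measurable hL'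
  obtain ⟨id2, ed2⟩ := integral_pairDens_mul_snd hB hdc.measurable hL'
  have i0 : Integrable (pairDens μ u) := hB.2
  have e0 : ∫ p, pairDens μ u p = ∫ x, charge μ u x := integral_charge hB
  have ic : Integrable (fun p : 𝔼 × 𝔼 => pairDens μ u p * diffQuot ψ e p) :=
    Integrable.mul_bdd (c := L) hB.2 (measurable_diffQuot hψ.continuous e).aestronglyMeasurable
      (ae_of_all _ (abs_diffQuot_le hL0 hL))
  refine ⟨(charge_integrable hB).bdd_mul hac.aestronglyMeasurable (ae_of_all _ hA), ?_⟩
  set G : 𝔼 × 𝔼 → ℝ := fun p => pairDens μ u p *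
    (1 + ((2 * n - μ) / 2 * (u (shear ψ e t p.1) - u p.1) +
      (2 * n - μ) / 2 * (u (shear ψ e t p.2) - u p.2) - μ * (t * diffQuot ψ e p) +
      t * (fderiv ℝ ψ p.1 e + fderiv ℝ ψ p.2 e) - (μ / 2 + 4) * (t * L) ^ 2)) with hG
  have hGeq : ∀ p, G p = pairDens μ u p +
      ((2 * n - μ) / 2 * (pairDens μ u p * (u (shear ψ e t p.1) - u p.1)) +
      ((2 * n - μ) / 2 * (pairDens μ u p * (u (shear ψ e t p.2) - u p.2)) +
      (t * (pairDens μ u p * fderiv ℝ ψ p.1 e) + (t * (pairDens μ u p * fderiv ℝ ψ p.2 e) +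
      ((-(μ * t)) * (pairDens μ u p * diffQuot ψ e p) +
      (-((μ / 2 + 4) * (t * L) ^ 2)) * pairDens μ u p))))) := fun p => by
    simp only [hG]
    ring
  have hlt : ∫⁻ p, ENNReal.ofReal (pairDens μ u p) ≠ ⊤ := by
    rw [← ofReal_integral_eq_lintegral_ofReal i0 (ae_of_all _ (pairDens_nonneg u))]
    exact ENNReal.ofReal_ne_top
  have j6 := (ic.const_mul (-(μ * t))).add (i0.const_mul (-((μ / 2 + 4) * (t * L) ^ 2)))
  have j5 := (id2.const_mul t).add j6
  have j4 := (id1.const_mul t).add j5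
  have j3 := (ia2.const_mul ((2 * n - μ) / 2)).add j4
  have j2 := (ia1.const_mul ((2 * n - μ) / 2)).add j3
  have iG : Integrable G := (i0.add j2).congr (ae_of_all _ fun p => (hGeq p).symm)
  have key : ∫ p, G p ≤ ∫ p, pairDens μ u p := by
    refine (integral_le_toReal_lintegral iG).trans ?_
    rw [integral_eq_lintegral_of_nonneg_ae (ae_of_all _ (pairDens_nonneg u))
      i0.aestronglyMeasurable]
    refine ENNReal.toReal_mono hlt (le_trans (lintegral_mono fun p => ?_)
      (lintegral_prod_comp_shear_le hψ (shear_injective hL ht htL)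
        (measurable_pairDens (μ := μ) hu).ennreal_ofReal))
    have hJ0 : ∀ x, 0 ≤ 1 + t * fderiv ℝ ψ x e := fun x => by
      have := mul_le_mul_of_nonneg_left (abs_le.1 (hL' x)).1 ht
      linarith
    rw [← ENNReal.ofReal_mul (hJ0 _), ← ENNReal.ofReal_mul (hJ0 _)]
    exact ENNReal.ofReal_le_ofReal (pairDens_shear hL hμ0 hL' ht htL u p)
  have eG : ∫ p, G p = (∫ x, charge μ u x) +
      ((2 * n - μ) / 2 * (∫ x, (u (shear ψ e t x) - u x) * charge μ u x) +
      ((2 * n - μ) / 2 * (∫ x, (u (shear ψ e t x) - u x) * charge μ u x) +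
      (t * (∫ x, fderiv ℝ ψ x e * charge μ u x) + (t * (∫ x, fderiv ℝ ψ x e * charge μ u x) +
      ((-(μ * t)) * (∫ p : 𝔼 × 𝔼, pairDens μ u p * diffQuot ψ e p) +
      (-((μ / 2 + 4) * (t * L) ^ 2)) * ∫ x, charge μ u x))))) := by
    refine (integral_congr_ae (ae_of_all _ hGeq)).trans ((integral_add i0 j2).trans ?_)
    rw [integral_add' (ia1.const_mul _) j3, integral_add' (ia2.const_mul _) j4,
      integral_add' (id1.const_mul _) j5, integral_add' (id2.const_mul _) j6,
      integral_add' (ic.const_mul _) (i0.const_mul _)]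
    simp only [integral_const_mul, ea1, ea2, ed1, ed2, e0]
  rw [eG, e0] at key
  linarith

lemma abs_inner_div_le (e d : 𝔼) : |inner ℝ e d / ‖d‖ ^ 2| ≤ ‖e‖ * ‖d‖ ^ (-1 : ℝ) := by
  rcases (norm_nonneg d).eq_or_lt with h | h
  · rw [← h]
    simp only [ne_eq, OfNat.ofNat_ne_zero, not_false_eq_true, zero_pow, div_zero, abs_zero]
    positivity
  rw [abs_div, abs_of_pos (by positivity : 0 < ‖d‖ ^ 2), div_le_iff₀ (by positivity),
    rpow_neg_one]
  calc |inner ℝ e d| ≤ ‖e‖ * ‖d‖ := abs_real_inner_le_norm _ _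
    _ = ‖e‖ * ‖d‖⁻¹ * ‖d‖ ^ 2 := by field_simp

lemma LocBddIntegrable.integrable_inner_mul {h : 𝔼 → ℝ} (H : LocBddIntegrable h) (hn : 2 ≤ n)
    (e x : 𝔼) : Integrable fun y => inner ℝ e (x - y) / ‖x - y‖ ^ 2 * h y := by
  have hn1 : (1 : ℝ) < n := by exact_mod_cast hn
  refine ((H.integrable_mul_rpow zero_le_one hn1 x).abs.const_mul ‖e‖).mono' ?_
    (ae_of_all _ fun y => ?_)
  · have : Measurable fun y : 𝔼 => inner ℝ e (x - y) :=
      (continuous_const.inner (continuous_const.sub continuous_id)).measurable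
    exact (by fun_prop : Measurable fun y : 𝔼 =>
      inner ℝ e (x - y) / ‖x - y‖ ^ 2).aestronglyMeasurable.mul H.integrable.aestronglyMeasurable
  · rw [Real.norm_eq_abs, abs_mul, abs_mul, abs_of_nonneg (by positivity : 0 ≤ ‖x - y‖ ^ (-1 : ℝ))]
    have := mul_le_mul_of_nonneg_right (abs_inner_div_le e (x - y)) (abs_nonneg (h y))
    linarith

/-- The logarithmic potential gains at most its formal first variation, up to `o(t)`. -/
lemma IsSol.exists_sub_shear_le (hn : 2 ≤ n) {u : 𝔼 → ℝ} (h : IsSol n μ β u) (hβ : 0 < β)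
    {ψ : 𝔼 → ℝ} (hψ : Continuous ψ) (hψc : HasCompactSupport ψ) (e : 𝔼) :
    ∃ K, 0 ≤ K ∧ ∀ t, 0 ≤ t → ∀ x, u x - u (shear ψ e t x) ≤
      t / β * (ψ x * ∫ y, inner ℝ e (x - y) / ‖x - y‖ ^ 2 * charge μ u y) +
        t ^ (3 / 2 : ℝ) * K := by
  have : NeZero n := ⟨by omega⟩
  have hn1 : (3 / 2 : ℝ) < n := by
    have : (2 : ℝ) ≤ n := by exact_mod_cast hn
    linarith
  obtain ⟨R, hR⟩ := hψc.isCompact.isBounded.subset_closedBall 0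
  obtain ⟨B, hB⟩ := hψc.exists_bound_of_continuous hψ
  have hB0 : 0 ≤ B := (norm_nonneg _).trans (hB 0)
  obtain ⟨K, hK0, hK⟩ := h.charge_lbi.exists_integral_mul_rpow_le
    (by norm_num : (0 : ℝ) ≤ 3 / 2) hn1 R
  refine ⟨1 / β * (2 * (B * ‖e‖) ^ (3 / 2 : ℝ) * K), by positivity, fun t ht x => ?_⟩
  by_cases hx : ψ x = 0
  · simp only [shear, hx, mul_zero, zero_smul, add_zero, sub_self, zero_mul, zero_add]
    positivity
  have hxR : ‖x‖ ≤ R := by simpa using hR (subset_tsupport _ hx)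
  have i1 := h.charge_lbi.integrable_inner_mul hn e x
  have i2 := h.charge_lbi.integrable_mul_rpow (by norm_num : (0 : ℝ) ≤ 3 / 2) hn1 x
  have hv : ‖(t * ψ x) • e‖ ≤ t * (B * ‖e‖) := by
    rw [norm_smul, norm_mul, Real.norm_of_nonneg ht, mul_assoc]
    gcongr
    exact hB x
  have hintg : ∫ y, Real.log (‖shear ψ e t x - y‖ / ‖x - y‖) * charge μ u y ≤
      ∫ y, (t * ψ x * (inner ℝ e (x - y) / ‖x - y‖ ^ 2 * charge μ u y) +
        2 * (t * (B * ‖e‖)) ^ (3 / 2 : ℝ) * (charge μ u y * ‖x - y‖ ^ (-(3 / 2) : ℝ))) := by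
    refine integral_mono_ae (h.charge_lbi.integrable_log_sub_mul hn x _)
      ((i1.const_mul _).add (i2.const_mul _)) ?_
    filter_upwards [ae_ne x, ae_ne (shear ψ e t x)] with y hy1 hy2
    have h1 : x - y + (t * ψ x) • e = shear ψ e t x - y := by
      simp only [shear]
      module
    have h2 := log_norm_add_le_rpow (d := x - y) (v := (t * ψ x) • e) (sub_ne_zero.2 hy1.symm)
      (by rw [h1]; exact sub_ne_zero.2 hy2.symm)
    rw [h1, real_inner_smul_left] at h2
    have h3 : ‖(t * ψ x) • e‖ ^ (3 / 2 : ℝ) ≤ (t * (B * ‖e‖)) ^ (3 / 2 : ℝ) :=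
      rpow_le_rpow (norm_nonneg _) hv (by norm_num)
    have h4 : 0 ≤ ‖x - y‖ ^ (-(3 / 2) : ℝ) := by positivity
    calc _ ≤ (t * ψ x * inner ℝ e (x - y) / ‖x - y‖ ^ 2 +
          2 * (t * (B * ‖e‖)) ^ (3 / 2 : ℝ) * ‖x - y‖ ^ (-(3 / 2) : ℝ)) * charge μ u y := by
          refine mul_le_mul_of_nonneg_right (h2.trans ?_) (charge_nonneg u y)
          gcongr
      _ = _ := by ring
  rw [integral_add (i1.const_mul _) (i2.const_mul _), integral_const_mul,
    integral_const_mul] at hintg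
  have h5 : ∫ y, charge μ u y * ‖x - y‖ ^ (-(3 / 2) : ℝ) ≤ K := by
    have := hK x hxR
    simpa only [abs_of_nonneg (charge_nonneg u _)] using this
  rw [h.diff x]
  calc _ ≤ 1 / β * (t * ψ x * (∫ y, inner ℝ e (x - y) / ‖x - y‖ ^ 2 * charge μ u y) +
        2 * (t * (B * ‖e‖)) ^ (3 / 2 : ℝ) * K) := by
        gcongr
        refine hintg.trans ?_
        gcongr
    _ = _ := by
        rw [mul_rpow ht (by positivity)]
        ring

lemma IsSol.integral_mul_inner (hn : 2 ≤ n) {u : 𝔼 → ℝ} (h : IsSol n μ β u)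
    {ψ : 𝔼 → ℝ} (hψ : Continuous ψ) (hψc : HasCompactSupport ψ) (e : 𝔼) :
    Integrable (fun x => (ψ x * ∫ y, inner ℝ e (x - y) / ‖x - y‖ ^ 2 * charge μ u y) *
      charge μ u x) ∧
    ∫ x, (ψ x * ∫ y, inner ℝ e (x - y) / ‖x - y‖ ^ 2 * charge μ u y) * charge μ u x =
      1 / 2 * ∫ p : 𝔼 × 𝔼, diffQuot ψ e p * (charge μ u p.1 * charge μ u p.2) := by
  have hn1 : (1 : ℝ) < n := by exact_mod_cast hn
  obtain ⟨R, hR⟩ := hψc.isCompact.isBounded.subset_closedBall 0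
  obtain ⟨B, hB⟩ := hψc.exists_bound_of_continuous hψ
  have hB0 : 0 ≤ B := (norm_nonneg _).trans (hB 0)
  obtain ⟨K, hK0, hK⟩ := h.charge_lbi.exists_integral_mul_rpow_le zero_le_one hn1 R
  have hm := h.charge_lbi.integrable
  set f : 𝔼 × 𝔼 → ℝ := fun p => ψ p.1 * charge μ u p.1 *
    (inner ℝ e (p.1 - p.2) / ‖p.1 - p.2‖ ^ 2 * charge μ u p.2) with hf
  have hfm : AEStronglyMeasurable f (volume.prod volume) := by
    have h1 : Measurable fun p : 𝔼 × 𝔼 => inner ℝ e (p.1 - p.2) :=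
      (continuous_const.inner (continuous_fst.sub continuous_snd)).measurable
    have h2 : Measurable fun p : 𝔼 × 𝔼 => inner ℝ e (p.1 - p.2) / ‖p.1 - p.2‖ ^ 2 := by fun_prop
    exact ((hψ.comp continuous_fst).aestronglyMeasurable.mul hm.aestronglyMeasurable.comp_fst).mul
      (h2.aestronglyMeasurable.mul hm.aestronglyMeasurable.comp_snd)
  have hfi : Integrable f (volume.prod volume) := by
    rw [integrable_prod_iff hfm]
    refine ⟨ae_of_all _ fun x => 
      (h.charge_lbi.integrable_inner_mul hn e x).const_mul (ψ x * charge μ u x), ?_⟩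
    refine (hm.const_mul (B * (‖e‖ * K))).mono' hfm.norm.integral_prod_right'
      (ae_of_all _ fun x => ?_)
    rw [Real.norm_of_nonneg (integral_nonneg fun y => norm_nonneg _)]
    by_cases hx : ψ x = 0
    · simp only [hf, hx, zero_mul, norm_zero, integral_zero]
      have := charge_nonneg (μ := μ) u x
      positivity
    have hxR : ‖x‖ ≤ R := by simpa using hR (subset_tsupport _ hx)
    simp only [hf, norm_mul (ψ x * charge μ u x), integral_const_mul]
    have h3 : ∫ y, ‖inner ℝ e (x - y) / ‖x - y‖ ^ 2 * charge μ u y‖ ≤ ‖e‖ * K := by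
      refine le_trans ?_ (mul_le_mul_of_nonneg_left (hK x hxR) (norm_nonneg e))
      rw [← integral_const_mul]
      refine integral_mono (h.charge_lbi.integrable_inner_mul hn e x).norm
        (((h.charge_lbi.integrable_mul_rpow zero_le_one hn1 x).abs.const_mul ‖e‖).congr
          (ae_of_all _ fun y => ?_)) fun y => ?_
      · dsimp only
        rw [abs_mul, abs_of_nonneg (by positivity : 0 ≤ ‖x - y‖ ^ (-1 : ℝ))]
      · dsimp only
        rw [norm_mul, Real.norm_eq_abs, Real.norm_eq_abs]
        have := mul_le_mul_of_nonneg_right (abs_inner_div_le e (x - y))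
          (abs_nonneg (charge μ u y))
        linarith
    rw [norm_mul, Real.norm_of_nonneg (charge_nonneg u x)]
    calc _ ≤ B * charge μ u x * (‖e‖ * K) := by
          have := charge_nonneg (μ := μ) u x
          gcongr
          exact hB x
      _ = _ := by ring
  have hfx : ∀ x, ∫ y, f (x, y) =
      (ψ x * ∫ y, inner ℝ e (x - y) / ‖x - y‖ ^ 2 * charge μ u y) * charge μ u x := fun x => by
    simp only [hf, integral_const_mul]
    ring
  refine ⟨hfi.integral_prod_left.congr (ae_of_all _ hfx), ?_⟩
  have h1 : ∫ p, f p ∂(volume.prod volume) =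
      ∫ x, (ψ x * ∫ y, inner ℝ e (x - y) / ‖x - y‖ ^ 2 * charge μ u y) * charge μ u x := by
    rw [integral_prod _ hfi]
    exact integral_congr_ae (ae_of_all _ hfx)
  have h2 : ∫ p : 𝔼 × 𝔼, f p.swap ∂(volume.prod volume) = ∫ p, f p ∂(volume.prod volume) :=
    integral_prod_swap f
  have h3 : ∫ p : 𝔼 × 𝔼, diffQuot ψ e p * (charge μ u p.1 * charge μ u p.2) =
      (∫ p, f p ∂(volume.prod volume)) + ∫ p : 𝔼 × 𝔼, f p.swap ∂(volume.prod volume) := by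
    refine Eq.trans ?_ (integral_add hfi hfi.swap)
    rw [Measure.volume_eq_prod]
    congr 1
    ext p
    simp only [hf, diffQuot, Prod.fst_swap, Prod.snd_swap]
    rw [← neg_sub p.1 p.2, inner_neg_right, norm_neg]
    ring
  rw [h3, h2, h1]
  ring

/-- A domain-variation inequality for the double integral in `CondB`. -/
lemma IsSol.variation_le (hn : 2 ≤ n) {u : 𝔼 → ℝ} (h : IsSol n μ β u) (hβ : 0 < β)
    (hB : CondB n μ u) (hμ0 : 0 < μ) (hμn : μ < n) {ψ : 𝔼 → ℝ} (hψ : ContDiff ℝ 1 ψ)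
    (hψc : HasCompactSupport ψ) {e : 𝔼} {L : ℝ}
    (hL : ∀ x y, |ψ x - ψ y| * ‖e‖ ≤ L * ‖x - y‖) (hL' : ∀ x, |fderiv ℝ ψ x e| ≤ L) :
    2 * (∫ x, fderiv ℝ ψ x e * charge μ u x) ≤
      (2 * n - μ) / (2 * β) *
        (∫ p : 𝔼 × 𝔼, diffQuot ψ e p * (charge μ u p.1 * charge μ u p.2)) +
      μ * ∫ p : 𝔼 × 𝔼, pairDens μ u p * diffQuot ψ e p := by
  obtain ⟨K, hK0, hK⟩ := h.exists_sub_shear_le hn hβ hψ.continuous hψc e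
  obtain ⟨i1, e1⟩ := h.integral_mul_inner hn hψ.continuous hψc e
  have hm := h.charge_lbi.integrable
  have hn0 : (0 : ℝ) ≤ n := Nat.cast_nonneg n
  have hL0 : 0 ≤ L := (abs_nonneg _).trans (hL' 0)
  set D := ∫ x, fderiv ℝ ψ x e * charge μ u x
  set Q := ∫ p : 𝔼 × 𝔼, diffQuot ψ e p * (charge μ u p.1 * charge μ u p.2)
  set P := ∫ p : 𝔼 × 𝔼, pairDens μ u p * diffQuot ψ e p
  set M := ∫ x, charge μ u x
  have key : ∀ t, 0 < t → t * L ≤ 1 / 2 → 2 * D ≤ (2 * n - μ) / (2 * β) * Q + μ * P +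
      ((2 * n - μ) * K * M * t ^ (1 / 2 : ℝ) + (μ / 2 + 4) * L ^ 2 * M * t) := by
    intro t ht htL
    obtain ⟨i2, h2⟩ := integral_shear_le h.cont hB hμ0 hψ hψc hL hL' ht.le htL
    have h3 : -(t / β * (1 / 2 * Q) + t ^ (3 / 2 : ℝ) * K * M) ≤
        ∫ x, (u (shear ψ e t x) - u x) * charge μ u x := by
      rw [← e1, ← integral_const_mul, ← integral_const_mul,
        ← integral_add (i1.const_mul _) (hm.const_mul _), ← integral_neg]
      refine integral_mono ((i1.const_mul _).add (hm.const_mul _)).neg i2 fun x => ?_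
      have := mul_le_mul_of_nonneg_right (hK t ht.le x) (charge_nonneg (μ := μ) u x)
      dsimp only [Pi.neg_apply]
      linarith
    have h4 := mul_le_mul_of_nonneg_left h3 (by linarith : 0 ≤ 2 * n - μ)
    have h5 : t ^ (3 / 2 : ℝ) = t * t ^ (1 / 2 : ℝ) := by
      rw [← rpow_one_add' ht.le (by norm_num)]
      norm_num
    rw [h5] at h4
    have h6 : t * (2 * D) ≤ t * ((2 * n - μ) / (2 * β) * Q + μ * P +
      ((2 * n - μ) * K * M * t ^ (1 / 2 : ℝ) + (μ / 2 + 4) * L ^ 2 * M * t)) := by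
      have h7 := h4.trans h2
      have h8 : (2 * n - μ) * (t / β * (1 / 2 * Q)) = t * ((2 * n - μ) / (2 * β) * Q) := by
        field_simp
      linarith
    exact le_of_mul_le_mul_left h6 ht
  have hlim : Tendsto (fun t : ℝ => (2 * n - μ) / (2 * β) * Q + μ * P +
      ((2 * n - μ) * K * M * t ^ (1 / 2 : ℝ) + (μ / 2 + 4) * L ^ 2 * M * t))
      (nhdsWithin 0 (Set.Ioi 0)) (nhds ((2 * n - μ) / (2 * β) * Q + μ * P)) := by
    have hc : Continuous (fun t : ℝ => (2 * n - μ) / (2 * β) * Q + μ * P +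
        ((2 * n - μ) * K * M * t ^ (1 / 2 : ℝ) + (μ / 2 + 4) * L ^ 2 * M * t)) := by
      have := Real.continuous_rpow_const (q := 1 / 2) (by norm_num)
      fun_prop
    have := (hc.tendsto 0).mono_left (nhdsWithin_le_nhds (s := Set.Ioi 0))
    simpa using this
  refine ge_of_tendsto hlim ?_
  have h1 : ∀ᶠ t : ℝ in nhdsWithin 0 (Set.Ioi 0), t * L ≤ 1 / 2 := by
    have hc : Tendsto (fun t : ℝ => t * L) (nhds 0) (nhds (0 * L)) :=
      (continuous_id.mul continuous_const).tendsto 0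
    rw [zero_mul] at hc
    exact nhdsWithin_le_nhds (hc.eventually (Iic_mem_nhds (by norm_num)))
  filter_upwards [h1, self_mem_nhdsWithin] with t ht1 ht0 using key t ht0 ht1

lemma IsSol.variation_eq (hn : 2 ≤ n) {u : 𝔼 → ℝ} (h : IsSol n μ β u) (hβ : 0 < β)
    (hB : CondB n μ u) (hμ0 : 0 < μ) (hμn : μ < n) {ψ : 𝔼 → ℝ} (hψ : ContDiff ℝ 1 ψ)
    (hψc : HasCompactSupport ψ) {e : 𝔼} {L : ℝ}
    (hL : ∀ x y, |ψ x - ψ y| * ‖e‖ ≤ L * ‖x - y‖) (hL' : ∀ x, |fderiv ℝ ψ x e| ≤ L) :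
    2 * (∫ x, fderiv ℝ ψ x e * charge μ u x) =
      (2 * n - μ) / (2 * β) *
        (∫ p : 𝔼 × 𝔼, diffQuot ψ e p * (charge μ u p.1 * charge μ u p.2)) +
      μ * ∫ p : 𝔼 × 𝔼, pairDens μ u p * diffQuot ψ e p := by
  refine le_antisymm (h.variation_le hn hβ hB hμ0 hμn hψ hψc hL hL') ?_
  have h1 := h.variation_le hn hβ hB hμ0 hμn (ψ := fun x => -ψ x) hψ.neg hψc.neg (e := e) (L := L)
    (fun x y => by rw [← abs_neg]; simpa [neg_add_eq_sub] using hL x y)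
    (fun x => by rw [fderiv_fun_neg]; simpa using hL' x)
  have h2 : ∀ p, diffQuot (fun x => -ψ x) e p = -diffQuot ψ e p := fun p => by
    simp only [diffQuot]
    ring
  simp only [h2, fderiv_fun_neg, neg_apply, neg_mul, mul_neg,
    integral_neg] at h1
  linarith

/-- Cut-offs of a coordinate function with a common Lipschitz constant. -/
lemma exists_coord_cutoff (i : Fin n) :
    ∃ (ψ : ℕ → 𝔼 → ℝ) (C : NNReal), (∀ k, ContDiff ℝ 1 (ψ k)) ∧ (∀ k, HasCompactSupport (ψ k)) ∧
      (∀ k, LipschitzWith C (ψ k)) ∧ ∀ x, ∀ᶠ k in atTop, ψ k =ᶠ[nhds x] fun y => y i := by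
  let χ : ContDiffBump (0 : 𝔼) := ⟨1, 2, one_pos, one_lt_two⟩
  have hφ : ContDiff ℝ 1 fun x : 𝔼 => χ x * x i :=
    χ.contDiff.mul (EuclideanSpace.proj (𝕜 := ℝ) i).contDiff
  have hφc : HasCompactSupport fun x : 𝔼 => χ x * x i := χ.hasCompactSupport.mul_right
  obtain ⟨C, hC⟩ := hφ.lipschitzWith_of_hasCompactSupport hφc one_ne_zero
  have hk : ∀ k : ℕ, (0 : ℝ) < k + 1 := fun k => by positivity
  refine ⟨fun k x => (k + 1 : ℝ) * (χ ((k + 1 : ℝ)⁻¹ • x) * ((k + 1 : ℝ)⁻¹ • x) i), C,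
    fun k => ?_, fun k => ?_, fun k => ?_, fun x => ?_⟩
  · exact contDiff_const.mul (hφ.comp (contDiff_id.const_smul (k + 1 : ℝ)⁻¹))
  · exact (hφc.comp_homeomorph
      (Homeomorph.smulOfNeZero (k + 1 : ℝ)⁻¹ (inv_ne_zero (hk k).ne'))).mul_left
  · refine LipschitzWith.of_dist_le_mul fun x y => ?_
    have h := hC.dist_le_mul ((k + 1 : ℝ)⁻¹ • x) ((k + 1 : ℝ)⁻¹ • y)
    rw [dist_smul₀, Real.norm_of_nonneg (inv_pos.2 (hk k)).le] at h
    rw [Real.dist_eq] at h ⊢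
    rw [← mul_sub, abs_mul, abs_of_pos (hk k)]
    calc _ ≤ (k + 1 : ℝ) * (C * ((k + 1 : ℝ)⁻¹ * dist x y)) := by gcongr
      _ = _ := by field_simp
  · obtain ⟨N, hN⟩ := exists_nat_gt ‖x‖
    filter_upwards [eventually_ge_atTop N] with k hkN
    have hx : ‖x‖ < k + 1 := by
      have : (N : ℝ) ≤ k := by exact_mod_cast hkN
      linarith
    filter_upwards [(isOpen_lt continuous_norm continuous_const).mem_nhds hx] with y hy
    have h1 : χ ((k + 1 : ℝ)⁻¹ • y) = 1 := by
      refine χ.one_of_mem_closedBall ?_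
      rw [mem_closedBall_zero_iff, norm_smul, Real.norm_of_nonneg (inv_pos.2 (hk k)).le,
        inv_mul_le_iff₀ (hk k)]
      have : ‖y‖ < k + 1 := hy
      simpa [χ] using this.le
    rw [h1, one_mul, PiLp.smul_apply, smul_eq_mul, mul_inv_cancel_left₀ (hk k).ne']

lemma IsSol.variation_coord (hn : 2 ≤ n) {u : 𝔼 → ℝ} (h : IsSol n μ β u) (hβ : 0 < β)
    (hB : CondB n μ u) (hμ0 : 0 < μ) (hμn : μ < n) (i : Fin n) :
    2 * (∫ x, charge μ u x) =
      (2 * n - μ) / (2 * β) * (∫ p : 𝔼 × 𝔼,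
        (p.1 - p.2) i ^ 2 / ‖p.1 - p.2‖ ^ 2 * (charge μ u p.1 * charge μ u p.2)) +
      μ * ∫ p : 𝔼 × 𝔼, pairDens μ u p * ((p.1 - p.2) i ^ 2 / ‖p.1 - p.2‖ ^ 2) := by
  obtain ⟨ψ, C, h1, hc, hC, hlim⟩ := exists_coord_cutoff i
  set e : 𝔼 := EuclideanSpace.single i 1
  have he : ‖e‖ = 1 := by simp [e]
  have hL : ∀ k x y, |ψ k x - ψ k y| * ‖e‖ ≤ C * ‖x - y‖ := fun k x y => by
    rw [he, mul_one, ← Real.dist_eq, ← dist_eq_norm]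
    exact (hC k).dist_le_mul x y
  have hL' : ∀ k x, |fderiv ℝ (ψ k) x e| ≤ C := fun k x => by
    have := (fderiv ℝ (ψ k) x).le_opNorm e
    rw [he, mul_one, Real.norm_eq_abs] at this
    exact this.trans (norm_fderiv_le_of_lipschitz ℝ (hC k))
  have hm := h.charge_lbi.integrable
  have hmm : Integrable (fun p : 𝔼 × 𝔼 => charge μ u p.1 * charge μ u p.2) := hm.mul_prod hm
  have i0 : Integrable (pairDens μ u) := hB.2
  have hq : ∀ p : 𝔼 × 𝔼, Tendsto (fun k => diffQuot (ψ k) e p) atTop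
      (nhds ((p.1 - p.2) i ^ 2 / ‖p.1 - p.2‖ ^ 2)) := fun p => by
    refine tendsto_const_nhds.congr' ?_
    filter_upwards [hlim p.1, hlim p.2] with k h1 h2
    rw [diffQuot, h1.eq_of_nhds, h2.eq_of_nhds, EuclideanSpace.inner_single_left]
    simp only [map_one, one_mul, PiLp.sub_apply]
    ring
  have hd : ∀ x, Tendsto (fun k => fderiv ℝ (ψ k) x e) atTop (nhds 1) := fun x => by
    refine tendsto_const_nhds.congr' ?_
    filter_upwards [hlim x] with k hk
    rw [hk.fderiv_eq]
    have : (fun y : 𝔼 => y i) = EuclideanSpace.proj (𝕜 := ℝ) i := rfl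
    rw [this, ContinuousLinearMap.fderiv]
    simp [e]
  have t1 : Tendsto (fun k => ∫ x, fderiv ℝ (ψ k) x e * charge μ u x) atTop
      (nhds (∫ x, 1 * charge μ u x)) := by
    refine tendsto_integral_of_dominated_convergence (fun x => C * charge μ u x)
      (fun k => ?_) (hm.const_mul _) (fun k => ae_of_all _ fun x => ?_)
      (ae_of_all _ fun x => (hd x).mul_const _)
    · exact (((h1 k).continuous_fderiv one_ne_zero).clm_apply
        continuous_const).aestronglyMeasurable.mul hm.aestronglyMeasurable
    · rw [norm_mul, Real.norm_of_nonneg (charge_nonneg u x)]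
      exact mul_le_mul_of_nonneg_right (hL' k x) (charge_nonneg u x)
  have t2 : Tendsto (fun k => ∫ p : 𝔼 × 𝔼, diffQuot (ψ k) e p * (charge μ u p.1 * charge μ u p.2))
      atTop (nhds (∫ p : 𝔼 × 𝔼,
        (p.1 - p.2) i ^ 2 / ‖p.1 - p.2‖ ^ 2 * (charge μ u p.1 * charge μ u p.2))) := by
    refine tendsto_integral_of_dominated_convergence
      (fun p => C * (charge μ u p.1 * charge μ u p.2))
      (fun k => ?_) (hmm.const_mul _) (fun k => ae_of_all _ fun p => ?_)
      (ae_of_all _ fun p => (hq p).mul_const _)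
    · exact (measurable_diffQuot (h1 k).continuous e).aestronglyMeasurable.mul
        hmm.aestronglyMeasurable
    · have h0 := mul_nonneg (charge_nonneg (μ := μ) u p.1) (charge_nonneg (μ := μ) u p.2)
      rw [norm_mul, Real.norm_of_nonneg h0]
      exact mul_le_mul_of_nonneg_right (abs_diffQuot_le C.2 (hL k) p) h0
  have t3 : Tendsto (fun k => ∫ p : 𝔼 × 𝔼, pairDens μ u p * diffQuot (ψ k) e p)
      atTop (nhds (∫ p : 𝔼 × 𝔼, pairDens μ u p * ((p.1 - p.2) i ^ 2 / ‖p.1 - p.2‖ ^ 2))) := by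
    refine tendsto_integral_of_dominated_convergence (fun p => pairDens μ u p * C)
      (fun k => ?_) (i0.mul_const _) (fun k => ae_of_all _ fun p => ?_)
      (ae_of_all _ fun p => (hq p).const_mul _)
    · exact i0.aestronglyMeasurable.mul
        (measurable_diffQuot (h1 k).continuous e).aestronglyMeasurable
    · rw [norm_mul, Real.norm_of_nonneg (pairDens_nonneg u p)]
      exact mul_le_mul_of_nonneg_left (abs_diffQuot_le C.2 (hL k) p) (pairDens_nonneg u p)
  simp only [one_mul] at t1
  refine tendsto_nhds_unique (t1.const_mul 2) (((t2.const_mul _).add (t3.const_mul μ)).congr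
    fun k => ?_)
  exact (h.variation_eq hn hβ hB hμ0 hμn (h1 k) (hc k) (hL k) (hL' k)).symm

lemma coord_div_nonneg (d : 𝔼) (i : Fin n) : 0 ≤ d i ^ 2 / ‖d‖ ^ 2 := by positivity

lemma coord_div_le_one (d : 𝔼) (i : Fin n) : d i ^ 2 / ‖d‖ ^ 2 ≤ 1 := by
  refine div_le_one_of_le₀ ?_ (by positivity)
  rw [EuclideanSpace.real_norm_sq_eq]
  exact Finset.single_le_sum (f := fun i => d i ^ 2) (fun j _ => sq_nonneg _) (Finset.mem_univ i)

lemma sum_coord_div {d : 𝔼} (hd : d ≠ 0) : ∑ i, d i ^ 2 / ‖d‖ ^ 2 = 1 := by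
  rw [← Finset.sum_div, ← EuclideanSpace.real_norm_sq_eq]
  exact div_self (pow_ne_zero 2 (norm_ne_zero_iff.2 hd))

/-- The Pohozaev identity: the total charge is determined by the equation. -/
lemma IsSol.integral_charge_eq (hn : 2 ≤ n) {u : 𝔼 → ℝ} (h : IsSol n μ β u) (hβ : 0 < β)
    (hB : CondB n μ u) (hμ0 : 0 < μ) (hμn : μ < n) : ∫ x, charge μ u x = 2 * β := by
  have : NeZero n := ⟨by omega⟩
  have hn0 : (0 : ℝ) < n := by exact_mod_cast (by omega : 0 < n)
  have hm := h.charge_lbi.integrable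
  have hmm : Integrable (fun p : 𝔼 × 𝔼 => charge μ u p.1 * charge μ u p.2) := hm.mul_prod hm
  have i0 : Integrable (pairDens μ u) := hB.2
  have e0 : ∫ p, pairDens μ u p = ∫ x, charge μ u x := integral_charge hB
  have hM : 0 < ∫ x, charge μ u x := by
    refine (integral_pos_iff_support_of_nonneg (charge_nonneg u) hm).2 ?_
    have : Function.support (charge μ u) = Set.univ := Set.eq_univ_of_forall fun x =>
      (mul_pos (V_pos hn hμ0.le hμn h.cont h.dens_integrable x) (dens_pos μ u x)).ne'
    rw [this]
    exact isOpen_univ.measure_pos _ Set.univ_nonempty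
  have hqm : ∀ i : Fin n, Measurable fun p : 𝔼 × 𝔼 => (p.1 - p.2) i ^ 2 / ‖p.1 - p.2‖ ^ 2 := by
    intro i
    have : Measurable fun p : 𝔼 × 𝔼 => (p.1 - p.2) i := Continuous.measurable (by fun_prop)
    fun_prop
  have hqb : ∀ (i : Fin n) (p : 𝔼 × 𝔼), ‖(p.1 - p.2) i ^ 2 / ‖p.1 - p.2‖ ^ 2‖ ≤ 1 := by
    intro i p
    rw [Real.norm_of_nonneg (coord_div_nonneg _ i)]
    exact coord_div_le_one _ i
  have s1 : ∑ i : Fin n, ∫ p : 𝔼 × 𝔼,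
      (p.1 - p.2) i ^ 2 / ‖p.1 - p.2‖ ^ 2 * (charge μ u p.1 * charge μ u p.2) =
      (∫ x, charge μ u x) * ∫ x, charge μ u x := by
    rw [← integral_finsetSum _ fun i _ => hmm.bdd_mul (hqm i).aestronglyMeasurable
      (ae_of_all _ (hqb i)), ← integral_prod_mul, Measure.volume_eq_prod]
    refine integral_congr_ae ?_
    have hne : ∀ᵐ p : 𝔼 × 𝔼 ∂(volume.prod volume), p ∈ {p : 𝔼 × 𝔼 | p.2 ≠ p.1} :=
      (Measure.ae_prod_mem_iff_ae_ae_mem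
        (isOpen_ne_fun continuous_snd continuous_fst).measurableSet).2
          (ae_of_all _ fun x => ae_ne x)
    filter_upwards [hne] with p hp
    rw [← Finset.sum_mul, sum_coord_div (sub_ne_zero.2 (Ne.symm hp)), one_mul]
  have s2 : ∑ i : Fin n, ∫ p : 𝔼 × 𝔼,
      pairDens μ u p * ((p.1 - p.2) i ^ 2 / ‖p.1 - p.2‖ ^ 2) = ∫ x, charge μ u x := by
    rw [← integral_finsetSum _ fun i _ => i0.mul_bdd (hqm i).aestronglyMeasurable
      (ae_of_all _ (hqb i)), ← e0]
    congr 1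
    ext p
    rw [← Finset.mul_sum]
    rcases eq_or_ne p.1 p.2 with hp | hp
    · simp [pairDens, hp, zero_rpow hμ0.ne']
    · rw [sum_coord_div (sub_ne_zero.2 hp), mul_one]
  have key := Finset.sum_congr (rfl : (Finset.univ : Finset (Fin n)) = Finset.univ)
    fun i _ => h.variation_coord hn hβ hB hμ0 hμn i
  rw [Finset.sum_add_distrib, ← Finset.mul_sum, ← Finset.mul_sum, ← Finset.mul_sum, s1, s2,
    Finset.sum_const, Finset.card_univ, Fintype.card_fin, nsmul_eq_mul] at key
  set M := ∫ x, charge μ u x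
  have h1 : (2 * n - μ) * (M - 2 * β) = 0 := by
    field_simp at key
    linarith
  have h2 : (2 * n - μ : ℝ) ≠ 0 := by linarith
  linarith [(mul_eq_zero.1 h1).resolve_left h2]

end LogPotential

theorem classification_of_solutions (n : ℕ) (hn : 2 ≤ n) (μ : ℝ) (hμ0 : 0 < μ) (hμn : μ < n)
    (u : EuclideanSpace ℝ (Fin n) → ℝ) (hu : ContDiff ℝ n u)
    (hB : CondB n μ u) (hIE : IE n μ u) :
    ∃ (x₀ : EuclideanSpace ℝ (Fin n)) (ε C₁ : ℝ), 0 < ε ∧ 0 < C₁ ∧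
      ∀ x : EuclideanSpace ℝ (Fin n), u x = Real.log (C₁ / (‖x - x₀‖ ^ 2 + ε ^ 2)) := by
  have : NeZero n := ⟨by omega⟩
  have hβ := LogPotential.betaN_pos hn
  have h := LogPotential.isSol_of_IE hn hμ0 hμn hu.continuous hB hIE
  have hM := h.integral_charge_eq hn hβ hB hμ0 hμn
  refine LogPotential.exists_eq_bubble
    (hu.differentiable (by exact_mod_cast (by omega : n ≠ 0))) fun b => ?_
  exact (h.comp_add b).exists_eq_kelvin hn hβ hμ0 hμn
    ((LogPotential.integral_charge_comp_add u b).trans hM)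
end
end

section
/- Let n ≥ 2 and 0 < μ < n. Suppose u ∈ C²(ℝⁿ) satisfies ∫_{ℝⁿ} v(y) e^{((2n−μ)/2) u(y)} dy < ∞ and ∫_{ℝⁿ} e^{((2n−μ)/2) u(y)} dy < ∞, and that u solves: Δu(x) + v(x) e^{((4−μ)/2) u(x)} = 0 for all x, in case n = 2; and Δu(x) + (n−2) ∫_{ℝⁿ} v(y) e^{((2n−μ)/2) u(y)} / |x−y|² dy = 0 for all x, in case n ≥ 3. Then there exists a constant C > 0 such that u(x) ≤ C and v(x) ≤ C for all x ∈ ℝⁿ. -/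
open MeasureTheory Real Filter Metric

noncomputable section

/-- The Laplacian of `f : ℝⁿ → ℝ` computed coordinatewise via Fréchet derivatives. -/
noncomputable def lap (n : ℕ) (f : EuclideanSpace ℝ (Fin n) → ℝ)
    (x : EuclideanSpace ℝ (Fin n)) : ℝ :=
  ∑ i : Fin n,
    fderiv ℝ (fun y => fderiv ℝ f y (EuclideanSpace.single i (1 : ℝ))) x
      (EuclideanSpace.single i (1 : ℝ))

/-- The `k`-fold iterate of the negative Laplacian `(-Δ)^k`. -/
noncomputable def negLapIter (n k : ℕ) (f : EuclideanSpace ℝ (Fin n) → ℝ) :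
    EuclideanSpace ℝ (Fin n) → ℝ :=
  (fun g x => -(lap n g x))^[k] f

lemma integrableOn_norm_rpow_neg {n : ℕ} (hn : 2 ≤ n) {s : ℝ} (hs : s < n) (r : ℝ) :
    IntegrableOn (fun z : EuclideanSpace ℝ (Fin n) => ‖z‖ ^ (-s)) (ball 0 r) := by
  have h : LocallyIntegrable (fun z : EuclideanSpace ℝ (Fin n) => ‖z‖ ^ (-s)) := by
    refine locallyIntegrable_of_norm_le_rpow (C := 1) (α := s) (by simp; omega) (by simpa using hs)
      (.of_forall fun x => ?_) ?_
    · simp [abs_of_nonneg (rpow_nonneg (norm_nonneg x) _)]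
    · exact (measurable_norm.pow_const _).aestronglyMeasurable
  exact (h.integrableOn_isCompact (isCompact_closedBall 0 r)).mono_set ball_subset_closedBall

lemma setIntegral_ball_norm_rpow_neg {n : ℕ} {s : ℝ} {δ : ℝ} (hδ : 0 < δ) :
    ∫ z in ball (0 : EuclideanSpace ℝ (Fin n)) δ, ‖z‖ ^ (-s) =
      δ ^ (n - s) * ∫ z in ball (0 : EuclideanSpace ℝ (Fin n)) 1, ‖z‖ ^ (-s) := by
  have h := Measure.setIntegral_comp_smul_of_pos (volume : Measure (EuclideanSpace ℝ (Fin n)))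
    (fun z => ‖z‖ ^ (-s)) (ball 0 1) hδ
  rw [smul_unitBall_of_pos hδ] at h
  simp only [norm_smul, norm_eq_abs, abs_of_pos hδ, finrank_euclideanSpace, Fintype.card_fin,
    smul_eq_mul] at h
  simp_rw [mul_rpow hδ.le (norm_nonneg _)] at h
  rw [integral_const_mul, eq_comm, inv_mul_eq_iff_eq_mul₀ (by positivity)] at h
  rw [h, rpow_sub hδ, rpow_natCast, rpow_neg hδ.le]
  ring

lemma integral_div_norm_rpow_le {n : ℕ} (hn : 2 ≤ n) {s : ℝ} (hs0 : 0 < s) (hs : s < n)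
    {h : EuclideanSpace ℝ (Fin n) → ℝ} (h0 : ∀ y, 0 ≤ h y) (hh : Integrable h)
    {w : EuclideanSpace ℝ (Fin n)} {δ H : ℝ} (hδ : 0 < δ) (hH : ∀ y ∈ ball w δ, h y ≤ H) :
    ∫ y, h y / ‖w - y‖ ^ s ≤
      (∫ z in ball (0 : EuclideanSpace ℝ (Fin n)) 1, ‖z‖ ^ (-s)) * H * δ ^ (n - s) +
        δ ^ (-s) * ∫ y, h y := by
  have hH0 : 0 ≤ H := (h0 w).trans (hH w (mem_ball_self hδ))
  set k : EuclideanSpace ℝ (Fin n) → ℝ := (ball 0 δ).indicator (fun z => ‖z‖ ^ (-s)) with hk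
  have hki : Integrable k :=
    (integrable_indicator_iff measurableSet_ball).2 (integrableOn_norm_rpow_neg hn hs δ)
  have hkw : Integrable (fun y => k (w - y)) := hki.comp_sub_left w
  have hkv : ∫ y, k (w - y) =
      δ ^ (n - s) * ∫ z in ball (0 : EuclideanSpace ℝ (Fin n)) 1, ‖z‖ ^ (-s) := by
    rw [integral_sub_left_eq_self k volume w, hk, integral_indicator measurableSet_ball,
      setIntegral_ball_norm_rpow_neg hδ]
  have key : ∀ y, h y / ‖w - y‖ ^ s ≤ H * k (w - y) + δ ^ (-s) * h y := by
    intro y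
    by_cases hy : y ∈ ball w δ
    · have hm : w - y ∈ ball (0 : EuclideanSpace ℝ (Fin n)) δ := by
        rw [mem_ball_zero_iff, ← dist_eq_norm, dist_comm]; exact hy
      rw [hk, Set.indicator_of_mem hm, rpow_neg (norm_nonneg _), div_eq_mul_inv]
      have := mul_le_mul_of_nonneg_right (hH y hy)
        (inv_nonneg.2 (rpow_nonneg (norm_nonneg (w - y)) s))
      have := mul_nonneg (rpow_nonneg hδ.le (-s)) (h0 y)
      linarith
    · have hm : w - y ∉ ball (0 : EuclideanSpace ℝ (Fin n)) δ := by
        rw [mem_ball_zero_iff, ← dist_eq_norm, dist_comm]; exact hy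
      rw [hk, Set.indicator_of_notMem hm, mul_zero, zero_add, rpow_neg hδ.le, div_eq_inv_mul]
      have : δ ≤ ‖w - y‖ := by simpa [mem_ball_zero_iff] using hm
      gcongr
      exact h0 y
  calc ∫ y, h y / ‖w - y‖ ^ s ≤ ∫ y, (H * k (w - y) + δ ^ (-s) * h y) := by
        refine integral_mono_of_nonneg (.of_forall fun y => ?_)
          ((hkw.const_mul H).add (hh.const_mul _)) (.of_forall key)
        exact div_nonneg (h0 y) (rpow_nonneg (norm_nonneg _) _)
    _ = _ := by
        rw [integral_add (hkw.const_mul H) (hh.const_mul _), integral_const_mul,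
          integral_const_mul, hkv]
        ring

lemma hasDerivAt_max_zero_pow_three (t : ℝ) :
    HasDerivAt (fun t : ℝ => (max 0 t) ^ 3) (3 * (max 0 t) ^ 2) t := by
  rcases lt_trichotomy t 0 with h | rfl | h
  · have : (fun t : ℝ => (max 0 t) ^ 3) =ᶠ[nhds t] fun _ => 0 := by
      filter_upwards [Iio_mem_nhds h] with s hs
      simp [max_eq_left (le_of_lt (Set.mem_Iio.1 hs))]
    simpa [max_eq_left h.le] using (hasDerivAt_const t (0 : ℝ)).congr_of_eventuallyEq this
  · rw [hasDerivAt_iff_isLittleO_nhds_zero]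
    simp only [zero_add, max_self]
    have h1 : (fun h : ℝ => h ^ 3) =o[nhds 0] fun h : ℝ => h := by
      simpa using (Asymptotics.isLittleO_pow_pow (𝕜 := ℝ) (show 1 < 3 by norm_num))
    refine Asymptotics.IsBigO.trans_isLittleO (Asymptotics.IsBigO.of_bound 1 ?_) h1
    refine .of_forall fun h => ?_
    simp only [norm_eq_abs, one_mul]
    have : |max 0 h| ≤ |h| := by
      rw [abs_of_nonneg (le_max_left _ _)]
      exact max_le (abs_nonneg _) (le_abs_self _)
    simpa [abs_pow] using pow_le_pow_left₀ (abs_nonneg _) this 3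
  · have : (fun t : ℝ => (max 0 t) ^ 3) =ᶠ[nhds t] fun t => t ^ 3 := by
      filter_upwards [Ioi_mem_nhds h] with s hs
      simp [max_eq_right (le_of_lt (Set.mem_Ioi.1 hs))]
    simpa [max_eq_right h.le] using (hasDerivAt_pow 3 t).congr_of_eventuallyEq this

/-- The radial weight `((1 - ‖z‖²)₊)²`. -/
def radialWeight (n : ℕ) (z : EuclideanSpace ℝ (Fin n)) : ℝ := (max 0 (1 - ‖z‖ ^ 2)) ^ 2

/-- The radial function `((1 - ‖z‖²)₊)³ / 6`, whose gradient is `-z` times the radial weight. -/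
def radialPotential (n : ℕ) (z : EuclideanSpace ℝ (Fin n)) : ℝ := (max 0 (1 - ‖z‖ ^ 2)) ^ 3 / 6

lemma continuous_radialWeight (n : ℕ) : Continuous (radialWeight n) := by
  unfold radialWeight; fun_prop

lemma continuous_radialPotential (n : ℕ) : Continuous (radialPotential n) := by
  unfold radialPotential; fun_prop

lemma radialWeight_nonneg {n : ℕ} (z : EuclideanSpace ℝ (Fin n)) : 0 ≤ radialWeight n z := by
  unfold radialWeight; positivity

lemma radialPotential_nonneg {n : ℕ} (z : EuclideanSpace ℝ (Fin n)) :
    0 ≤ radialPotential n z := by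
  unfold radialPotential; positivity

lemma max_zero_one_sub_norm_sq_le {n : ℕ} (z : EuclideanSpace ℝ (Fin n)) :
    max 0 (1 - ‖z‖ ^ 2) ≤ 1 :=
  max_le zero_le_one (by nlinarith [sq_nonneg ‖z‖])

lemma radialWeight_le_one {n : ℕ} (z : EuclideanSpace ℝ (Fin n)) : radialWeight n z ≤ 1 :=
  pow_le_one₀ (le_max_left _ _) (max_zero_one_sub_norm_sq_le z)

lemma radialPotential_le_one {n : ℕ} (z : EuclideanSpace ℝ (Fin n)) :
    radialPotential n z ≤ 1 := by
  have := pow_le_one₀ (n := 3) (le_max_left _ _) (max_zero_one_sub_norm_sq_le z)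
  unfold radialPotential
  linarith

lemma max_zero_one_sub_norm_sq_eq_zero {n : ℕ} {z : EuclideanSpace ℝ (Fin n)}
    (hz : z ∉ ball (0 : EuclideanSpace ℝ (Fin n)) 1) : max 0 (1 - ‖z‖ ^ 2) = 0 := by
  rw [mem_ball_zero_iff, not_lt] at hz
  exact max_eq_left (by nlinarith)

lemma radialWeight_eq_zero {n : ℕ} {z : EuclideanSpace ℝ (Fin n)}
    (hz : z ∉ ball (0 : EuclideanSpace ℝ (Fin n)) 1) : radialWeight n z = 0 := by
  simp [radialWeight, max_zero_one_sub_norm_sq_eq_zero hz]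

lemma radialPotential_eq_zero {n : ℕ} {z : EuclideanSpace ℝ (Fin n)}
    (hz : z ∉ ball (0 : EuclideanSpace ℝ (Fin n)) 1) : radialPotential n z = 0 := by
  simp [radialPotential, max_zero_one_sub_norm_sq_eq_zero hz]

lemma hasCompactSupport_radialWeight (n : ℕ) : HasCompactSupport (radialWeight n) :=
  .of_support_subset_isCompact (isCompact_closedBall 0 1) fun z hz => by
    by_contra h
    exact hz (radialWeight_eq_zero fun h' => h (ball_subset_closedBall h'))

lemma hasCompactSupport_radialPotential (n : ℕ) : HasCompactSupport (radialPotential n) :=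
  .of_support_subset_isCompact (isCompact_closedBall 0 1) fun z hz => by
    by_contra h
    exact hz (radialPotential_eq_zero fun h' => h (ball_subset_closedBall h'))

lemma hasFDerivAt_radialPotential {n : ℕ} (z : EuclideanSpace ℝ (Fin n)) :
    HasFDerivAt (radialPotential n) (-radialWeight n z • innerSL ℝ z) z := by
  have h1 : HasFDerivAt (fun z : EuclideanSpace ℝ (Fin n) => 1 - ‖z‖ ^ 2)
      (-(2 • innerSL ℝ z)) z := by
    simpa using (hasStrictFDerivAt_norm_sq z).hasFDerivAt.const_sub 1
  have h2 := ((hasDerivAt_max_zero_pow_three (1 - ‖z‖ ^ 2)).comp_hasFDerivAt z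
    h1).const_mul (1 / 6)
  refine (h2.congr_fderiv ?_).congr_of_eventuallyEq (.of_forall fun y => ?_)
  · ext y
    simp [radialWeight]
    ring
  · simp [radialPotential]
    ring

lemma fderiv_radialPotential_single {n : ℕ} (z : EuclideanSpace ℝ (Fin n)) (i : Fin n) :
    fderiv ℝ (radialPotential n) z (EuclideanSpace.single i 1) = -(z i * radialWeight n z) := by
  rw [(hasFDerivAt_radialPotential z).fderiv]
  simp [EuclideanSpace.inner_single_right]
  ring

lemma contDiff_one_fderiv_apply {n : ℕ} {u : EuclideanSpace ℝ (Fin n) → ℝ}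
    (hu : ContDiff ℝ 2 u) (e : EuclideanSpace ℝ (Fin n)) :
    ContDiff ℝ 1 (fun y => fderiv ℝ u y e) :=
  (hu.fderiv_right (m := 1) (by norm_num)).clm_apply contDiff_const

lemma continuous_lap {n : ℕ} {u : EuclideanSpace ℝ (Fin n) → ℝ} (hu : ContDiff ℝ 2 u) :
    Continuous (lap n u) := by
  unfold lap
  refine continuous_finsetSum _ fun i _ => ?_
  exact ((contDiff_one_fderiv_apply hu _).continuous_fderiv (by norm_num)).clm_apply
    continuous_const

lemma integral_fderiv_mul_radialWeight {n : ℕ} {u : EuclideanSpace ℝ (Fin n) → ℝ}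
    (hu : ContDiff ℝ 2 u) (x : EuclideanSpace ℝ (Fin n)) (r : ℝ) :
    ∫ z, fderiv ℝ u (x + r • z) z * radialWeight n z =
      r * ∫ z, lap n u (x + r • z) * radialPotential n z := by
  have hw := continuous_radialWeight n
  have hp := continuous_radialPotential n
  have hD (i : Fin n) : ContDiff ℝ 1 (fun y => fderiv ℝ u y (EuclideanSpace.single i 1)) :=
    contDiff_one_fderiv_apply hu _
  have hDD (i : Fin n) : Continuous (fun y => fderiv ℝ
      (fun y => fderiv ℝ u y (EuclideanSpace.single i 1)) y (EuclideanSpace.single i 1)) :=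
    ((hD i).continuous_fderiv (by norm_num)).clm_apply continuous_const
  have hDc (i : Fin n) : Continuous
      (fun z => fderiv ℝ u (x + r • z) (EuclideanSpace.single i 1)) :=
    (hD i).continuous.comp (by fun_prop)
  have hDDc (i : Fin n) : Continuous (fun z => fderiv ℝ
      (fun y => fderiv ℝ u y (EuclideanSpace.single i 1)) (x + r • z)
        (EuclideanSpace.single i 1)) :=
    (hDD i).comp (by fun_prop)
  have hexp (z : EuclideanSpace ℝ (Fin n)) : fderiv ℝ u (x + r • z) z * radialWeight n z =
      ∑ i, fderiv ℝ u (x + r • z) (EuclideanSpace.single i 1) * (z i * radialWeight n z) := by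
    have hz : z = ∑ i, z i • EuclideanSpace.single i (1 : ℝ) := by
      simpa using ((EuclideanSpace.basisFun (Fin n) ℝ).sum_repr z).symm
    conv_lhs => rw [show fderiv ℝ u (x + r • z) z = fderiv ℝ u (x + r • z)
      (∑ i, z i • EuclideanSpace.single i (1 : ℝ)) by rw [← hz]]
    rw [map_sum, Finset.sum_mul]
    refine Finset.sum_congr rfl fun i _ => ?_
    simp only [map_smul, smul_eq_mul]
    ring
  have hint1 (i : Fin n) : Integrable (fun z => fderiv ℝ u (x + r • z)
      (EuclideanSpace.single i 1) * (z i * radialWeight n z)) := by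
    refine Continuous.integrable_of_hasCompactSupport ?_ ?_
    · exact (hDc i).mul (Continuous.mul (by fun_prop) hw)
    · exact ((hasCompactSupport_radialWeight n).mul_left).mul_left
  have hint2 (i : Fin n) : Integrable (fun z => fderiv ℝ
      (fun y => fderiv ℝ u y (EuclideanSpace.single i 1)) (x + r • z)
        (EuclideanSpace.single i 1) * radialPotential n z) :=
    ((hDDc i).mul hp).integrable_of_hasCompactSupport
      (hasCompactSupport_radialPotential n).mul_left
  have hchain (i : Fin n) (z : EuclideanSpace ℝ (Fin n)) :
      HasFDerivAt (fun z => fderiv ℝ u (x + r • z) (EuclideanSpace.single i 1))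
        (r • fderiv ℝ (fun y => fderiv ℝ u y (EuclideanSpace.single i 1)) (x + r • z)) z := by
    have h1 : HasFDerivAt (fun z : EuclideanSpace ℝ (Fin n) => x + r • z)
        (r • ContinuousLinearMap.id ℝ (EuclideanSpace ℝ (Fin n))) z :=
      ((hasFDerivAt_id z).const_smul r).const_add x
    have h2 := (((hD i).differentiable (by norm_num)) (x + r • z)).hasFDerivAt.comp z h1
    refine h2.congr_fderiv ?_
    ext y
    simp
  have hibp (i : Fin n) : ∫ z, fderiv ℝ u (x + r • z) (EuclideanSpace.single i 1) *
      (z i * radialWeight n z) = r * ∫ z, fderiv ℝ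
      (fun y => fderiv ℝ u y (EuclideanSpace.single i 1)) (x + r • z)
        (EuclideanSpace.single i 1) * radialPotential n z := by
    have h := integral_mul_fderiv_eq_neg_fderiv_mul_of_integrable (μ := volume)
      (f := fun z => fderiv ℝ u (x + r • z) (EuclideanSpace.single i 1))
      (g := radialPotential n) (v := EuclideanSpace.single i (1 : ℝ)) ?_ ?_ ?_
      (fun z _ => (hchain i z).differentiableAt)
      (fun z _ => (hasFDerivAt_radialPotential z).differentiableAt)
    · simp only [fderiv_radialPotential_single, (hchain i _).fderiv, mul_neg, integral_neg,
        neg_inj] at h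
      rw [h, ← integral_const_mul]
      refine integral_congr_ae (.of_forall fun z => ?_)
      simp [mul_assoc]
    · refine ((hint2 i).const_mul r).congr (.of_forall fun z => ?_)
      simp [(hchain i _).fderiv, mul_assoc]
    · refine (hint1 i).neg.congr (.of_forall fun z => ?_)
      simp [fderiv_radialPotential_single]
    · exact ((hDc i).mul hp).integrable_of_hasCompactSupport
        (hasCompactSupport_radialPotential n).mul_left
  simp_rw [hexp, lap, Finset.sum_mul]
  rw [integral_finsetSum _ fun i _ => hint1 i, integral_finsetSum _ fun i _ => hint2 i,
    Finset.mul_sum]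
  exact Finset.sum_congr rfl fun i _ => hibp i

lemma hasDerivAt_integral_mul_radialWeight {n : ℕ} {u : EuclideanSpace ℝ (Fin n) → ℝ}
    (hu : ContDiff ℝ 2 u) (x : EuclideanSpace ℝ (Fin n)) (r : ℝ) :
    HasDerivAt (fun r : ℝ => ∫ z, u (x + r • z) * radialWeight n z)
      (r * ∫ z, lap n u (x + r • z) * radialPotential n z) r := by
  have hw := continuous_radialWeight n
  have huc := hu.continuous
  have hDu : Continuous (fderiv ℝ u) := hu.continuous_fderiv (by norm_num)
  rw [← integral_fderiv_mul_radialWeight hu]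
  have hcomp : IsCompact ((fun p : ℝ × EuclideanSpace ℝ (Fin n) => x + p.1 • p.2) ''
      (Set.Icc (r - 1) (r + 1) ×ˢ closedBall 0 1)) :=
    (isCompact_Icc.prod (isCompact_closedBall 0 1)).image (by fun_prop)
  obtain ⟨B, hB⟩ := hcomp.exists_bound_of_continuousOn hDu.continuousOn
  have hdiff (z : EuclideanSpace ℝ (Fin n)) (s : ℝ) :
      HasDerivAt (fun s : ℝ => u (x + s • z) * radialWeight n z)
        (fderiv ℝ u (x + s • z) z * radialWeight n z) s := by
    have h1 : HasDerivAt (fun s : ℝ => x + s • z) z s := by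
      simpa using ((hasDerivAt_id s).smul_const z).const_add x
    have h2 := (hu.differentiable (by norm_num) (x + s • z)).hasFDerivAt.comp_hasDerivAt s h1
    exact h2.mul_const _
  refine (hasDerivAt_integral_of_dominated_loc_of_deriv_le
    (F := fun (r : ℝ) z => u (x + r • z) * radialWeight n z)
    (F' := fun (r : ℝ) z => fderiv ℝ u (x + r • z) z * radialWeight n z)
    (bound := fun z => B * radialWeight n z)
    (Icc_mem_nhds (sub_one_lt r) (lt_add_one r)) ?_ ?_ ?_ ?_ ?_ ?_).2
  · refine .of_forall fun s => Continuous.aestronglyMeasurable ?_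
    exact (huc.comp (by fun_prop)).mul hw
  · exact ((huc.comp (by fun_prop)).mul hw).integrable_of_hasCompactSupport
      (hasCompactSupport_radialWeight n).mul_left
  · refine Continuous.aestronglyMeasurable ?_
    exact ((hDu.comp (by fun_prop)).clm_apply continuous_id).mul hw
  · refine .of_forall fun z s hs => ?_
    by_cases hz : z ∈ ball (0 : EuclideanSpace ℝ (Fin n)) 1
    · have h1 := hB (x + s • z) ⟨(s, z), ⟨hs, ball_subset_closedBall hz⟩, rfl⟩
      rw [norm_mul, norm_of_nonneg (radialWeight_nonneg z)]
      refine mul_le_mul_of_nonneg_right ?_ (radialWeight_nonneg z)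
      calc ‖fderiv ℝ u (x + s • z) z‖ ≤ ‖fderiv ℝ u (x + s • z)‖ * ‖z‖ :=
            ContinuousLinearMap.le_opNorm _ _
        _ ≤ ‖fderiv ℝ u (x + s • z)‖ * 1 := by
            gcongr; exact (mem_ball_zero_iff.1 hz).le
        _ ≤ B := by rw [mul_one]; exact h1
    · simp [radialWeight_eq_zero hz]
  · exact (hw.integrable_of_hasCompactSupport (hasCompactSupport_radialWeight n)).const_mul B
  · exact .of_forall fun z s _ => hdiff z s

lemma integral_mul_radialPotential_le {n : ℕ} {g : EuclideanSpace ℝ (Fin n) → ℝ}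
    (hg : Continuous g) (hg0 : ∀ z, 0 ≤ g z) :
    ∫ z, g z * radialPotential n z ≤ ∫ z in ball (0 : EuclideanSpace ℝ (Fin n)) 1, g z := by
  have hgi : IntegrableOn g (ball 0 1) :=
    (hg.continuousOn.integrableOn_compact (isCompact_closedBall 0 1)).mono_set
      ball_subset_closedBall
  rw [← setIntegral_eq_integral_of_forall_compl_eq_zero (s := ball 0 1)
    fun z hz => by rw [radialPotential_eq_zero hz, mul_zero]]
  refine integral_mono_of_nonneg (.of_forall fun z => ?_) hgi (.of_forall fun z => ?_)
  · exact mul_nonneg (hg0 z) (radialPotential_nonneg z)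
  · exact mul_le_of_le_one_right (hg0 z) (radialPotential_le_one z)

lemma mul_integral_radialWeight_le {n : ℕ} {u : EuclideanSpace ℝ (Fin n) → ℝ}
    (hu : ContDiff ℝ 2 u) (hlap : ∀ x, lap n u x ≤ 0) {x : EuclideanSpace ℝ (Fin n)}
    {δ b p q : ℝ} (hδ0 : 0 < δ) (hδ1 : δ < 1) (hq : 0 ≤ q)
    (hb : ∀ w ∈ ball x δ, -lap n u w ≤ b / δ ^ 2)
    (hpq : ∀ r, 0 < r → r < 1 →
      ∫ z in ball (0 : EuclideanSpace ℝ (Fin n)) 1, -lap n u (x + r • z) ≤ p / r ^ 2 + q) :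
    u x * ∫ z, radialWeight n z ≤ (∫ z, u (x + z) * radialWeight n z) +
      b * volume.real (ball (0 : EuclideanSpace ℝ (Fin n)) 1) + p * log (1 / δ) + q := by
  set A : ℝ → ℝ := fun r => ∫ z, u (x + r • z) * radialWeight n z with hA
  set D : ℝ → ℝ := fun r => ∫ z, lap n u (x + r • z) * radialPotential n z with hD
  set m := volume.real (ball (0 : EuclideanSpace ℝ (Fin n)) 1) with hm
  have hm0 : 0 ≤ m := measureReal_nonneg
  have hder (r : ℝ) : HasDerivAt A (r * D r) r := hasDerivAt_integral_mul_radialWeight hu x r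
  have hgc (r : ℝ) : Continuous fun z => -lap n u (x + r • z) :=
    ((continuous_lap hu).comp (by fun_prop)).neg
  have hDle (r : ℝ) : -D r ≤
      ∫ z in ball (0 : EuclideanSpace ℝ (Fin n)) 1, -lap n u (x + r • z) := by
    have := integral_mul_radialPotential_le (hgc r) fun z => by linarith [hlap (x + r • z)]
    simpa [hD, integral_neg] using this
  have hDsmall (r : ℝ) (hr0 : 0 < r) (hrδ : r < δ) : -D r ≤ b / δ ^ 2 * m := by
    refine (hDle r).trans ?_
    have hi : IntegrableOn (fun z => -lap n u (x + r • z)) (ball 0 1) :=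
      ((hgc r).continuousOn.integrableOn_compact (isCompact_closedBall 0 1)).mono_set
        ball_subset_closedBall
    calc ∫ z in ball (0 : EuclideanSpace ℝ (Fin n)) 1, -lap n u (x + r • z)
        ≤ ∫ z in ball (0 : EuclideanSpace ℝ (Fin n)) 1, b / δ ^ 2 := by
          refine setIntegral_mono_on hi (integrableOn_const measure_ball_lt_top.ne)
            measurableSet_ball fun z hz => hb _ ?_
          rw [mem_ball, dist_eq_norm, add_sub_cancel_left, norm_smul, norm_of_nonneg hr0.le]
          rw [mem_ball_zero_iff] at hz
          nlinarith [norm_nonneg z]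
      _ = b / δ ^ 2 * m := by simp [hm, mul_comm]
  have hb0 : 0 ≤ b := by
    have h1 := hb x (mem_ball_self hδ0)
    have h2 : 0 ≤ b / δ ^ 2 := by linarith [hlap x]
    by_contra h
    exact absurd h2 (not_le.2 (div_neg_of_neg_of_pos (not_le.1 h) (by positivity)))
  have mono1 : MonotoneOn (fun r => A r + b * m / δ * r) (Set.Icc 0 δ) := by
    have hd (r : ℝ) : HasDerivAt (fun r => A r + b * m / δ * r) (r * D r + b * m / δ) r := by
      simpa using (hder r).fun_add ((hasDerivAt_id r).const_mul (b * m / δ))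
    refine monotoneOn_of_deriv_nonneg (convex_Icc _ _)
      (fun r _ => (hd r).continuousAt.continuousWithinAt)
      (fun r _ => (hd r).differentiableAt.differentiableWithinAt) fun r hr => ?_
    rw [interior_Icc] at hr
    rw [(hd r).deriv]
    have h1 := mul_le_mul_of_nonneg_left (hDsmall r hr.1 hr.2) hr.1.le
    have h2 : r * (b / δ ^ 2 * m) ≤ δ * (b / δ ^ 2 * m) :=
      mul_le_mul_of_nonneg_right hr.2.le (by positivity)
    have h3 : δ * (b / δ ^ 2 * m) = b * m / δ := by field_simp
    linarith
  have mono2 : MonotoneOn (fun r => A r + p * log r + q * r) (Set.Icc δ 1) := by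
    have hd (r : ℝ) (hr : 0 < r) :
        HasDerivAt (fun r => A r + p * log r + q * r) (r * D r + p * r⁻¹ + q) r := by
      simpa using ((hder r).fun_add ((hasDerivAt_log hr.ne').const_mul p)).fun_add
        ((hasDerivAt_id r).const_mul q)
    refine monotoneOn_of_deriv_nonneg (convex_Icc _ _)
      (fun r hr => (hd r (hδ0.trans_le hr.1)).continuousAt.continuousWithinAt)
      (fun r hr => ?_) fun r hr => ?_ <;> rw [interior_Icc] at hr
    · exact (hd r (hδ0.trans hr.1)).differentiableAt.differentiableWithinAt
    have hr0 : 0 < r := hδ0.trans hr.1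
    rw [(hd r hr0).deriv]
    have h1 := mul_le_mul_of_nonneg_left ((hDle r).trans (hpq r hr0 hr.2)) hr0.le
    have h2 : r * (p / r ^ 2 + q) = p * r⁻¹ + r * q := by field_simp
    have h3 : r * q ≤ q := mul_le_of_le_one_left hq hr.2.le
    linarith
  have e1 := mono1 (Set.left_mem_Icc.2 hδ0.le) (Set.right_mem_Icc.2 hδ0.le) hδ0.le
  have e2 := mono2 (Set.left_mem_Icc.2 hδ1.le) (Set.right_mem_Icc.2 hδ1.le) hδ1.le
  have hA0 : A 0 = u x * ∫ z, radialWeight n z := by simp [hA, integral_const_mul]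
  have hA1 : A 1 = ∫ z, u (x + z) * radialWeight n z := by simp [hA]
  have hbm : b * m / δ * δ = b * m := by field_simp
  simp only [log_one, mul_zero, mul_one, add_zero, hbm] at e1 e2
  rw [← hA0, ← hA1, one_div, log_inv]
  have : 0 ≤ q * δ := by positivity
  linarith

lemma integrableOn_norm_sub_rpow_neg {n : ℕ} (hn : 2 ≤ n) {s : ℝ} (hs : s < n)
    (w : EuclideanSpace ℝ (Fin n)) :
    IntegrableOn (fun z : EuclideanSpace ℝ (Fin n) => ‖w - z‖ ^ (-s)) (ball 0 1) := by
  set k : EuclideanSpace ℝ (Fin n) → ℝ :=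
    (ball 0 (‖w‖ + 1)).indicator (fun z => ‖z‖ ^ (-s)) with hk
  have hki : Integrable k :=
    (integrable_indicator_iff measurableSet_ball).2 (integrableOn_norm_rpow_neg hn hs _)
  refine (hki.comp_sub_left w).integrableOn.congr_fun (fun z hz => ?_) measurableSet_ball
  have : w - z ∈ ball (0 : EuclideanSpace ℝ (Fin n)) (‖w‖ + 1) := by
    rw [mem_ball_zero_iff] at hz ⊢
    linarith [norm_sub_le w z]
  simp only [hk, Set.indicator_of_mem this]

lemma setIntegral_norm_sub_rpow_neg_le {n : ℕ} (hn : 2 ≤ n) {s : ℝ} (hs0 : 0 < s) (hs : s < n)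
    (w : EuclideanSpace ℝ (Fin n)) :
    ∫ z in ball (0 : EuclideanSpace ℝ (Fin n)) 1, ‖w - z‖ ^ (-s) ≤
      (∫ z in ball (0 : EuclideanSpace ℝ (Fin n)) 1, ‖z‖ ^ (-s)) +
        volume.real (ball (0 : EuclideanSpace ℝ (Fin n)) 1) := by
  have h := integral_div_norm_rpow_le hn hs0 hs
    (h := (ball (0 : EuclideanSpace ℝ (Fin n)) 1).indicator 1) (w := w) (δ := 1) (H := 1)
    (fun y => Set.indicator_nonneg (fun _ _ => zero_le_one) y)
    ((integrable_indicator_iff measurableSet_ball).2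
      (integrableOn_const measure_ball_lt_top.ne)) one_pos
    (fun y _ => Set.indicator_le_self' (fun _ _ => zero_le_one) y)
  rw [integral_indicator_one measurableSet_ball] at h
  simp only [one_rpow, mul_one, one_mul] at h
  refine le_trans (le_of_eq ?_) h
  rw [← integral_indicator measurableSet_ball]
  refine integral_congr_ae (.of_forall fun z => ?_)
  by_cases hz : z ∈ ball (0 : EuclideanSpace ℝ (Fin n)) 1
  · simp only [Set.indicator_of_mem hz, rpow_neg (norm_nonneg _), Pi.one_apply, one_div]
  · simp only [Set.indicator_of_notMem hz, zero_div]

lemma setIntegral_integral_div_norm_sq_le {n : ℕ} (hn : 3 ≤ n)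
    {f : EuclideanSpace ℝ (Fin n) → ℝ} (hf0 : ∀ y, 0 ≤ f y) (hf : Integrable f)
    (x : EuclideanSpace ℝ (Fin n)) {r : ℝ} (hr0 : 0 < r) (hr1 : r < 1) :
    ∫ z in ball (0 : EuclideanSpace ℝ (Fin n)) 1, ∫ y, f y / ‖x + r • z - y‖ ^ (2 : ℝ) ≤
      ((∫ z in ball (0 : EuclideanSpace ℝ (Fin n)) 1, ‖z‖ ^ (-2 : ℝ)) +
        volume.real (ball (0 : EuclideanSpace ℝ (Fin n)) 1)) *
        ((∫ y in ball x 2, f y) / r ^ 2 + ∫ y, f y) := by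
  have hs : (2 : ℝ) < n := by exact_mod_cast hn
  set K := ∫ z in ball (0 : EuclideanSpace ℝ (Fin n)) 1, ‖z‖ ^ (-2 : ℝ) with hK
  set m := volume.real (ball (0 : EuclideanSpace ℝ (Fin n)) 1) with hm
  have hm0 : 0 ≤ m := measureReal_nonneg
  have hK0 : 0 ≤ K := integral_nonneg fun z => rpow_nonneg (norm_nonneg _) _
  set κ : EuclideanSpace ℝ (Fin n) → EuclideanSpace ℝ (Fin n) → ℝ :=
    fun z y => ‖x + r • z - y‖ ^ (-2 : ℝ) with hκ
  have hκ0 (z y) : 0 ≤ κ z y := rpow_nonneg (norm_nonneg _) _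
  have hκscale (z y) : κ z y = r ^ (-2 : ℝ) * ‖r⁻¹ • (y - x) - z‖ ^ (-2 : ℝ) := by
    have h1 : x + r • z - y = -(r • (r⁻¹ • (y - x) - z)) := by
      rw [smul_sub, smul_inv_smul₀ hr0.ne']; abel
    simp only [hκ, h1, norm_neg, norm_smul, norm_of_nonneg hr0.le]
    rw [mul_rpow hr0.le (norm_nonneg _)]
  have hκi (y) : IntegrableOn (fun z => κ z y) (ball 0 1) := by
    simp_rw [hκscale]
    exact (integrableOn_norm_sub_rpow_neg (by omega) hs _).const_mul _
  have hκle (y) : ∫ z in ball (0 : EuclideanSpace ℝ (Fin n)) 1, κ z y ≤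
      (K + m) * ((ball x 2).indicator 1 y / r ^ 2 + 1) := by
    by_cases hy : y ∈ ball x 2
    · rw [Set.indicator_of_mem hy]
      simp_rw [hκscale]
      rw [integral_const_mul, rpow_neg hr0.le, rpow_two]
      have h1 := mul_le_mul_of_nonneg_left
        (setIntegral_norm_sub_rpow_neg_le (by omega) two_pos hs (r⁻¹ • (y - x)))
        (show 0 ≤ (r ^ 2)⁻¹ by positivity)
      have h2 : (K + m) * ((1 : EuclideanSpace ℝ (Fin n) → ℝ) y / r ^ 2 + 1) =
          (r ^ 2)⁻¹ * (K + m) + (K + m) := by simp; ring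
      rw [h2]
      linarith
    · rw [Set.indicator_of_notMem hy, zero_div, zero_add, mul_one]
      calc ∫ z in ball (0 : EuclideanSpace ℝ (Fin n)) 1, κ z y
          ≤ ∫ z in ball (0 : EuclideanSpace ℝ (Fin n)) 1, 1 := by
            refine setIntegral_mono_on (hκi y) (integrableOn_const measure_ball_lt_top.ne)
              measurableSet_ball fun z hz => ?_
            refine rpow_le_one_of_one_le_of_nonpos ?_ (by norm_num)
            rw [mem_ball, dist_eq_norm, not_lt] at hy
            have h1 : ‖y - x‖ ≤ ‖x + r • z - y‖ + ‖r • z‖ := by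
              have h2 := norm_sub_le (r • z) (x + r • z - y)
              rw [show r • z - (x + r • z - y) = y - x by abel] at h2
              linarith
            rw [norm_smul, norm_of_nonneg hr0.le] at h1
            rw [mem_ball_zero_iff] at hz
            nlinarith [norm_nonneg z]
        _ = m := by simp [hm]
        _ ≤ K + m := by linarith
  have hfi2 : Integrable (fun y => (K + m) * ((ball x 2).indicator f y / r ^ 2 + f y)) :=
    (((hf.indicator measurableSet_ball).div_const _).add hf).const_mul _
  have hnn (y) : 0 ≤ (K + m) * ((ball x 2).indicator f y / r ^ 2 + f y) := by
    have : 0 ≤ (ball x 2).indicator f y := Set.indicator_nonneg (fun y _ => hf0 y) y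
    have := hf0 y
    positivity
  have hval : ∫ y, (K + m) * ((ball x 2).indicator f y / r ^ 2 + f y) =
      (K + m) * ((∫ y in ball x 2, f y) / r ^ 2 + ∫ y, f y) := by
    rw [integral_const_mul, integral_add ((hf.indicator measurableSet_ball).div_const _) hf,
      integral_div, integral_indicator measurableSet_ball]
  have hmeas : AEMeasurable (Function.uncurry fun z y => ‖f y * κ z y‖ₑ)
      ((volume.restrict (ball (0 : EuclideanSpace ℝ (Fin n)) 1)).prod volume) := by
    refine AEMeasurable.enorm (AEMeasurable.mul ?_ ?_)
    · exact hf.1.aemeasurable.comp_snd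
    · refine Measurable.aemeasurable (Measurable.pow_const ?_ _)
      exact Continuous.measurable (by fun_prop)
  have hfκ (z y) : f y / ‖x + r • z - y‖ ^ (2 : ℝ) = f y * κ z y := by
    simp only [hκ]
    rw [rpow_neg (norm_nonneg _), div_eq_mul_inv]
  simp_rw [hfκ]
  rw [← hval, ← ENNReal.ofReal_le_ofReal_iff (integral_nonneg hnn)]
  calc ENNReal.ofReal (∫ z in ball (0 : EuclideanSpace ℝ (Fin n)) 1, ∫ y, f y * κ z y)
      ≤ ‖∫ z in ball (0 : EuclideanSpace ℝ (Fin n)) 1, ∫ y, f y * κ z y‖ₑ :=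
        Real.ofReal_le_enorm _
    _ ≤ ∫⁻ z in ball (0 : EuclideanSpace ℝ (Fin n)) 1, ‖∫ y, f y * κ z y‖ₑ :=
        enorm_integral_le_lintegral_enorm _
    _ ≤ ∫⁻ z in ball (0 : EuclideanSpace ℝ (Fin n)) 1, ∫⁻ y, ‖f y * κ z y‖ₑ :=
        lintegral_mono fun z => enorm_integral_le_lintegral_enorm _
    _ = ∫⁻ y, ∫⁻ z in ball (0 : EuclideanSpace ℝ (Fin n)) 1, ‖f y * κ z y‖ₑ :=
        lintegral_lintegral_swap hmeas
    _ ≤ ∫⁻ y, ENNReal.ofReal ((K + m) * ((ball x 2).indicator f y / r ^ 2 + f y)) := by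
        refine lintegral_mono fun y => ?_
        have h1 : ∀ z, ‖f y * κ z y‖ₑ = ENNReal.ofReal (f y * κ z y) := fun z =>
          Real.enorm_of_nonneg (mul_nonneg (hf0 y) (hκ0 z y))
        simp_rw [h1]
        rw [← ofReal_integral_eq_lintegral_ofReal ((hκi y).const_mul _)
          (.of_forall fun z => mul_nonneg (hf0 y) (hκ0 z y)), integral_const_mul]
        refine ENNReal.ofReal_le_ofReal ((mul_le_mul_of_nonneg_left (hκle y) (hf0 y)).trans_eq ?_)
        by_cases hy : y ∈ ball x 2
        · simp only [Set.indicator_of_mem hy, Pi.one_apply]; ring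
        · simp only [Set.indicator_of_notMem hy]; ring
    _ = _ := (ofReal_integral_eq_lintegral_ofReal hfi2 (.of_forall hnn)).symm

lemma exists_setIntegral_ball_le {n : ℕ} {f : EuclideanSpace ℝ (Fin n) → ℝ}
    (hf0 : ∀ y, 0 ≤ f y) (hf : Integrable f) (ρ : ℝ) {ε : ℝ} (hε : 0 < ε) :
    ∃ R : ℝ, ∀ x : EuclideanSpace ℝ (Fin n), R ≤ ‖x‖ → ∫ y in ball x ρ, f y ≤ ε := by
  have h := tendsto_setIntegral_of_antitone (μ := volume) (f := f)
    (s := fun m : ℕ => (ball (0 : EuclideanSpace ℝ (Fin n)) m)ᶜ)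
    (fun m => measurableSet_ball.compl)
    (fun a b hab => Set.compl_subset_compl.2 (ball_subset_ball (by exact_mod_cast hab)))
    ⟨0, hf.integrableOn⟩
  have he : ⋂ m : ℕ, (ball (0 : EuclideanSpace ℝ (Fin n)) m)ᶜ = ∅ := by
    rw [← Set.compl_iUnion, iUnion_ball_nat, Set.compl_univ]
  rw [he, setIntegral_empty] at h
  obtain ⟨m, hm⟩ := (h.eventually (gt_mem_nhds hε)).exists
  refine ⟨m + ρ, fun x hx => le_trans ?_ hm.le⟩
  refine setIntegral_mono_set hf.integrableOn (.of_forall hf0)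
    (LE.le.eventuallyLE fun y hy => ?_)
  rw [mem_ball, dist_comm, dist_eq_norm] at hy
  rw [Set.mem_compl_iff, mem_ball_zero_iff, not_lt]
  linarith [norm_le_norm_add_norm_sub' x y]

lemma V_nonneg {n : ℕ} {μ : ℝ} (u : EuclideanSpace ℝ (Fin n) → ℝ)
    (x : EuclideanSpace ℝ (Fin n)) : 0 ≤ V n μ u x :=
  integral_nonneg fun _ => div_nonneg (exp_pos _).le (rpow_nonneg (norm_nonneg _) _)

lemma integral_mul_radialWeight_le_integral_exp {n : ℕ} {u : EuclideanSpace ℝ (Fin n) → ℝ}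
    (hu : Continuous u) {k : ℝ} (hk : 0 < k) (hui : Integrable fun y => exp (k * u y))
    (x : EuclideanSpace ℝ (Fin n)) :
    ∫ z, u (x + z) * radialWeight n z ≤ (∫ y, exp (k * u y)) / k := by
  rw [← integral_add_left_eq_self (fun y => exp (k * u y)) x, ← integral_div]
  refine integral_mono ?_ ((hui.comp_add_left x).div_const k) fun z => ?_
  · exact ((hu.comp (by fun_prop)).mul (continuous_radialWeight n)).integrable_of_hasCompactSupport
      (hasCompactSupport_radialWeight n).mul_left
  · have h1 : u (x + z) ≤ exp (k * u (x + z)) / k := by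
      rw [le_div_iff₀ hk]
      linarith [add_one_le_exp (k * u (x + z))]
    exact (mul_le_mul_of_nonneg_right h1 (radialWeight_nonneg z)).trans
      (mul_le_of_le_one_right (by positivity) (radialWeight_le_one z))

lemma integral_radialWeight_pos (n : ℕ) : 0 < ∫ z, radialWeight n z :=
  (continuous_radialWeight n).integral_pos_of_hasCompactSupport_nonneg_nonzero
    (hasCompactSupport_radialWeight n) radialWeight_nonneg (x := 0) (by simp [radialWeight])

/-- If the nonlinearity has small mass near the maximum point of the weighted function
`(1 - ‖x - x₀‖) e^{A u}`, rescaling around that point bounds `u x₀`. -/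
lemma exists_bound_of_small_mass {n : ℕ} (hn : 2 ≤ n) {μ : ℝ} (hμ0 : 0 < μ) (hμn : μ < n)
    {u : EuclideanSpace ℝ (Fin n) → ℝ} (hu : ContDiff ℝ 2 u)
    (hInt1 : Integrable
      (fun y : EuclideanSpace ℝ (Fin n) => V n μ u y * Real.exp ((2 * n - μ) / 2 * u y)))
    (hInt2 : Integrable
      (fun y : EuclideanSpace ℝ (Fin n) => Real.exp ((2 * n - μ) / 2 * u y)))
    (hlap : ∀ x, lap n u x ≤ 0) {C₁ C₂ : ℝ} (hC₂ : 0 < C₂)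
    (hlocal : ∀ (w : EuclideanSpace ℝ (Fin n)) (δ H : ℝ), 0 < δ →
      (∀ y ∈ ball w δ, V n μ u y * Real.exp ((2 * n - μ) / 2 * u y) ≤ H) →
      -lap n u w ≤ C₁ * (H * δ ^ n + 1) / δ ^ 2)
    (hmean : ∀ (x : EuclideanSpace ℝ (Fin n)) (r : ℝ), 0 < r → r < 1 →
      ∫ z in ball (0 : EuclideanSpace ℝ (Fin n)) 1, -lap n u (x + r • z) ≤
        C₂ * ((∫ y in ball x 2, V n μ u y * Real.exp ((2 * n - μ) / 2 * u y)) / r ^ 2 + 1)) :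
    ∃ ε > (0 : ℝ), ∃ C : ℝ, ∀ x : EuclideanSpace ℝ (Fin n),
      ∫ y in ball x 3, V n μ u y * Real.exp ((2 * n - μ) / 2 * u y) ≤ ε → u x ≤ C := by
  set k : ℝ := (2 * n - μ) / 2 with hk
  set f : EuclideanSpace ℝ (Fin n) → ℝ := fun y => V n μ u y * Real.exp (k * u y) with hf
  have hf0 (y) : 0 ≤ f y := mul_nonneg (V_nonneg u y) (exp_pos _).le
  have hk0 : 0 < k := by rw [hk]; linarith
  have hnμ : 0 < n - μ := by linarith
  set A : ℝ := k / (n - μ) with hA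
  have hA0 : 0 < A := by positivity
  have hkA : k = A * (n - μ) := by rw [hA]; field_simp
  set c₀ : ℝ := ∫ z, radialWeight n z with hc₀
  have hc₀0 : 0 < c₀ := integral_radialWeight_pos n
  set E₀ : ℝ := ∫ y, exp (k * u y) with hE₀
  have hE₀0 : 0 ≤ E₀ := integral_nonneg fun y => (exp_pos _).le
  set K : ℝ := ∫ z in ball (0 : EuclideanSpace ℝ (Fin n)) 1, ‖z‖ ^ (-μ) with hK
  have hK0 : 0 ≤ K := integral_nonneg fun z => rpow_nonneg (norm_nonneg _) _
  set τ : ℝ := 2 ^ ((n : ℝ) - μ) with hτ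
  have hτ0 : 0 < τ := by positivity
  set b : ℝ := C₁ * ((K * τ + E₀) * τ + 1) with hb
  set m := volume.real (ball (0 : EuclideanSpace ℝ (Fin n)) 1) with hm
  set M₁ : ℝ := 2 * (E₀ / k + b * m + C₂) / c₀ with hM₁
  refine ⟨c₀ / (2 * C₂ * A), by positivity, max (log 6 / A) M₁, fun x₀ hx₀ => ?_⟩
  obtain ⟨x₁, hx₁, hmax⟩ := (isCompact_closedBall x₀ 1).exists_isMaxOn
    (f := fun x => (1 - dist x x₀) * exp (A * u x)) ⟨x₀, mem_closedBall_self zero_le_one⟩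
    (by have := hu.continuous; fun_prop)
  set d : ℝ := 1 - dist x₁ x₀ with hd
  have hmax' (x) (hx : dist x x₀ ≤ 1) : (1 - dist x x₀) * exp (A * u x) ≤ d * exp (A * u x₁) :=
    hmax hx
  have h00 : exp (A * u x₀) ≤ d * exp (A * u x₁) := by simpa using hmax' x₀ (by simp)
  have hd0 : 0 < d := by
    by_contra h
    have := mul_nonpos_of_nonpos_of_nonneg (not_lt.1 h) (exp_pos (A * u x₁)).le
    linarith [exp_pos (A * u x₀)]
  have hd1 : d ≤ 1 := by rw [hd]; linarith [dist_nonneg (x := x₁) (y := x₀)]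
  by_cases hcase : d * exp (A * u x₁) ≤ 6
  · refine le_max_of_le_left ?_
    rw [le_div_iff₀ hA0, mul_comm, le_log_iff_exp_le (by norm_num)]
    exact h00.trans hcase
  refine le_max_of_le_right ?_
  have hx₀₁ : u x₀ ≤ u x₁ := by
    have : exp (A * u x₀) ≤ exp (A * u x₁) :=
      h00.trans (mul_le_of_le_one_left (exp_pos _).le hd1)
    exact le_of_mul_le_mul_left (exp_le_exp.1 this) hA0
  refine hx₀₁.trans ?_
  set δ : ℝ := exp (-(A * u x₁)) with hδ
  have hδ0 : 0 < δ := exp_pos _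
  have hδd : 6 * δ < d := by
    rw [not_le] at hcase
    have h1 : exp (A * u x₁) * δ = 1 := by rw [hδ, ← exp_add, add_neg_cancel, exp_zero]
    have := mul_lt_mul_of_pos_right hcase hδ0
    rwa [mul_assoc, h1, mul_one] at this
  have hδ1 : δ < 1 := by linarith
  have hloc (y) (hy : dist y x₁ < 3 * δ) : exp (k * u y) ≤ τ * δ ^ (-((n : ℝ) - μ)) := by
    have h1 : dist y x₀ ≤ 1 - d / 2 := by
      have := dist_triangle y x₁ x₀
      rw [hd] at *
      linarith
    have h2 : exp (A * u y) ≤ 2 * δ⁻¹ := by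
      have h3 := hmax' y (by linarith)
      have h4 : d / 2 * exp (A * u y) ≤ (1 - dist y x₀) * exp (A * u y) :=
        mul_le_mul_of_nonneg_right (by linarith) (exp_pos _).le
      have h5 : δ⁻¹ = exp (A * u x₁) := by rw [hδ, exp_neg, inv_inv]
      rw [h5]
      refine le_of_mul_le_mul_left ?_ (half_pos hd0)
      linarith
    have h3 : exp (k * u y) = exp (A * u y) ^ ((n : ℝ) - μ) := by
      rw [← exp_mul, hkA]; ring_nf
    rw [h3, hτ, rpow_neg hδ0.le, ← inv_rpow hδ0.le, ← mul_rpow two_pos.le (inv_nonneg.2 hδ0.le)]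
    exact rpow_le_rpow (exp_pos _).le h2 hnμ.le
  have hδμ : 1 ≤ δ ^ (-μ) := one_le_rpow_of_pos_of_le_one_of_nonpos hδ0 hδ1.le (by linarith)
  have hV (y) (hy : dist y x₁ < 2 * δ) : V n μ u y ≤ (K * τ + E₀) * δ ^ (-μ) := by
    have h1 := integral_div_norm_rpow_le hn hμ0 hμn (h := fun y => exp (k * u y))
      (fun y => (exp_pos _).le) hInt2 (w := y) hδ0
      (fun z hz => hloc z (by linarith [dist_triangle z y x₁, mem_ball.1 hz]))
    have h2 : K * (τ * δ ^ (-((n : ℝ) - μ))) * δ ^ ((n : ℝ) - μ) = K * τ := by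
      rw [rpow_neg hδ0.le]
      have := (rpow_pos_of_pos hδ0 ((n : ℝ) - μ)).ne'
      field_simp
    rw [← hK, h2] at h1
    refine h1.trans ?_
    have : K * τ * 1 ≤ K * τ * δ ^ (-μ) := mul_le_mul_of_nonneg_left hδμ (by positivity)
    linarith
  have hfle (y) (hy : dist y x₁ < 2 * δ) : f y ≤ (K * τ + E₀) * τ * (δ ^ n)⁻¹ := by
    have h1 := mul_le_mul (hV y hy) (hloc y (by linarith)) (exp_pos _).le (by positivity)
    refine h1.trans_eq ?_
    have h2 : (δ ^ n)⁻¹ = δ ^ (-μ) * δ ^ (-((n : ℝ) - μ)) := by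
      rw [← rpow_add hδ0, ← rpow_natCast, ← rpow_neg hδ0.le]
      ring_nf
    rw [h2]
    ring
  have hg (w) (hw : w ∈ ball x₁ δ) : -lap n u w ≤ b / δ ^ 2 := by
    have h1 := hlocal w δ _ hδ0 fun y hy =>
      hfle y (by linarith [dist_triangle y w x₁, mem_ball.1 hw, mem_ball.1 hy])
    rwa [inv_mul_cancel_right₀ (by positivity)] at h1
  set η : ℝ := ∫ y in ball x₁ 2, f y with hη
  have hηle : η ≤ c₀ / (2 * C₂ * A) := by
    refine le_trans (setIntegral_mono_set hInt1.integrableOn (.of_forall hf0)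
      (LE.le.eventuallyLE fun y hy => ?_)) hx₀
    rw [mem_ball] at hy ⊢
    linarith [dist_triangle y x₁ x₀]
  have hfin := mul_integral_radialWeight_le hu hlap hδ0 hδ1 hC₂.le hg (p := C₂ * η)
    fun r hr0 hr1 => (hmean x₁ r hr0 hr1).trans_eq (by ring)
  have hlog : log (1 / δ) = A * u x₁ := by rw [one_div, log_inv, hδ, log_exp, neg_neg]
  have hpos : 0 < A * u x₁ := by
    rw [← hlog]
    exact log_pos (one_lt_one_div hδ0 hδ1)
  have hmass : C₂ * η * (A * u x₁) ≤ c₀ / 2 * u x₁ := by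
    have h1 : C₂ * η * (A * u x₁) ≤ C₂ * (c₀ / (2 * C₂ * A)) * (A * u x₁) := by gcongr
    refine h1.trans_eq ?_
    field_simp
  have hS := integral_mul_radialWeight_le_integral_exp hu.continuous hk0 hInt2 x₁
  rw [hlog] at hfin
  rw [hM₁, le_div_iff₀ hc₀0]
  linarith

lemma exists_upper_bound {n : ℕ} (hn : 2 ≤ n) {μ : ℝ} (hμ0 : 0 < μ) (hμn : μ < n)
    {u : EuclideanSpace ℝ (Fin n) → ℝ} (hu : Continuous u)
    (hInt1 : Integrable
      (fun y : EuclideanSpace ℝ (Fin n) => V n μ u y * Real.exp ((2 * n - μ) / 2 * u y)))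
    (hInt2 : Integrable
      (fun y : EuclideanSpace ℝ (Fin n) => Real.exp ((2 * n - μ) / 2 * u y)))
    (hsmall : ∃ ε > (0 : ℝ), ∃ C : ℝ, ∀ x : EuclideanSpace ℝ (Fin n),
      ∫ y in ball x 3, V n μ u y * Real.exp ((2 * n - μ) / 2 * u y) ≤ ε → u x ≤ C) :
    ∃ C > (0 : ℝ), ∀ x : EuclideanSpace ℝ (Fin n), u x ≤ C ∧ V n μ u x ≤ C := by
  obtain ⟨ε, hε, C, hC⟩ := hsmall
  obtain ⟨R, hR⟩ := exists_setIntegral_ball_le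
    (fun y => mul_nonneg (V_nonneg u y) (exp_pos _).le) hInt1 3 hε
  obtain ⟨B, hB⟩ := (isCompact_closedBall (0 : EuclideanSpace ℝ (Fin n)) R).bddAbove_image
    hu.continuousOn
  have hle (x) : u x ≤ max B C := by
    rcases le_total ‖x‖ R with h | h
    · exact le_max_of_le_left (hB ⟨x, by simpa using h, rfl⟩)
    · exact le_max_of_le_right (hC x (hR x h))
  have hk0 : 0 < (2 * (n : ℝ) - μ) / 2 := by linarith
  have hVle (x) := integral_div_norm_rpow_le hn hμ0 hμn
    (h := fun y => exp ((2 * n - μ) / 2 * u y)) (fun y => (exp_pos _).le) hInt2 (w := x) one_pos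
    (H := exp ((2 * n - μ) / 2 * max B C))
    (fun y _ => exp_le_exp.2 (mul_le_mul_of_nonneg_left (hle y) hk0.le))
  exact ⟨max (max 1 (max B C)) _, lt_max_of_lt_left (lt_max_of_lt_left one_pos), fun x =>
    ⟨le_max_of_le_left (le_max_of_le_right (hle x)), le_max_of_le_right (hVle x)⟩⟩

theorem upper_bound_u_v (n : ℕ) (hn : 2 ≤ n) (μ : ℝ) (hμ0 : 0 < μ) (hμn : μ < n)
    (u : EuclideanSpace ℝ (Fin n) → ℝ) (hu : ContDiff ℝ 2 u)
    (hInt1 : Integrable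
      (fun y : EuclideanSpace ℝ (Fin n) => V n μ u y * Real.exp ((2 * n - μ) / 2 * u y)))
    (hInt2 : Integrable
      (fun y : EuclideanSpace ℝ (Fin n) => Real.exp ((2 * n - μ) / 2 * u y)))
    (hEq2 : n = 2 → ∀ x : EuclideanSpace ℝ (Fin n),
      lap n u x + V n μ u x * Real.exp ((4 - μ) / 2 * u x) = 0)
    (hEq3 : 3 ≤ n → ∀ x : EuclideanSpace ℝ (Fin n),
      lap n u x + (n - 2) *
        ∫ y, V n μ u y * Real.exp ((2 * n - μ) / 2 * u y) / ‖x - y‖ ^ (2 : ℝ) = 0) :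
    ∃ C > (0 : ℝ), ∀ x : EuclideanSpace ℝ (Fin n), u x ≤ C ∧ V n μ u x ≤ C := by
  have hf0 (y) : 0 ≤ V n μ u y * Real.exp ((2 * n - μ) / 2 * u y) :=
    mul_nonneg (V_nonneg u y) (exp_pos _).le
  refine exists_upper_bound hn hμ0 hμn hu.continuous hInt1 hInt2 ?_
  rcases hn.eq_or_lt with rfl | hn3
  · have hlap (x) : -lap 2 u x = V 2 μ u x * Real.exp ((2 * (2 : ℕ) - μ) / 2 * u x) := by
      have h := hEq2 rfl x
      norm_num
      linarith
    refine exists_bound_of_small_mass hn hμ0 hμn hu hInt1 hInt2 (C₁ := 1) (C₂ := 1)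
      (fun x => by linarith [hlap x, hf0 x]) one_pos ?_ ?_
    · intro w δ H hδ hH
      rw [hlap, one_mul, le_div_iff₀ (by positivity)]
      have := mul_le_mul_of_nonneg_right (hH w (mem_ball_self hδ)) (sq_nonneg δ)
      linarith
    · intro x r hr0 hr1
      set f : EuclideanSpace ℝ (Fin 2) → ℝ :=
        fun y => V 2 μ u y * Real.exp ((2 * (2 : ℕ) - μ) / 2 * u y) with hf
      simp_rw [hlap]
      have h := Measure.setIntegral_comp_smul_of_pos
        (volume : Measure (EuclideanSpace ℝ (Fin 2))) (fun z => f (x + z)) (ball 0 1) hr0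
      rw [smul_unitBall_of_pos hr0, finrank_euclideanSpace, Fintype.card_fin, smul_eq_mul] at h
      have h2 : ∫ z in ball (0 : EuclideanSpace ℝ (Fin 2)) r, f (x + z) ≤
          ∫ y in ball x 2, f y := by
        rw [← integral_indicator measurableSet_ball, ← integral_indicator measurableSet_ball,
          ← integral_add_left_eq_self ((ball x 2).indicator f) x]
        refine integral_mono_of_nonneg
          (.of_forall fun z => Set.indicator_nonneg (fun z _ => hf0 (x + z)) z)
          ((hInt1.indicator measurableSet_ball).comp_add_left x) (.of_forall fun z => ?_)
        by_cases hz : z ∈ ball (0 : EuclideanSpace ℝ (Fin 2)) r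
        · have hz' : x + z ∈ ball x 2 := by
            rw [mem_ball_zero_iff] at hz
            rw [mem_ball, dist_eq_norm, add_sub_cancel_left]
            linarith
          simp only [Set.indicator_of_mem hz, Set.indicator_of_mem hz', le_refl]
        · simp only [Set.indicator_of_notMem hz]
          exact Set.indicator_nonneg (fun z _ => hf0 z) _
      have h3 := mul_le_mul_of_nonneg_left h2 (show 0 ≤ (r ^ 2)⁻¹ by positivity)
      rw [← h] at h3
      rw [one_mul, div_eq_inv_mul (∫ y in ball x 2, f y)]
      exact h3.trans (le_add_of_nonneg_right zero_le_one)
  · have hn3' : 3 ≤ n := hn3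
    have hs : (2 : ℝ) < n := by exact_mod_cast hn3
    have hlap (x) : -lap n u x = (n - 2) *
        ∫ y, V n μ u y * Real.exp ((2 * n - μ) / 2 * u y) / ‖x - y‖ ^ (2 : ℝ) := by
      linarith [hEq3 hn3' x]
    set f : EuclideanSpace ℝ (Fin n) → ℝ :=
      fun y => V n μ u y * Real.exp ((2 * n - μ) / 2 * u y) with hf
    set F : ℝ := ∫ y, f y with hF
    have hF0 : 0 ≤ F := integral_nonneg hf0
    set K : ℝ := ∫ z in ball (0 : EuclideanSpace ℝ (Fin n)) 1, ‖z‖ ^ (-2 : ℝ) with hK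
    have hK0 : 0 ≤ K := integral_nonneg fun z => rpow_nonneg (norm_nonneg _) _
    set m := volume.real (ball (0 : EuclideanSpace ℝ (Fin n)) 1) with hm
    have hm0 : 0 ≤ m := measureReal_nonneg
    have hn2 : 0 < (n : ℝ) - 2 := by linarith
    refine exists_bound_of_small_mass hn hμ0 hμn hu hInt1 hInt2 (C₁ := (n - 2) * (K + F))
      (C₂ := (n - 2) * ((K + m) * (F + 1)) + 1) ?_ (by positivity) ?_ ?_
    · intro x
      have : 0 ≤ ∫ y, f y / ‖x - y‖ ^ (2 : ℝ) :=
        integral_nonneg fun y => div_nonneg (hf0 y) (rpow_nonneg (norm_nonneg _) _)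
      have := mul_nonneg hn2.le this
      linarith [hlap x]
    · intro w δ H hδ hH
      have hH0 : 0 ≤ H := (hf0 w).trans (hH w (mem_ball_self hδ))
      rw [hlap]
      have h1 := integral_div_norm_rpow_le hn two_pos hs hf0 hInt1 hδ hH
      have h2 : δ ^ ((n : ℝ) - 2) = δ ^ n / δ ^ 2 := by
        rw [rpow_sub hδ, rpow_natCast, rpow_two]
      rw [h2, rpow_neg hδ.le, rpow_two] at h1
      rw [mul_assoc, mul_div_assoc]
      refine mul_le_mul_of_nonneg_left (h1.trans ?_) hn2.le
      rw [le_div_iff₀ (by positivity), add_mul]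
      have e1 : K * H * (δ ^ n / δ ^ 2) * δ ^ 2 = K * H * δ ^ n := by field_simp
      have e2 : (δ ^ 2)⁻¹ * F * δ ^ 2 = F := by field_simp
      rw [e1, e2]
      have : 0 ≤ F * (H * δ ^ n) := by positivity
      linarith
    · intro x r hr0 hr1
      simp_rw [hlap]
      rw [integral_const_mul]
      have h1 := setIntegral_integral_div_norm_sq_le hn3' hf0 hInt1 x hr0 hr1
      set η := ∫ y in ball x 2, f y with hη
      have hη0 : 0 ≤ η / r ^ 2 := div_nonneg (integral_nonneg hf0) (by positivity)
      have h2 : η / r ^ 2 + F ≤ (F + 1) * (η / r ^ 2 + 1) := by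
        have := mul_nonneg hF0 hη0
        linarith
      have h3 := h1.trans (mul_le_mul_of_nonneg_left h2 (by positivity))
      have h4 := mul_le_mul_of_nonneg_left h3 hn2.le
      linarith
end
end
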